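/- arXiv:2409.00290 — 4 statements merged into one kernel-verified Lean document; each statement's English description precedes it below -/
import Mathlib

section
/- The Lagrangian concordance relation γ₋ ⪯ γ₊ (defined by the existence of a Lagrangian concordance from γ₋ to γ₊) on Legendrian knots in the standard contact ℝ³ is reflexive and transitive: (i) for every Legendrian knot γ, the cylinder C(s,θ) = (s, γ(θ)) is a Lagrangian concordance from γ to γ; and (ii) if there exists a Lagrangian concordance from γ₀ to γ₁ and a Lagrangian concordance from γ₁ to γ₂, then there exists a Lagrangian concordance from γ₀ to γ₂. -/
/-!
Common definitions: the standard contact `ℝ³` with contact form `α = dz - y dx`,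
Legendrian knots, its symplectization `ℝ_t × ℝ³` with `ω = d(e^t α)`,
Lagrangian concordances, smooth unknottedness, and Legendrian isotopy.

A point of `ℝ³` is `(x, y, z) : ℝ × ℝ × ℝ`; a point of the symplectization is
`(t, x, y, z) : ℝ × ℝ × ℝ × ℝ`, and tangent vectors are encoded the same way.
-/

noncomputable section

open Real

/-- Points (or tangent vectors) `(x,y,z)` of `ℝ³`. -/
abbrev R3 : Type := ℝ × ℝ × ℝ

/-- Points (or tangent vectors) `(t,x,y,z)` of the symplectization `ℝ_t × ℝ³`. -/
abbrev R4 : Type := ℝ × ℝ × ℝ × ℝ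

/-- A Legendrian knot in the standard contact `(ℝ³, dz - y dx)`: a smooth `2π`-periodic
map `γ : ℝ → ℝ³` descending to an injective map of `ℝ/2πℤ`, immersed (`γ' ≠ 0`), and
tangent to the contact distribution: `γ₃' = γ₂ ⬝ γ₁'`. -/
def IsLegendrianKnot (γ : ℝ → R3) : Prop :=
  ContDiff ℝ (⊤ : ℕ∞) γ ∧
  (∀ t : ℝ, γ (t + 2 * π) = γ t) ∧
  (∀ t t' : ℝ, γ t = γ t' → ∃ k : ℤ, t' = t + 2 * π * k) ∧
  (∀ t : ℝ, deriv γ t ≠ 0) ∧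
  (∀ t : ℝ, (deriv γ t).2.2 = (γ t).2.1 * (deriv γ t).1)

/-- The symplectic form `ω = d(e^t (dz - y dx))` of the symplectization, evaluated at the
point `p = (t,x,y,z)` on tangent vectors `v = (a₁,b₁,c₁,d₁)` and `w = (a₂,b₂,c₂,d₂)`:
`ω_p(v,w) = e^t ((a₁d₂ - a₂d₁) - y (a₁b₂ - a₂b₁) - (c₁b₂ - c₂b₁))`. -/
def symplForm (p : R4) (v w : R4) : ℝ :=
  Real.exp p.1 *
    ((v.1 * w.2.2.2 - w.1 * v.2.2.2)
      - p.2.2.1 * (v.1 * w.2.1 - w.1 * v.2.1)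
      - (v.2.2.1 * w.2.1 - w.2.2.1 * v.2.1))

/-- The partial derivative `∂ₛC` of a map `C` of two real variables `(s, θ)`. -/
def Ds {E : Type*} [NormedAddCommGroup E] [NormedSpace ℝ E]
    (C : ℝ × ℝ → E) (p : ℝ × ℝ) : E :=
  deriv (fun s : ℝ => C (s, p.2)) p.1

/-- The partial derivative `∂_θC` of a map `C` of two real variables `(s, θ)`. -/
def Dtheta {E : Type*} [NormedAddCommGroup E] [NormedSpace ℝ E]
    (C : ℝ × ℝ → E) (p : ℝ × ℝ) : E :=
  deriv (fun θ : ℝ => C (p.1, θ)) p.2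

/-- A Lagrangian concordance from the Legendrian knot `γm` to the Legendrian knot `γp`
in the symplectization `(ℝ_t × ℝ³, d(e^t α))`: a smooth map `C : ℝ × ℝ → ℝ × ℝ³`,
`2π`-periodic in the second variable, descending to a proper injective immersion of
`ℝ × (ℝ/2πℤ)`, with `ω(∂ₛC, ∂_θC) = 0` everywhere, which coincides with the cylinder
over `γm` (resp. `γp`) for `s ≤ -T` (resp. `s ≥ T`). -/
def IsLagrangianConcordance (C : ℝ × ℝ → R4) (γm γp : ℝ → R3) : Prop :=
  ContDiff ℝ (⊤ : ℕ∞) C ∧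
  (∀ s θ : ℝ, C (s, θ + 2 * π) = C (s, θ)) ∧
  (∀ s θ s' θ' : ℝ, C (s, θ) = C (s', θ') → s = s' ∧ ∃ k : ℤ, θ' = θ + 2 * π * k) ∧
  (∀ p : ℝ × ℝ, ∀ a b : ℝ, a • Ds C p + b • Dtheta C p = 0 → a = 0 ∧ b = 0) ∧
  (∀ K : Set R4, IsCompact K → ∃ M : ℝ, ∀ s θ : ℝ, C (s, θ) ∈ K → |s| ≤ M) ∧
  (∀ p : ℝ × ℝ, symplForm (C p) (Ds C p) (Dtheta C p) = 0) ∧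
  (∃ T : ℝ, 0 < T ∧
    (∀ s θ : ℝ, s ≤ -T → C (s, θ) = (s, γm θ)) ∧
    (∀ s θ : ℝ, T ≤ s → C (s, θ) = (s, γp θ)))

/-- The closed round unit disc in `ℝ²`. -/
def unitDisc : Set (ℝ × ℝ) := {p : ℝ × ℝ | p.1 ^ 2 + p.2 ^ 2 ≤ 1}

/-- A (`2π`-periodic parametrized) knot `γ` in `ℝ³` is smoothly unknotted if it extends to
a smooth embedding of the closed unit `2`-disc into `ℝ³`. -/
def SmoothlyUnknotted (γ : ℝ → R3) : Prop :=
  ∃ F : ℝ × ℝ → R3, ContDiff ℝ (⊤ : ℕ∞) F ∧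
    Set.InjOn F unitDisc ∧
    (∀ p ∈ unitDisc, Function.Injective (fderiv ℝ F p)) ∧
    (∀ θ : ℝ, F (Real.cos θ, Real.sin θ) = γ θ)

/-- Two Legendrian knots are Legendrian isotopic if they are connected by a smooth family
of Legendrian knots parametrized by `[0,1]`. -/
def LegendrianIsotopic (γ₀ γ₁ : ℝ → R3) : Prop :=
  ∃ H : ℝ × ℝ → R3, ContDiff ℝ (⊤ : ℕ∞) H ∧
    (∀ θ : ℝ, H (0, θ) = γ₀ θ) ∧
    (∀ θ : ℝ, H (1, θ) = γ₁ θ) ∧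
    (∀ u ∈ Set.Icc (0 : ℝ) 1, IsLegendrianKnot (fun θ : ℝ => H (u, θ)))

open Filter Topology

/-- The translate by `a` in the symplectization direction, reparametrized so that cylinders
are preserved. -/
def translateCylinder (a : ℝ) (C : ℝ × ℝ → R4) : ℝ × ℝ → R4 :=
  fun p => C (p.1 - a, p.2) + (a, 0)

lemma Ds_translateCylinder (a : ℝ) (C : ℝ × ℝ → R4) (p : ℝ × ℝ) :
    Ds (translateCylinder a C) p = Ds C (p.1 - a, p.2) := by
  simp only [Ds, translateCylinder, deriv_add_const]
  exact deriv_comp_sub_const (f := fun s => C (s, p.2)) ..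

lemma Dtheta_translateCylinder (a : ℝ) (C : ℝ × ℝ → R4) (p : ℝ × ℝ) :
    Dtheta (translateCylinder a C) p = Dtheta C (p.1 - a, p.2) := by
  simp only [Dtheta, translateCylinder, deriv_add_const]

lemma symplForm_translate (a : ℝ) (p v w : R4) :
    symplForm (p + (a, 0)) v w = Real.exp a * symplForm p v w := by
  simp only [symplForm, Prod.fst_add, Prod.snd_add, Real.exp_add, add_zero]
  ring

lemma ContDiff.translateCylinder {C : ℝ × ℝ → R4} (hC : ContDiff ℝ (⊤ : ℕ∞) C) (a : ℝ) :
    ContDiff ℝ (⊤ : ℕ∞) (translateCylinder a C) :=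
  (hC.comp ((contDiff_fst.sub contDiff_const).prodMk contDiff_snd)).add contDiff_const

lemma Ds_congr_of_eventuallyEq {C D : ℝ × ℝ → R4} {p : ℝ × ℝ} (h : C =ᶠ[𝓝 p] D) :
    Ds C p = Ds D p := by
  have hc : Tendsto (fun s : ℝ => (s, p.2)) (𝓝 p.1) (𝓝 p) :=
    (by fun_prop : Continuous fun s : ℝ => (s, p.2)).tendsto p.1
  exact (h.comp_tendsto hc).deriv_eq

lemma Dtheta_congr_of_eventuallyEq {C D : ℝ × ℝ → R4} {p : ℝ × ℝ} (h : C =ᶠ[𝓝 p] D) :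
    Dtheta C p = Dtheta D p := by
  have hc : Tendsto (fun θ : ℝ => (p.1, θ)) (𝓝 p.2) (𝓝 p) :=
    (by fun_prop : Continuous fun θ : ℝ => (p.1, θ)).tendsto p.2
  exact (h.comp_tendsto hc).deriv_eq

lemma IsCompact.exists_abs_fst_le {K : Set R4} (hK : IsCompact K) :
    ∃ M : ℝ, ∀ q ∈ K, |q.1| ≤ M := by
  obtain ⟨M, hM⟩ := hK.exists_bound_of_continuousOn (f := fun q : R4 => q.1) (by fun_prop)
  exact ⟨M, hM⟩

/-- A map which is periodic in `θ` has bounded first coordinate over bounded `s`. -/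
lemma exists_abs_fst_le_of_periodic {C : ℝ × ℝ → R4} (hC : Continuous C)
    (hper : ∀ s θ : ℝ, C (s, θ + 2 * π) = C (s, θ)) (T : ℝ) :
    ∃ B : ℝ, 0 ≤ B ∧ ∀ s θ : ℝ, |s| ≤ T → |(C (s, θ)).1| ≤ B := by
  have hK : IsCompact (C '' (Set.Icc (-T) T ×ˢ Set.Icc 0 (2 * π))) :=
    (isCompact_Icc.prod isCompact_Icc).image hC
  obtain ⟨B, hB⟩ := hK.exists_abs_fst_le
  refine ⟨max B 0, le_max_right _ _, fun s θ hs => ?_⟩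
  have hp : Function.Periodic (fun θ => C (s, θ)) (2 * π) := hper s
  obtain ⟨φ, hφ, h⟩ := hp.exists_mem_Ico₀ Real.two_pi_pos θ
  rw [show C (s, θ) = C (s, φ) from h]
  exact le_max_of_le_left (hB _ ⟨(s, φ), ⟨abs_le.mp hs, hφ.1, hφ.2.le⟩, rfl⟩)

/-- A map which is the cylinder over a curve at both ends is proper. -/
lemma proper_of_cylindrical_ends {C : ℝ × ℝ → R4} {γm γp : ℝ → R3} {T : ℝ}
    (hm : ∀ s θ : ℝ, s ≤ -T → C (s, θ) = (s, γm θ))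
    (hp : ∀ s θ : ℝ, T ≤ s → C (s, θ) = (s, γp θ)) (K : Set R4) (hK : IsCompact K) :
    ∃ M : ℝ, ∀ s θ : ℝ, C (s, θ) ∈ K → |s| ≤ M := by
  obtain ⟨M, hM⟩ := hK.exists_abs_fst_le
  refine ⟨max M T, fun s θ h => ?_⟩
  have h1 := hM _ h
  rcases le_total s (-T) with hs | hs
  · rw [hm s θ hs] at h1
    exact le_max_of_le_left h1
  rcases le_total T s with hs' | hs'
  · rw [hp s θ hs'] at h1
    exact le_max_of_le_left h1
  · exact le_max_of_le_right (abs_le.mpr ⟨hs, hs'⟩)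

/-- The cylinder over a Legendrian knot is a Lagrangian concordance. -/
theorem isLagrangianConcordance_cylinder {γ : ℝ → R3} (hγ : IsLegendrianKnot γ) :
    IsLagrangianConcordance (fun p : ℝ × ℝ => ((p.1, γ p.2) : R4)) γ γ := by
  obtain ⟨hsm, hper, hinj, himm, hleg⟩ := hγ
  have hs : ∀ p : ℝ × ℝ, Ds (fun p : ℝ × ℝ => ((p.1, γ p.2) : R4)) p = (1, 0) := fun p =>
    ((hasDerivAt_id p.1).prodMk (hasDerivAt_const p.1 (γ p.2))).deriv
  have ht : ∀ p : ℝ × ℝ,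
      Dtheta (fun p : ℝ × ℝ => ((p.1, γ p.2) : R4)) p = (0, deriv γ p.2) := fun p =>
    ((hasDerivAt_const p.2 p.1).prodMk
      ((hsm.differentiable (by simp)) p.2).hasDerivAt).deriv
  refine ⟨contDiff_fst.prodMk (hsm.comp contDiff_snd), fun s θ => by simp [hper], ?_, ?_,
    proper_of_cylindrical_ends (C := fun p => (p.1, γ p.2)) (γm := γ) (γp := γ) (T := 1)
      (fun _ _ _ => rfl) (fun _ _ _ => rfl), ?_,
    1, one_pos, fun _ _ _ => rfl, fun _ _ _ => rfl⟩
  · intro s θ s' θ' h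
    obtain ⟨h1, h2⟩ := Prod.mk.inj h
    exact ⟨h1, hinj _ _ h2⟩
  · intro p a b h
    rw [hs, ht] at h
    have h1 := congrArg Prod.fst h
    have h2 := congrArg Prod.snd h
    simp only [Prod.fst_add, Prod.snd_add, Prod.smul_fst, Prod.smul_snd, smul_zero, zero_add,
      add_zero, smul_eq_mul, mul_one, mul_zero, Prod.fst_zero, Prod.snd_zero] at h1 h2
    exact ⟨h1, (smul_eq_zero.mp h2).resolve_right (himm _)⟩
  · intro p
    rw [hs, ht]
    simp [symplForm, hleg]

/-- Lagrangian concordances can be concatenated: translate the first one far down and the second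
one far up in the symplectization direction, and glue along the cylinder over the middle knot. -/
theorem IsLagrangianConcordance.trans {γ₀ γ₁ γ₂ : ℝ → R3} {C D : ℝ × ℝ → R4}
    (hC : IsLagrangianConcordance C γ₀ γ₁) (hD : IsLagrangianConcordance D γ₁ γ₂) :
    ∃ E : ℝ × ℝ → R4, IsLagrangianConcordance E γ₀ γ₂ := by
  obtain ⟨Csm, Cper, Cinj, Cimm, -, Clag, S, hS, Cm, Cp⟩ := hC
  obtain ⟨Dsm, Dper, Dinj, Dimm, -, Dlag, T, hT, Dm, Dp⟩ := hD
  obtain ⟨B, hB0, hB⟩ := exists_abs_fst_le_of_periodic Csm.continuous Cper S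
  obtain ⟨B', hB0', hB'⟩ := exists_abs_fst_le_of_periodic Dsm.continuous Dper T
  obtain ⟨A, hA⟩ : ∃ A : ℝ, A = S + T + B + B' + 1 := ⟨_, rfl⟩
  have cyl : ∀ (a s : ℝ) (v : R3), ((s - a, v) : R4) + (a, 0) = (s, v) := by
    intro a s v
    simp
  let E : ℝ × ℝ → R4 := fun p =>
    if p.1 ≤ 0 then translateCylinder (-A) C p else translateCylinder A D p
  have EC : ∀ s θ : ℝ, s < 1 → E (s, θ) = translateCylinder (-A) C (s, θ) := by
    intro s θ hs
    by_cases h : s ≤ 0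
    · simp only [E, if_pos h]
    · simp only [E, if_neg h, translateCylinder]
      rw [Dm _ _ (by linarith), Cp _ _ (by linarith), cyl, cyl]
  have ED : ∀ s θ : ℝ, -1 < s → E (s, θ) = translateCylinder A D (s, θ) := by
    intro s θ hs
    by_cases h : s ≤ 0
    · simp only [E, if_pos h, translateCylinder]
      rw [Dm _ _ (by linarith), Cp _ _ (by linarith), cyl, cyl]
    · simp only [E, if_neg h]
  have nonpos : ∀ s θ : ℝ, s ≤ 0 → (E (s, θ)).1 ≤ 0 := by
    intro s θ hs
    rw [EC s θ (by linarith), translateCylinder]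
    rcases le_total S (s - -A) with h | h
    · rwa [Cp _ _ h, cyl]
    rcases le_total (s - -A) (-S) with h' | h'
    · rwa [Cm _ _ h', cyl]
    · have := (abs_le.mp (hB (s - -A) θ (abs_le.mpr ⟨h', h⟩))).2
      simp only [Prod.fst_add]
      linarith
  have pos : ∀ s θ : ℝ, 0 < s → 0 < (E (s, θ)).1 := by
    intro s θ hs
    rw [ED s θ (by linarith), translateCylinder]
    rcases le_total T (s - A) with h | h
    · rwa [Dp _ _ h, cyl]
    rcases le_total (s - A) (-T) with h' | h'
    · rwa [Dm _ _ h', cyl]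
    · have := (abs_le.mp (hB' (s - A) θ (abs_le.mpr ⟨h', h⟩))).1
      simp only [Prod.fst_add]
      linarith
  have loc : ∀ p : ℝ × ℝ,
      E =ᶠ[𝓝 p] translateCylinder (-A) C ∨ E =ᶠ[𝓝 p] translateCylinder A D := by
    intro p
    rcases lt_or_ge p.1 1 with h | h
    · exact .inl ((continuous_fst.continuousAt.eventually (gt_mem_nhds h)).mono
        fun q hq => EC q.1 q.2 hq)
    · exact .inr ((continuous_fst.continuousAt.eventually
        (lt_mem_nhds (by linarith : (-1 : ℝ) < p.1))).mono fun q hq => ED q.1 q.2 hq)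
  have Em : ∀ s θ : ℝ, s ≤ -(A + S + T) → E (s, θ) = (s, γ₀ θ) := by
    intro s θ hs
    rw [EC s θ (by linarith), translateCylinder, Cm _ _ (by linarith), cyl]
  have Ep : ∀ s θ : ℝ, A + S + T ≤ s → E (s, θ) = (s, γ₂ θ) := by
    intro s θ hs
    rw [ED s θ (by linarith), translateCylinder, Dp _ _ (by linarith), cyl]
  refine ⟨E, ?_, ?_, ?_, ?_, proper_of_cylindrical_ends Em Ep, ?_,
    A + S + T, by linarith, Em, Ep⟩
  · rw [contDiff_iff_contDiffAt]
    intro p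
    rcases loc p with h | h
    · exact (Csm.translateCylinder _).contDiffAt.congr_of_eventuallyEq h
    · exact (Dsm.translateCylinder _).contDiffAt.congr_of_eventuallyEq h
  · intro s θ
    simp only [E, translateCylinder, Cper, Dper]
  · intro s θ s' θ' h
    rcases le_or_gt s 0 with hs | hs <;> rcases le_or_gt s' 0 with hs' | hs'
    · rw [EC _ _ (by linarith), EC _ _ (by linarith)] at h
      obtain ⟨h1, h2⟩ := Cinj _ _ _ _ (add_right_cancel h)
      exact ⟨by simpa using h1, h2⟩
    · have h1 := nonpos s θ hs
      rw [h] at h1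
      exact absurd (pos s' θ' hs') h1.not_gt
    · have h1 := nonpos s' θ' hs'
      rw [← h] at h1
      exact absurd (pos s θ hs) h1.not_gt
    · rw [ED _ _ (by linarith), ED _ _ (by linarith)] at h
      obtain ⟨h1, h2⟩ := Dinj _ _ _ _ (add_right_cancel h)
      exact ⟨by simpa using h1, h2⟩
  · intro p a b
    rcases loc p with h | h <;>
      rw [Ds_congr_of_eventuallyEq h, Dtheta_congr_of_eventuallyEq h, Ds_translateCylinder,
        Dtheta_translateCylinder]
    · exact Cimm _ a b
    · exact Dimm _ a b
  · intro p
    rcases loc p with h | h <;>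
      rw [Ds_congr_of_eventuallyEq h, Dtheta_congr_of_eventuallyEq h, Ds_translateCylinder,
        Dtheta_translateCylinder, h.eq_of_nhds, translateCylinder, symplForm_translate]
    · rw [Clag, mul_zero]
    · rw [Dlag, mul_zero]

/-- The Lagrangian concordance relation on Legendrian knots in the
standard contact `ℝ³` is reflexive and transitive: (i) the trivial cylinder
`C(s,θ) = (s, γ(θ))` is a Lagrangian concordance from `γ` to itself; (ii) Lagrangian
concordances from `γ₀` to `γ₁` and from `γ₁` to `γ₂` yield one from `γ₀` to `γ₂`. -/
theorem lagrangian_concordance_refl_trans :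
    (∀ γ : ℝ → R3, IsLegendrianKnot γ →
      IsLagrangianConcordance (fun p : ℝ × ℝ => ((p.1, γ p.2) : R4)) γ γ) ∧
    (∀ γ₀ γ₁ γ₂ : ℝ → R3,
      IsLegendrianKnot γ₀ → IsLegendrianKnot γ₁ → IsLegendrianKnot γ₂ →
      (∃ C : ℝ × ℝ → R4, IsLagrangianConcordance C γ₀ γ₁) →
      (∃ C : ℝ × ℝ → R4, IsLagrangianConcordance C γ₁ γ₂) →
      ∃ C : ℝ × ℝ → R4, IsLagrangianConcordance C γ₀ γ₂) := by
  refine ⟨fun γ hγ => isLagrangianConcordance_cylinder hγ, ?_⟩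
  rintro γ₀ γ₁ γ₂ - - - ⟨C, hC⟩ ⟨D, hD⟩
  exact hC.trans hD
end
end

section
/- If two Legendrian knots γ₀ and γ₁ in the standard contact ℝ³ are Legendrian isotopic, then there exists a Lagrangian concordance from γ₀ to γ₁ (the Lagrangian trace cobordism of the Legendrian isotopy). In particular, the Lagrangian concordance relation descends to Legendrian isotopy classes. -/
/-!
Common definitions: the standard contact `ℝ³` with contact form `α = dz - y dx`,
Legendrian knots, its symplectization `ℝ_t × ℝ³` with `ω = d(e^t α)`,
Lagrangian concordances, smooth unknottedness, and Legendrian isotopy.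

A point of `ℝ³` is `(x, y, z) : ℝ × ℝ × ℝ`; a point of the symplectization is
`(t, x, y, z) : ℝ × ℝ × ℝ × ℝ`, and tangent vectors are encoded the same way.
-/

noncomputable section

open Real

open Filter Topology

theorem hasDerivAt_slice_fst {E : Type*} [NormedAddCommGroup E] [NormedSpace ℝ E]
    {f : ℝ × ℝ → E} (hf : Differentiable ℝ f) (s θ : ℝ) :
    HasDerivAt (fun s : ℝ => f (s, θ)) (fderiv ℝ f (s, θ) (1, 0)) s :=
  (hf (s, θ)).hasFDerivAt.comp_hasDerivAt s ((hasDerivAt_id s).prodMk (hasDerivAt_const s θ))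

theorem hasDerivAt_slice_snd {E : Type*} [NormedAddCommGroup E] [NormedSpace ℝ E]
    {f : ℝ × ℝ → E} (hf : Differentiable ℝ f) (s θ : ℝ) :
    HasDerivAt (fun θ : ℝ => f (s, θ)) (fderiv ℝ f (s, θ) (0, 1)) θ :=
  (hf (s, θ)).hasFDerivAt.comp_hasDerivAt θ ((hasDerivAt_const θ s).prodMk (hasDerivAt_id θ))

theorem contDiff_fderiv_apply_const {E F : Type*} [NormedAddCommGroup E] [NormedSpace ℝ E]
    [NormedAddCommGroup F] [NormedSpace ℝ F] {f : E → F} (hf : ContDiff ℝ (⊤ : ℕ∞) f) (v : E) :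
    ContDiff ℝ (⊤ : ℕ∞) (fun p => fderiv ℝ f p v) :=
  (hf.fderiv_right (m := (⊤ : ℕ∞)) (by exact_mod_cast le_top)).clm_apply contDiff_const

/-- Mixed second partial derivatives of a smooth function commute. -/
theorem fderiv_fderiv_apply_comm {E F : Type*} [NormedAddCommGroup E] [NormedSpace ℝ E]
    [NormedAddCommGroup F] [NormedSpace ℝ F] {f : E → F}
    (hf : ContDiff ℝ (⊤ : ℕ∞) f) (p v w : E) :
    fderiv ℝ (fun q => fderiv ℝ f q v) p w = fderiv ℝ (fun q => fderiv ℝ f q w) p v := by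
  have hd : DifferentiableAt ℝ (fderiv ℝ f) p :=
    (hf.fderiv_right (m := (⊤ : ℕ∞)) (by exact_mod_cast le_top)).differentiable (by simp) p
  have h : IsSymmSndFDerivAt ℝ f p :=
    hf.contDiffAt.isSymmSndFDerivAt (by
      simp only [minSmoothness_of_isRCLikeNormedField]
      exact WithTop.coe_le_coe.2 (le_top (a := (2 : ℕ∞))))
  rw [fderiv_clm_apply hd (differentiableAt_const v), fderiv_clm_apply hd (differentiableAt_const w)]
  simpa using h.eq w v

/-- The value `α(∂ₛγ)` of the contact form on the variation of a family of curves `γ`. -/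
def contactVariation (γ : ℝ × ℝ → R3) (p : ℝ × ℝ) : ℝ :=
  (fderiv ℝ γ p (1, 0)).2.2 - (γ p).2.1 * (fderiv ℝ γ p (1, 0)).1

/-- The trace of a family of curves `γ`, translated along the Reeb field `∂_z` by `α(∂ₛγ)`. -/
def legendrianTrace (γ : ℝ × ℝ → R3) (p : ℝ × ℝ) : R4 :=
  (p.1, (γ p).1, (γ p).2.1, (γ p).2.2 + contactVariation γ p)

theorem contDiff_contactVariation {γ : ℝ × ℝ → R3} (hγ : ContDiff ℝ (⊤ : ℕ∞) γ) :
    ContDiff ℝ (⊤ : ℕ∞) (contactVariation γ) := by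
  have h := contDiff_fderiv_apply_const hγ (1, 0)
  exact h.snd.snd.sub (hγ.snd.fst.mul h.fst)

theorem contDiff_legendrianTrace {γ : ℝ × ℝ → R3} (hγ : ContDiff ℝ (⊤ : ℕ∞) γ) :
    ContDiff ℝ (⊤ : ℕ∞) (legendrianTrace γ) :=
  contDiff_fst.prodMk (hγ.fst.prodMk (hγ.snd.fst.prodMk
    (hγ.snd.snd.add (contDiff_contactVariation hγ))))

theorem Ds_legendrianTrace {γ : ℝ × ℝ → R3} (hγ : ContDiff ℝ (⊤ : ℕ∞) γ) (p : ℝ × ℝ) :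
    Ds (legendrianTrace γ) p =
      (1, (fderiv ℝ γ p (1, 0)).1, (fderiv ℝ γ p (1, 0)).2.1,
        (fderiv ℝ γ p (1, 0)).2.2 + fderiv ℝ (contactVariation γ) p (1, 0)) := by
  obtain ⟨s, θ⟩ := p
  have h := hasDerivAt_slice_fst (hγ.differentiable (by simp)) s θ
  have hη := hasDerivAt_slice_fst ((contDiff_contactVariation hγ).differentiable (by simp)) s θ
  exact ((hasDerivAt_id s).prodMk (h.hasFDerivAt.fst.hasDerivAt.prodMk
    (h.hasFDerivAt.snd.fst.hasDerivAt.prodMk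
      (h.hasFDerivAt.snd.snd.hasDerivAt.add hη)))).deriv.trans (by simp)

theorem Dtheta_legendrianTrace {γ : ℝ × ℝ → R3} (hγ : ContDiff ℝ (⊤ : ℕ∞) γ) (p : ℝ × ℝ) :
    Dtheta (legendrianTrace γ) p =
      (0, (fderiv ℝ γ p (0, 1)).1, (fderiv ℝ γ p (0, 1)).2.1,
        (fderiv ℝ γ p (0, 1)).2.2 + fderiv ℝ (contactVariation γ) p (0, 1)) := by
  obtain ⟨s, θ⟩ := p
  have h := hasDerivAt_slice_snd (hγ.differentiable (by simp)) s θ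
  have hη := hasDerivAt_slice_snd ((contDiff_contactVariation hγ).differentiable (by simp)) s θ
  exact ((hasDerivAt_const θ s).prodMk (h.hasFDerivAt.fst.hasDerivAt.prodMk
    (h.hasFDerivAt.snd.fst.hasDerivAt.prodMk
      (h.hasFDerivAt.snd.snd.hasDerivAt.add hη)))).deriv.trans (by simp)

theorem symplForm_legendrianTrace {γ : ℝ × ℝ → R3} (hγ : ContDiff ℝ (⊤ : ℕ∞) γ)
    (hleg : ∀ p, (fderiv ℝ γ p (0, 1)).2.2 = (γ p).2.1 * (fderiv ℝ γ p (0, 1)).1) (p : ℝ × ℝ) :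
    symplForm (legendrianTrace γ p) (Ds (legendrianTrace γ) p)
      (Dtheta (legendrianTrace γ) p) = 0 := by
  have hg := (hγ.differentiable (by simp) p).hasFDerivAt
  have hs := ((contDiff_fderiv_apply_const hγ (1, 0)).differentiable (by simp) p).hasFDerivAt
  have ht := ((contDiff_fderiv_apply_const hγ (0, 1)).differentiable (by simp) p).hasFDerivAt
  have hη : HasFDerivAt (contactVariation γ) _ p := hs.snd.snd.sub (hg.snd.fst.mul hs.fst)
  have h0 := ht.snd.snd.sub (hg.snd.fst.mul ht.fst)
  have hzero : (fun q => (fderiv ℝ γ q (0, 1)).2.2 -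
      (γ q).2.1 * (fderiv ℝ γ q (0, 1)).1) = fun _ => 0 := by
    funext q
    rw [hleg q, sub_self]
  have h1 := DFunLike.congr_fun (h0.unique (hzero ▸ hasFDerivAt_const (0 : ℝ) p)) (1, 0)
  have hc := fderiv_fderiv_apply_comm hγ p (0, 1) (1, 0)
  rw [Ds_legendrianTrace hγ, Dtheta_legendrianTrace hγ, hη.fderiv]
  simp at h1
  rw [hc] at h1
  simp [symplForm, legendrianTrace, hleg p]
  linarith

theorem contactVariation_reparam {H : ℝ × ℝ → R3} (hH : Differentiable ℝ H)
    {ρ : ℝ → ℝ} (hρ : Differentiable ℝ ρ) (s θ : ℝ) :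
    contactVariation (fun p : ℝ × ℝ => H (ρ p.1, p.2)) (s, θ) =
      deriv ρ s * contactVariation H (ρ s, θ) := by
  have hd : Differentiable ℝ (fun p : ℝ × ℝ => H (ρ p.1, p.2)) := by fun_prop
  have h1 := hasDerivAt_slice_fst hd s θ
  have h2 := (hasDerivAt_slice_fst hH (ρ s) θ).scomp s (hρ s).hasDerivAt
  have h3 : fderiv ℝ (fun p : ℝ × ℝ => H (ρ p.1, p.2)) (s, θ) (1, 0) =
      deriv ρ s • fderiv ℝ H (ρ s, θ) (1, 0) := h1.unique h2
  simp only [contactVariation, h3, Prod.smul_fst, Prod.smul_snd, smul_eq_mul]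
  ring

/-- A smooth cutoff from `0` to `1` which is as slow as desired. -/
theorem exists_slow_transition {ε : ℝ} (hε : 0 < ε) :
    ∃ (ρ : ℝ → ℝ) (T : ℝ), ContDiff ℝ (⊤ : ℕ∞) ρ ∧ 0 < T ∧ (∀ s, ρ s ∈ Set.Icc (0 : ℝ) 1) ∧
      (∀ s ≤ -T, ρ s = 0 ∧ deriv ρ s = 0) ∧ (∀ s, T ≤ s → ρ s = 1 ∧ deriv ρ s = 0) ∧
      ∀ s, |deriv ρ s| < ε := by
  have hst : ContDiff ℝ (⊤ : ℕ∞) smoothTransition := smoothTransition.contDiff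
  have hleft : ∀ x ≤ 0, deriv smoothTransition x = 0 := fun x hx =>
    IsLocalMin.deriv_eq_zero <| Eventually.of_forall fun y => by
      rw [smoothTransition.zero_of_nonpos hx]
      exact smoothTransition.nonneg y
  have hright : ∀ x, 1 ≤ x → deriv smoothTransition x = 0 := fun x hx =>
    IsLocalMax.deriv_eq_zero <| Eventually.of_forall fun y => by
      rw [smoothTransition.one_of_one_le hx]
      exact smoothTransition.le_one y
  obtain ⟨M, hM⟩ := (isCompact_Icc (a := (0 : ℝ)) (b := 1)).exists_bound_of_continuousOn
    (hst.continuous_deriv (by simp)).continuousOn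
  have hM0 : 0 ≤ M := (norm_nonneg _).trans (hM 0 (by simp))
  have hbound : ∀ x, |deriv smoothTransition x| ≤ M := fun x => by
    by_cases hx : x ∈ Set.Icc (0 : ℝ) 1
    · exact hM x hx
    · rcases le_total x 0 with h | h
      · simpa [hleft x h] using hM0
      · have : 1 ≤ x := by
          by_contra hlt
          exact hx ⟨h, by linarith⟩
        simpa [hright x this] using hM0
  set T : ℝ := (M + 1) / ε with hT
  have hTpos : 0 < T := by positivity
  have hderiv : ∀ s, deriv (fun s => smoothTransition ((s + T) / (2 * T))) s =
      deriv smoothTransition ((s + T) / (2 * T)) * (1 / (2 * T)) := fun s =>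
    ((hst.differentiable (by simp) _).hasDerivAt.comp s
      (((hasDerivAt_id s).add_const T).div_const (2 * T))).deriv
  refine ⟨fun s => smoothTransition ((s + T) / (2 * T)), T, ?_, hTpos,
    fun s => ⟨smoothTransition.nonneg _, smoothTransition.le_one _⟩, fun s hs => ?_,
    fun s hs => ?_, fun s => ?_⟩
  · exact hst.comp ((contDiff_id.add contDiff_const).div_const _)
  · have hx : (s + T) / (2 * T) ≤ 0 := div_nonpos_of_nonpos_of_nonneg (by linarith) (by linarith)
    exact ⟨smoothTransition.zero_of_nonpos hx, by rw [hderiv, hleft _ hx, zero_mul]⟩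
  · have hx : 1 ≤ (s + T) / (2 * T) := by
      rw [le_div_iff₀ (by positivity)]
      linarith
    exact ⟨smoothTransition.one_of_one_le hx, by rw [hderiv, hright _ hx, zero_mul]⟩
  · rw [hderiv, abs_mul, abs_of_pos (by positivity : 0 < 1 / (2 * T)), mul_one_div,
      div_lt_iff₀ (by positivity)]
    have : ε * (2 * T) = 2 * (M + 1) := by
      rw [hT]
      field_simp
    linarith [hbound ((s + T) / (2 * T))]

/-- If `∂_θ f` does not vanish at `(u, θ)`, then `f(u', ·)` is injective near `θ`
for all `u'` near `u`. -/
theorem eventually_slice_injective {f : ℝ × ℝ → ℝ} (hf : ContDiff ℝ (⊤ : ℕ∞) f) {u θ : ℝ}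
    (h : fderiv ℝ f (u, θ) (0, 1) ≠ 0) :
    ∀ᶠ q : ℝ × ℝ × ℝ in 𝓝 (u, θ, θ), f (q.1, q.2.1) = f (q.1, q.2.2) → q.2.1 = q.2.2 := by
  have hev : ∀ᶠ p in 𝓝 (u, θ), fderiv ℝ f p (0, 1) ≠ 0 :=
    (contDiff_fderiv_apply_const hf (0, 1)).continuous.continuousAt.eventually_ne h
  obtain ⟨δ, hδ, hball⟩ := Metric.eventually_nhds_iff_ball.1 hev
  filter_upwards [Metric.ball_mem_nhds (u, θ, θ) hδ] with ⟨v, a, b⟩ hq heq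
  simp only [← ball_prod_same, Set.mem_prod] at hq
  obtain ⟨hv, ha, hb⟩ := hq
  have key : ∀ a b : ℝ, a ∈ Metric.ball θ δ → b ∈ Metric.ball θ δ → f (v, a) = f (v, b) →
      ¬ a < b := fun a b ha hb heq hab => by
    obtain ⟨ξ, hξ, hξ0⟩ := exists_hasDerivAt_eq_zero hab
      (hf.continuous.comp (by fun_prop : Continuous fun θ : ℝ => (v, θ))).continuousOn heq
      (fun x _ => hasDerivAt_slice_snd (hf.differentiable (by simp)) v x)
    refine hball (v, ξ) ?_ hξ0
    rw [← ball_prod_same]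
    exact ⟨hv, (convex_ball θ δ).ordConnected.out ha hb ⟨hξ.1.le, hξ.2.le⟩⟩
  exact le_antisymm (not_lt.1 (key b a hb ha heq.symm)) (not_lt.1 (key a b ha hb heq))

theorem IsLegendrianKnot.deriv_xy_ne_zero {γ : ℝ → R3} (h : IsLegendrianKnot γ) (t : ℝ) :
    (deriv γ t).1 ≠ 0 ∨ (deriv γ t).2.1 ≠ 0 := by
  by_contra! hc
  refine h.2.2.2.1 t (Prod.ext hc.1 (Prod.ext hc.2 ?_))
  rw [h.2.2.2.2 t, hc.1, mul_zero]
  rfl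

/-- Small vertical translations of a compact family of Legendrian knots keep its members
injective modulo `2π`. -/
theorem eventually_translate_injective {H : ℝ × ℝ → R3} (hH : ContDiff ℝ (⊤ : ℕ∞) H)
    (hleg : ∀ u ∈ Set.Icc (0 : ℝ) 1, IsLegendrianKnot (fun θ : ℝ => H (u, θ)))
    {k : ℝ × ℝ → ℝ} (hk : Continuous k)
    (hper : ∀ u ∈ Set.Icc (0 : ℝ) 1, ∀ θ, k (u, θ + 2 * π) = k (u, θ)) :
    ∀ᶠ ε in 𝓝 (0 : ℝ), ∀ u ∈ Set.Icc (0 : ℝ) 1, ∀ θ θ' : ℝ,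
      H (u, θ) + (0, 0, ε * k (u, θ)) = H (u, θ') + (0, 0, ε * k (u, θ')) →
        ∃ n : ℤ, θ' = θ + 2 * π * n := by
  have hHc := hH.continuous
  have hlocal : ∀ q ∈ Set.Icc (0 : ℝ) 1 ×ˢ Set.Icc 0 (2 * π) ×ˢ Set.Icc (-π) (3 * π),
      ∀ᶠ z : ℝ × ℝ × ℝ × ℝ in 𝓝 (0, q),
        H (z.2.1, z.2.2.1) + (0, 0, z.1 * k (z.2.1, z.2.2.1)) =
          H (z.2.1, z.2.2.2) + (0, 0, z.1 * k (z.2.1, z.2.2.2)) →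
        |z.2.2.1 - z.2.2.2| ≤ π → z.2.2.1 = z.2.2.2 := by
    rintro ⟨u, a, b⟩ ⟨hu, -, -⟩
    by_cases hab : H (u, a) = H (u, b)
    · obtain ⟨n, hn⟩ := (hleg u hu).2.2.1 a b hab
      rcases eq_or_ne n 0 with rfl | hn0
      · obtain rfl : b = a := by simpa using hn
        have hd := (hasDerivAt_slice_snd (hH.differentiable (by simp)) u b).deriv
        have hev : ∀ᶠ q : ℝ × ℝ × ℝ in 𝓝 (u, b, b),
            (H (q.1, q.2.1)).1 = (H (q.1, q.2.2)).1 →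
            (H (q.1, q.2.1)).2.1 = (H (q.1, q.2.2)).2.1 → q.2.1 = q.2.2 := by
          have hg := (hH.differentiable (by simp) (u, b)).hasFDerivAt
          rcases (hleg u hu).deriv_xy_ne_zero b with h | h <;> rw [hd] at h
          · filter_upwards [eventually_slice_injective hH.fst (u := u) (θ := b)
              (by rw [hg.fst.fderiv]; exact h)] with q hq h1 _ using hq h1
          · filter_upwards [eventually_slice_injective hH.snd.fst (u := u) (θ := b)
              (by rw [hg.snd.fst.fderiv]; exact h)] with q hq _ h2 using hq h2
        filter_upwards [(continuous_snd.tendsto ((0 : ℝ), u, b, b)).eventually hev]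
          with z hz heq _
        exact hz (by simpa using congrArg Prod.fst heq)
          (by simpa using congrArg (fun v : R3 => v.2.1) heq)
      · have hfar : π < |a - b| := by
          have h1 : (1 : ℝ) ≤ |(n : ℝ)| := by exact_mod_cast Int.one_le_abs hn0
          have h2 : a - b = -(2 * π * n) := by linarith
          rw [h2, abs_neg, abs_mul, abs_of_pos two_pi_pos]
          nlinarith [pi_pos]
        have hc : Continuous fun z : ℝ × ℝ × ℝ × ℝ => |z.2.2.1 - z.2.2.2| := by fun_prop
        filter_upwards [hc.continuousAt.eventually (lt_mem_nhds
          (show π < |((0 : ℝ), u, a, b).2.2.1 - ((0 : ℝ), u, a, b).2.2.2| from hfar))]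
          with z hz _ hle
        exact absurd hle (not_le.2 hz)
    · have hc : Continuous fun z : ℝ × ℝ × ℝ × ℝ =>
          (H (z.2.1, z.2.2.1) + (0, 0, z.1 * k (z.2.1, z.2.2.1))) -
          (H (z.2.1, z.2.2.2) + (0, 0, z.1 * k (z.2.1, z.2.2.2))) := by fun_prop
      have hne := hc.continuousAt.eventually_ne (x := ((0 : ℝ), u, a, b)) (y := 0) (by
        rw [sub_ne_zero]
        intro h
        refine hab ?_
        simpa [← Prod.zero_eq_mk] using h)
      filter_upwards [hne] with z hz heq _
      exact absurd (sub_eq_zero.2 heq) hz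
  have hcpt : IsCompact (Set.Icc (0 : ℝ) 1 ×ˢ Set.Icc 0 (2 * π) ×ˢ Set.Icc (-π) (3 * π)) :=
    isCompact_Icc.prod (isCompact_Icc.prod isCompact_Icc)
  filter_upwards [hcpt.eventually_forall_of_forall_eventually
    (P := fun (ε : ℝ) (q : ℝ × ℝ × ℝ) =>
      H (q.1, q.2.1) + (0, 0, ε * k (q.1, q.2.1)) =
        H (q.1, q.2.2) + (0, 0, ε * k (q.1, q.2.2)) →
      |q.2.1 - q.2.2| ≤ π → q.2.1 = q.2.2) hlocal] with ε hε u hu θ θ' heq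
  have hG : Function.Periodic (fun θ => H (u, θ) + ((0, 0, ε * k (u, θ)) : R3)) (2 * π) :=
    fun t => by
      have hHper : H (u, t + 2 * π) = H (u, t) := (hleg u hu).2.1 t
      dsimp only
      rw [hHper, hper u hu t]
  set a := toIcoMod two_pi_pos 0 θ with ha
  set b := toIcoMod two_pi_pos (a - π) θ' with hb
  have ha' := toIcoMod_mem_Ico two_pi_pos 0 θ
  have hb' := toIcoMod_mem_Ico two_pi_pos (a - π) θ'
  rw [← ha] at ha'
  rw [← hb] at hb'
  obtain ⟨ha1, ha2⟩ := ha'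
  obtain ⟨hb1, hb2⟩ := hb'
  have hθ : θ - toIcoDiv two_pi_pos 0 θ • (2 * π) = a := rfl
  have hθ' : θ' - toIcoDiv two_pi_pos (a - π) θ' • (2 * π) = b := rfl
  have hab : a = b := by
    refine hε (u, a, b) ⟨hu, ⟨ha1, by linarith⟩, by dsimp; linarith, by dsimp; linarith⟩ ?_
      (abs_le.2 ⟨by dsimp; linarith, by dsimp; linarith⟩)
    have h1 := hG.sub_zsmul_eq (x := θ) (toIcoDiv two_pi_pos 0 θ)
    have h2 := hG.sub_zsmul_eq (x := θ') (toIcoDiv two_pi_pos (a - π) θ')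
    rw [hθ] at h1
    rw [hθ'] at h2
    exact h1.trans (heq.trans h2.symm)
  refine ⟨toIcoDiv two_pi_pos (a - π) θ' - toIcoDiv two_pi_pos 0 θ, ?_⟩
  rw [← hθ', ← hθ] at hab
  simp only [zsmul_eq_mul] at hab
  push_cast
  rw [← hθ]
  simp only [zsmul_eq_mul]
  linarith

theorem contactVariation_periodic {γ : ℝ × ℝ → R3} (hγ : Differentiable ℝ γ) {S : Set ℝ}
    (hS : UniqueDiffOn ℝ S) {c : ℝ} (hper : ∀ s ∈ S, ∀ θ, γ (s, θ + c) = γ (s, θ)) :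
    ∀ s ∈ S, ∀ θ, contactVariation γ (s, θ + c) = contactVariation γ (s, θ) := by
  intro s hs θ
  have h1 := (hasDerivAt_slice_fst hγ s (θ + c)).hasDerivWithinAt (s := S)
  have h2 := (hasDerivAt_slice_fst hγ s θ).hasDerivWithinAt (s := S)
  have h : fderiv ℝ γ (s, θ + c) (1, 0) = fderiv ℝ γ (s, θ) (1, 0) :=
    (hS s hs).eq_deriv S (h1.congr (fun t ht => (hper t ht θ).symm) (hper s hs θ).symm) h2
  simp only [contactVariation, h, hper s hs]

/-- If two Legendrian knots `γ₀`, `γ₁` in the standard contact `ℝ³` are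
Legendrian isotopic, then there exists a Lagrangian concordance from `γ₀` to `γ₁` (the
Lagrangian trace cobordism of the Legendrian isotopy). -/
theorem legendrian_isotopic_implies_lagrangian_concordance
    (γ₀ γ₁ : ℝ → R3)
    (h₀ : IsLegendrianKnot γ₀) (h₁ : IsLegendrianKnot γ₁)
    (hiso : LegendrianIsotopic γ₀ γ₁) :
    ∃ C : ℝ × ℝ → R4, IsLagrangianConcordance C γ₀ γ₁ := by
  obtain ⟨H, hH, hH0, hH1, hleg⟩ := hiso
  have hHd : Differentiable ℝ H := hH.differentiable (by simp)
  have hper : ∀ u ∈ Set.Icc (0 : ℝ) 1, ∀ θ, H (u, θ + 2 * π) = H (u, θ) :=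
    fun u hu => (hleg u hu).2.1
  have hkper := contactVariation_periodic hHd (uniqueDiffOn_Icc zero_lt_one) hper
  obtain ⟨ε, hε, hinj⟩ := Metric.eventually_nhds_iff.1
    (eventually_translate_injective hH hleg (contDiff_contactVariation hH).continuous hkper)
  obtain ⟨ρ, T, hρ, hT, hρmem, hρleft, hρright, hρderiv⟩ := exists_slow_transition hε
  set γ : ℝ × ℝ → R3 := fun p => H (ρ p.1, p.2)
  have hγapp : ∀ s θ, γ (s, θ) = H (ρ s, θ) := fun _ _ => rfl
  have hγ : ContDiff ℝ (⊤ : ℕ∞) γ := hH.comp ((hρ.comp contDiff_fst).prodMk contDiff_snd)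
  have hvar : ∀ s θ, contactVariation γ (s, θ) = deriv ρ s * contactVariation H (ρ s, θ) :=
    contactVariation_reparam hHd (hρ.differentiable (by simp))
  have hγderiv : ∀ s θ, deriv (fun θ => H (ρ s, θ)) θ = fderiv ℝ γ (s, θ) (0, 1) := fun s θ =>
    (hasDerivAt_slice_snd (hγ.differentiable (by simp)) s θ).deriv
  have hend : ∀ s θ, deriv ρ s = 0 →
      legendrianTrace γ (s, θ) = (s, H (ρ s, θ)) := fun s θ h => by
    simp [legendrianTrace, hvar, h, hγapp]
  refine ⟨legendrianTrace γ, contDiff_legendrianTrace hγ, fun s θ => ?_, fun s θ s' θ' h => ?_,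
    fun p a b h => ?_, fun K hK => ?_, symplForm_legendrianTrace hγ fun p => ?_,
    T, hT, fun s θ hs => ?_, fun s θ hs => ?_⟩
  · simp only [legendrianTrace, hvar, hkper _ (hρmem s), hγapp, hper _ (hρmem s)]
  · obtain rfl : s = s' := congrArg Prod.fst h
    refine ⟨rfl, hinj (y := deriv ρ s) (by simpa using hρderiv s) _ (hρmem s) _ _ ?_⟩
    have h' := congrArg Prod.snd h
    simp only [legendrianTrace, hvar, Prod.mk.injEq] at h'
    exact Prod.ext (by simpa using h'.1) (Prod.ext (by simpa using h'.2.1) h'.2.2)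
  · rw [Ds_legendrianTrace hγ, Dtheta_legendrianTrace hγ] at h
    obtain rfl : a = 0 := by simpa using congrArg Prod.fst h
    refine ⟨rfl, ?_⟩
    have hxy := (hleg _ (hρmem p.1)).deriv_xy_ne_zero p.2
    rw [hγderiv] at hxy
    have hx : b * (fderiv ℝ γ p (0, 1)).1 = 0 := by
      simpa using congrArg (fun v : R4 => v.2.1) h
    have hy : b * (fderiv ℝ γ p (0, 1)).2.1 = 0 := by
      simpa using congrArg (fun v : R4 => v.2.2.1) h
    rcases hxy with hne | hne
    · exact (mul_eq_zero.1 hx).resolve_right hne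
    · exact (mul_eq_zero.1 hy).resolve_right hne
  · obtain ⟨M, hM⟩ := hK.isBounded.exists_norm_le
    exact ⟨M, fun s θ h => (norm_fst_le (legendrianTrace γ (s, θ))).trans (hM _ h)⟩
  · have h := (hleg _ (hρmem p.1)).2.2.2.2 p.2
    rwa [hγderiv] at h
  · rw [hend s θ (hρleft s hs).2, (hρleft s hs).1, hH0]
  · rw [hend s θ (hρright s hs).2, (hρright s hs).1, hH1]
end
end

section
/- Every Lagrangian concordance between Legendrian knots is exact: if C is a Lagrangian concordance from γ₋ to γ₊ in the symplectization of the standard contact ℝ³, then the pullback under C of the primitive one-form λ = e^t·(dz − y·dx) is exact, i.e. there exists a smooth function h : ℝ×ℝ → ℝ, 2π-periodic in the second variable, such that ∂ₛh(s,θ) = λ_{C(s,θ)}(∂ₛC(s,θ)) and ∂_θh(s,θ) = λ_{C(s,θ)}(∂_θC(s,θ)) for all (s,θ), where λ_{(t,x,y,z)}(a,b,c,d) = e^t·(d − y·b). -/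
/-!
Common definitions: the standard contact `ℝ³` with contact form `α = dz - y dx`,
Legendrian knots, its symplectization `ℝ_t × ℝ³` with `ω = d(e^t α)`,
Lagrangian concordances, smooth unknottedness, and Legendrian isotopy.

A point of `ℝ³` is `(x, y, z) : ℝ × ℝ × ℝ`; a point of the symplectization is
`(t, x, y, z) : ℝ × ℝ × ℝ × ℝ`, and tangent vectors are encoded the same way.
-/

noncomputable section

open Real

/-- The Liouville form `λ = e^t (dz - y dx)` of the symplectization, evaluated at the
point `p = (t,x,y,z)` on the tangent vector `v = (a,b,c,d)`: `λ_p(v) = e^t (d - y b)`. -/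
def liouvilleForm (p : R4) (v : R4) : ℝ :=
  Real.exp p.1 * (v.2.2.2 - p.2.2.1 * v.2.1)

theorem Ds_eq_of_hasFDerivAt {E : Type*} [NormedAddCommGroup E] [NormedSpace ℝ E]
    {f : ℝ × ℝ → E} {f' : ℝ × ℝ →L[ℝ] E} {p : ℝ × ℝ} (hf : HasFDerivAt f f' p) :
    Ds f p = f' (1, 0) := by
  have hline : HasDerivAt (fun s : ℝ => (s, p.2)) ((1 : ℝ), (0 : ℝ)) p.1 :=
    (hasDerivAt_id p.1).prodMk (hasDerivAt_const p.1 p.2)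
  exact (HasFDerivAt.comp_hasDerivAt (f := fun s : ℝ => (s, p.2)) p.1 hf hline).deriv

theorem Dtheta_eq_of_hasFDerivAt {E : Type*} [NormedAddCommGroup E] [NormedSpace ℝ E]
    {f : ℝ × ℝ → E} {f' : ℝ × ℝ →L[ℝ] E} {p : ℝ × ℝ} (hf : HasFDerivAt f f' p) :
    Dtheta f p = f' (0, 1) := by
  have hline : HasDerivAt (fun θ : ℝ => (p.1, θ)) ((0 : ℝ), (1 : ℝ)) p.2 :=
    (hasDerivAt_const p.2 p.1).prodMk (hasDerivAt_id p.2)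
  exact (HasFDerivAt.comp_hasDerivAt (f := fun θ : ℝ => (p.1, θ)) p.2 hf hline).deriv

/-- The pullback under `C` of the Liouville form, as a one-form on the plane. -/
def liouvillePullback (C : ℝ × ℝ → R4) (p : ℝ × ℝ) : ℝ × ℝ →L[ℝ] ℝ :=
  Real.exp (C p).1 • (fderiv ℝ (fun q => (C q).2.2.2) p -
    (C p).2.2.1 • fderiv ℝ (fun q => (C q).2.1) p)

theorem liouvillePullback_apply {C : ℝ × ℝ → R4} {p : ℝ × ℝ} (hC : DifferentiableAt ℝ C p)
    (v : ℝ × ℝ) : liouvillePullback C p v = liouvilleForm (C p) (fderiv ℝ C p v) := by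
  have hx : fderiv ℝ (fun q => (C q).2.1) p v = (fderiv ℝ C p v).2.1 :=
    congrArg (· v) hC.hasFDerivAt.snd.fst.fderiv
  have hz : fderiv ℝ (fun q => (C q).2.2.2) p v = (fderiv ℝ C p v).2.2.2 :=
    congrArg (· v) hC.hasFDerivAt.snd.snd.snd.fderiv
  simp [liouvillePullback, liouvilleForm, hx, hz]

theorem contDiff_liouvillePullback {C : ℝ × ℝ → R4} (hC : ContDiff ℝ (⊤ : ℕ∞) C) :
    ContDiff ℝ (⊤ : ℕ∞) (liouvillePullback C) := by
  have hdx : ContDiff ℝ (⊤ : ℕ∞) (fderiv ℝ (fun q => (C q).2.1)) :=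
    hC.snd.fst.fderiv_right (m := (⊤ : ℕ∞)) le_rfl
  have hdz : ContDiff ℝ (⊤ : ℕ∞) (fderiv ℝ (fun q => (C q).2.2.2)) :=
    hC.snd.snd.snd.fderiv_right (m := (⊤ : ℕ∞)) le_rfl
  exact hC.fst.exp.smul (hdz.sub (hC.snd.snd.fst.smul hdx))

/-- The pullback of the Liouville form is not closed in general: its exterior derivative is
the pullback of the symplectic form. -/
theorem fderiv_liouvillePullback_sub {C : ℝ × ℝ → R4} (hC : ContDiff ℝ (⊤ : ℕ∞) C)
    (p v w : ℝ × ℝ) :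
    fderiv ℝ (liouvillePullback C) p v w - fderiv ℝ (liouvillePullback C) p w v =
      symplForm (C p) (fderiv ℝ C p v) (fderiv ℝ C p w) := by
  have htop : ((⊤ : ℕ∞) : WithTop ℕ∞) ≠ 0 := by simp
  have h_two : (2 : WithTop ℕ∞) ≤ ((⊤ : ℕ∞) : WithTop ℕ∞) :=
    WithTop.coe_le_coe.2 le_top
  have hfd {f : ℝ × ℝ → ℝ} (hf : ContDiff ℝ (⊤ : ℕ∞) f) :
      HasFDerivAt (fderiv ℝ f) (fderiv ℝ (fderiv ℝ f) p) p :=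
    ((hf.fderiv_right (m := (⊤ : ℕ∞)) le_rfl).differentiable htop p).hasFDerivAt
  have hsymm {f : ℝ × ℝ → ℝ} (hf : ContDiff ℝ (⊤ : ℕ∞) f) :
      fderiv ℝ (fderiv ℝ f) p v w = fderiv ℝ (fderiv ℝ f) p w v :=
    ((hf.of_le h_two).contDiffAt.isSymmSndFDerivAt (by simp)) v w
  have hC' : HasFDerivAt C (fderiv ℝ C p) p := (hC.differentiable htop p).hasFDerivAt
  have hx (u : ℝ × ℝ) : fderiv ℝ (fun q => (C q).2.1) p u = (fderiv ℝ C p u).2.1 :=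
    congrArg (· u) hC'.snd.fst.fderiv
  have hz (u : ℝ × ℝ) : fderiv ℝ (fun q => (C q).2.2.2) p u = (fderiv ℝ C p u).2.2.2 :=
    congrArg (· u) hC'.snd.snd.snd.fderiv
  have hω := hC'.fst.exp.smul
    ((hfd hC.snd.snd.snd).sub (hC'.snd.snd.fst.smul (hfd hC.snd.fst)))
  have hω' : HasFDerivAt (liouvillePullback C) _ p := hω
  have hsx := hsymm hC.snd.fst
  have hsz := hsymm hC.snd.snd.snd
  rw [hω'.fderiv]
  simp [symplForm, hx, hz, hsx, hsz]
  ring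

theorem symplForm_fderiv_eq_zero {C : ℝ × ℝ → R4} {p : ℝ × ℝ} (hC : DifferentiableAt ℝ C p)
    (h : symplForm (C p) (Ds C p) (Dtheta C p) = 0) (v w : ℝ × ℝ) :
    symplForm (C p) (fderiv ℝ C p v) (fderiv ℝ C p w) = 0 := by
  have hdecomp (u : ℝ × ℝ) : fderiv ℝ C p u = u.1 • Ds C p + u.2 • Dtheta C p := by
    rw [Ds_eq_of_hasFDerivAt hC.hasFDerivAt, Dtheta_eq_of_hasFDerivAt hC.hasFDerivAt,
      ← map_smul, ← map_smul, ← map_add]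
    simp
  have hbilin : symplForm (C p) (fderiv ℝ C p v) (fderiv ℝ C p w) =
      (v.1 * w.2 - v.2 * w.1) * symplForm (C p) (Ds C p) (Dtheta C p) := by
    simp only [hdecomp, symplForm, Prod.fst_add, Prod.snd_add, Prod.smul_fst, Prod.smul_snd,
      smul_eq_mul]
    ring
  rw [hbilin, h, mul_zero]

/-- A primitive of a `T`-invariant one-form that takes equal values at `x₀` and `x₀ + T`
is itself `T`-periodic. -/
theorem apply_add_eq_of_hasFDerivAt_of_periodic {E F : Type*} [NormedAddCommGroup E]
    [NormedSpace ℝ E] [NormedAddCommGroup F] [NormedSpace ℝ F] {h : E → F} {ω : E → E →L[ℝ] F}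
    {T x₀ : E} (hh : ∀ x, HasFDerivAt h (ω x) x) (hω : ∀ x, ω (x + T) = ω x)
    (hx₀ : h (x₀ + T) = h x₀) (x : E) : h (x + T) = h x := by
  have hdiff (y : E) : HasFDerivAt (fun y => h (y + T) - h y) (0 : E →L[ℝ] F) y := by
    have := ((hasFDerivAt_comp_add_right T).2 (hh (y + T))).sub (hh y)
    rwa [hω, sub_self] at this
  have hconst := is_const_of_fderiv_eq_zero (𝕜 := ℝ) (fun y => (hdiff y).differentiableAt)
    (fun y => (hdiff y).fderiv) x x₀
  simpa [hx₀, sub_eq_zero] using hconst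

theorem liouvillePullback_add_of_periodic {C : ℝ × ℝ → R4} {T : ℝ × ℝ}
    (hC : ∀ p, C (p + T) = C p) (p : ℝ × ℝ) :
    liouvillePullback C (p + T) = liouvillePullback C p := by
  unfold liouvillePullback
  rw [← fderiv_comp_add_right (f := fun q => (C q).2.2.2) T,
    ← fderiv_comp_add_right (f := fun q => (C q).2.1) T]
  simp only [hC]

/-- Every Lagrangian concordance between Legendrian knots is exact: the
pullback of the primitive `λ = e^t (dz - y dx)` under the concordance `C` admits a
(`2π`-periodic) smooth primitive `h`, i.e. `∂ₛh = λ(∂ₛC)` and `∂_θh = λ(∂_θC)`. -/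
theorem lagrangian_concordance_is_exact
    (γm γp : ℝ → R3) (C : ℝ × ℝ → R4)
    (hγm : IsLegendrianKnot γm) (hγp : IsLegendrianKnot γp)
    (hC : IsLagrangianConcordance C γm γp) :
    ∃ h : ℝ × ℝ → ℝ, ContDiff ℝ (⊤ : ℕ∞) h ∧
      (∀ s θ : ℝ, h (s, θ + 2 * π) = h (s, θ)) ∧
      (∀ p : ℝ × ℝ, Ds h p = liouvilleForm (C p) (Ds C p)) ∧
      (∀ p : ℝ × ℝ, Dtheta h p = liouvilleForm (C p) (Dtheta C p)) := by
  obtain ⟨hsmooth, hper, -, -, -, hlag, T, -, hneg, -⟩ := hC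
  have htop : ((⊤ : ℕ∞) : WithTop ℕ∞) ≠ 0 := by simp
  have hCd : Differentiable ℝ C := hsmooth.differentiable htop
  have hωs := contDiff_liouvillePullback hsmooth
  have hclosed (p v w : ℝ × ℝ) :
      fderiv ℝ (liouvillePullback C) p v w = fderiv ℝ (liouvillePullback C) p w v := by
    rw [← sub_eq_zero, fderiv_liouvillePullback_sub hsmooth]
    exact symplForm_fderiv_eq_zero (hCd p) (hlag p) v w
  obtain ⟨h, hh⟩ := convex_univ.exists_forall_hasFDerivAt_of_fderiv_symmetric isOpen_univ
    (hωs.differentiable htop).differentiableOn (fun p _ => hclosed p)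
  replace hh (p : ℝ × ℝ) : HasFDerivAt h (liouvillePullback C p) p := hh p (Set.mem_univ p)
  have hDθ (p : ℝ × ℝ) : Dtheta h p = liouvilleForm (C p) (Dtheta C p) := by
    rw [Dtheta_eq_of_hasFDerivAt (hh p), liouvillePullback_apply (hCd p),
      ← Dtheta_eq_of_hasFDerivAt (hCd p).hasFDerivAt]
  -- On the negative end the pullback vanishes on `∂_θ`, as `γm` is Legendrian.
  have hend (θ : ℝ) : Dtheta h (-T, θ) = 0 := by
    have hγ : HasDerivAt γm (deriv γm θ) θ := (hγm.1.differentiable htop θ).hasDerivAt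
    have hDC : Dtheta C (-T, θ) = (0, deriv γm θ) := by
      have hcyl : (fun φ => C (-T, φ)) = fun φ => (-T, γm φ) :=
        funext fun φ => hneg (-T) φ le_rfl
      rw [Dtheta, hcyl]
      exact ((hasDerivAt_const θ (-T)).prodMk hγ).deriv
    rw [hDθ, hDC, hneg (-T) θ le_rfl]
    simp [liouvilleForm, hγm.2.2.2.2 θ]
  have hloop : h ((-T, 0) + (0, 2 * π)) = h (-T, 0) := by
    have hd : Differentiable ℝ fun θ : ℝ => h (-T, θ) :=
      Differentiable.comp (g := h) (fun p => (hh p).differentiableAt)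
        ((differentiable_const _).prodMk differentiable_id)
    simpa using is_const_of_deriv_eq_zero hd hend (2 * π) 0
  have hCper (p : ℝ × ℝ) : C (p + (0, 2 * π)) = C p := by
    obtain ⟨s, θ⟩ := p
    simpa using hper s θ
  refine ⟨h, ?_, fun s θ => ?_, fun p => ?_, hDθ⟩
  · have hfd : fderiv ℝ h = liouvillePullback C := funext fun p => (hh p).fderiv
    exact contDiff_infty_iff_fderiv.2 ⟨fun p => (hh p).differentiableAt, hfd ▸ hωs⟩
  · simpa using apply_add_eq_of_hasFDerivAt_of_periodic hh
      (liouvillePullback_add_of_periodic hCper) hloop (s, θ)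
  · rw [Ds_eq_of_hasFDerivAt (hh p), liouvillePullback_apply (hCd p),
      ← Ds_eq_of_hasFDerivAt (hCd p).hasFDerivAt]
end
end

section
/- If a Legendrian knot γ in the standard contact ℝ³ admits a Lagrangian disc filling, then there exists a smoothly unknotted Legendrian knot γ₀ and a Lagrangian concordance from γ₀ to γ. (Any Lagrangian slice disc of γ induces a Lagrangian concordance from a Legendrian unknot to γ, by removing a standard neighbourhood of an interior point of the disc.) -/
/-!
Common definitions: the standard contact `ℝ³` with contact form `α = dz - y dx`,
Legendrian knots, its symplectization `ℝ_t × ℝ³` with `ω = d(e^t α)`,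
Lagrangian concordances, smooth unknottedness, and Legendrian isotopy.

A point of `ℝ³` is `(x, y, z) : ℝ × ℝ × ℝ`; a point of the symplectization is
`(t, x, y, z) : ℝ × ℝ × ℝ × ℝ`, and tangent vectors are encoded the same way.
-/

noncomputable section

open Real

/-- A Lagrangian disc filling of a Legendrian knot `γ` in the symplectization of the
standard contact `ℝ³`: a smooth proper injective immersion `F : ℝ² → ℝ × ℝ³` whose
tangent planes are `ω`-isotropic, and which for some `R > 0` satisfies
`F(r cos θ, r sin θ) = (log r, γ(θ))` whenever `r ≥ R`. -/
def IsLagrangianDiscFilling (F : ℝ × ℝ → R4) (γ : ℝ → R3) : Prop :=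
  ContDiff ℝ (⊤ : ℕ∞) F ∧
  Function.Injective F ∧
  (∀ K : Set R4, IsCompact K → ∃ M : ℝ, ∀ p : ℝ × ℝ, F p ∈ K → ‖p‖ ≤ M) ∧
  (∀ p : ℝ × ℝ, Function.Injective (fderiv ℝ F p)) ∧
  (∀ p : ℝ × ℝ, ∀ u v : ℝ × ℝ, symplForm (F p) (fderiv ℝ F p u) (fderiv ℝ F p v) = 0) ∧
  (∃ R : ℝ, 0 < R ∧ ∀ r θ : ℝ, R ≤ r →
    F (r * Real.cos θ, r * Real.sin θ) = ((Real.log r, γ θ) : R4))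

section Construction

open Filter Topology Set

/-- `f` is smooth near `p`, and an immersion with isotropic differential at `p`. -/
def IsLagImmAt (f : ℝ × ℝ → R4) (p : ℝ × ℝ) : Prop :=
  ContDiffAt ℝ (⊤ : ℕ∞) f p ∧ Function.Injective (fderiv ℝ f p) ∧
    ∀ u v, symplForm (f p) (fderiv ℝ f p u) (fderiv ℝ f p v) = 0

theorem IsLagImmAt.congr {f g : ℝ × ℝ → R4} {p : ℝ × ℝ} (hf : IsLagImmAt f p)
    (h : g =ᶠ[𝓝 p] f) : IsLagImmAt g p := by
  refine ⟨hf.1.congr_of_eventuallyEq h, ?_, ?_⟩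
  · rw [h.fderiv_eq]; exact hf.2.1
  · rw [h.fderiv_eq, h.eq_of_nhds]; exact hf.2.2

theorem IsLagImmAt.comp {f : ℝ × ℝ → R4} {φ : ℝ × ℝ → ℝ × ℝ} {p : ℝ × ℝ}
    (hf : IsLagImmAt f (φ p)) (hφ : ContDiffAt ℝ (⊤ : ℕ∞) φ p)
    (hi : Function.Injective (fderiv ℝ φ p)) : IsLagImmAt (f ∘ φ) p := by
  have hd : fderiv ℝ (f ∘ φ) p = (fderiv ℝ f (φ p)).comp (fderiv ℝ φ p) :=
    fderiv_comp p (hf.1.differentiableAt (by simp)) (hφ.differentiableAt (by simp))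
  refine ⟨hf.1.comp p hφ, ?_, ?_⟩
  · rw [hd]; exact hf.2.1.comp hi
  · intro u v; rw [hd]; exact hf.2.2 _ _

/-- Passage from canonical coordinates `(p₁, p₂, q₁, q₂)` on `{p₁ > 0} ⊆ T*ℝ²`, where
`ω = dp₁ ∧ dq₁ + dp₂ ∧ dq₂`, to the symplectization: `p₁ = e^t`, `p₂ = -e^t y`,
`q₁ = z`, `q₂ = x`. -/
def ofCanonical (h : R4) : R4 := (Real.log h.1, h.2.2.2, -h.2.1 / h.1, h.2.2.1)

theorem contDiffAt_ofCanonical {h : R4} (hp : 0 < h.1) :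
    ContDiffAt ℝ (⊤ : ℕ∞) ofCanonical h := by
  unfold ofCanonical
  refine ContDiffAt.prodMk (ContDiffAt.log contDiffAt_fst hp.ne') ?_
  refine ContDiffAt.prodMk (by fun_prop) (ContDiffAt.prodMk ?_ (by fun_prop))
  exact ContDiffAt.div (by fun_prop) (by fun_prop) hp.ne'

theorem fderiv_ofCanonical {h : R4} (hp : 0 < h.1) (v : R4) :
    fderiv ℝ ofCanonical h v =
      (v.1 / h.1, v.2.2.2, -v.2.1 / h.1 + h.2.1 * v.1 / h.1 ^ 2, v.2.2.1) := by
  have h1 : HasFDerivAt (fun h : R4 => h.1) (ContinuousLinearMap.fst ℝ ℝ (ℝ × ℝ × ℝ)) h :=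
    hasFDerivAt_fst
  have hs : HasFDerivAt (fun h : R4 => h.2) (ContinuousLinearMap.snd ℝ ℝ (ℝ × ℝ × ℝ)) h :=
    hasFDerivAt_snd
  have h2 := hs.fst
  have h3 := hs.snd.fst
  have h4 := hs.snd.snd
  have hy : HasFDerivAt (fun h : R4 => -h.2.1 / h.1) _ h :=
    (h2.neg.mul ((hasDerivAt_inv hp.ne').comp_hasFDerivAt h h1))
  have := (h1.log hp.ne').prodMk (h4.prodMk (hy.prodMk h3))
  have e : fderiv ℝ ofCanonical h = _ := this.fderiv
  rw [e]
  simp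
  constructor
  · field_simp
  · field_simp; ring

theorem IsLagImmAt.ofCanonical {H : ℝ × ℝ → R4} {p : ℝ × ℝ}
    (hs : ContDiffAt ℝ (⊤ : ℕ∞) H p) (hp : 0 < (H p).1)
    (hi : Function.Injective (fderiv ℝ H p))
    (hω : ∀ u v, (fderiv ℝ H p u).1 * (fderiv ℝ H p v).2.2.1
      - (fderiv ℝ H p v).1 * (fderiv ℝ H p u).2.2.1
      + (fderiv ℝ H p u).2.1 * (fderiv ℝ H p v).2.2.2
      - (fderiv ℝ H p v).2.1 * (fderiv ℝ H p u).2.2.2 = 0) :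
    IsLagImmAt (fun u => ofCanonical (H u)) p := by
  have hd : fderiv ℝ (fun u => _root_.ofCanonical (H u)) p
      = (fderiv ℝ _root_.ofCanonical (H p)).comp (fderiv ℝ H p) :=
    fderiv_comp p ((contDiffAt_ofCanonical hp).differentiableAt (by simp))
      (hs.differentiableAt (by simp))
  refine ⟨(contDiffAt_ofCanonical hp).comp p hs, ?_, ?_⟩
  · rw [hd]
    refine Function.Injective.comp (g := fderiv ℝ _root_.ofCanonical (H p)) ?_ hi
    rw [injective_iff_map_eq_zero]
    intro v hv
    rw [fderiv_ofCanonical hp] at hv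
    simp only [Prod.mk_eq_zero] at hv
    obtain ⟨h1, h2, h3, h4⟩ := hv
    have h1' : v.1 = 0 := by
      rcases div_eq_zero_iff.1 h1 with h | h
      · exact h
      · exact absurd h hp.ne'
    have h2' : v.2.1 = 0 := by
      rw [h1'] at h3
      simp at h3
      rcases h3 with h | h
      · exact h
      · exact absurd h hp.ne'
    ext <;> simp [*]
  · intro u v
    rw [hd]
    simp only [ContinuousLinearMap.comp_apply, fderiv_ofCanonical hp]
    have := hω u v
    simp only [symplForm, _root_.ofCanonical, Real.exp_log hp]
    field_simp
    linear_combination (H p).1 * this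

/-- Cutting off a germ `f` with `f 0 = 0` at a small scale `ε` keeps the derivative bounded
by a constant multiple of any bound for the derivative of `f` at `0`. -/
theorem exists_cutoff : ∃ M : ℝ, 0 < M ∧ ∀ (V : Type) [NormedAddCommGroup V] [NormedSpace ℝ V]
    (f : ℝ × ℝ → V), (∀ᶠ u in 𝓝 0, ContDiffAt ℝ (⊤ : ℕ∞) f u) → f 0 = 0 →
    ∀ δ : ℝ, ‖fderiv ℝ f 0‖ < δ → ∀ᶠ ε in 𝓝[>] (0 : ℝ), ∃ h : ℝ × ℝ → V,
      ContDiff ℝ (⊤ : ℕ∞) h ∧ (∀ u, ‖u‖ < ε → h u = f u) ∧ (∀ u, 2 * ε ≤ ‖u‖ → h u = 0) ∧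
      ∀ u, ‖fderiv ℝ h u‖ ≤ M * δ := by
  let χ : ContDiffBump (0 : ℝ × ℝ) := ⟨1, 2, one_pos, one_lt_two⟩
  have hχs : ContDiff ℝ (⊤ : ℕ∞) χ := χ.contDiff
  obtain ⟨K, hK⟩ : ∃ K, ∀ u, ‖fderiv ℝ χ u‖ ≤ K :=
    (χ.hasCompactSupport.fderiv ℝ).exists_bound_of_continuous (hχs.continuous_fderiv (by simp))
  have hK0 : 0 ≤ K := (norm_nonneg _).trans (hK 0)
  refine ⟨3 * K + 1, by positivity, ?_⟩
  intro V _ _ f hf hf0 δ hδ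
  have hδ0 : 0 < δ := (norm_nonneg _).trans_lt hδ
  have hcont : ContinuousAt (fun u => fderiv ℝ f u) 0 :=
    (hf.self_of_nhds.fderiv_right (m := 0) (by simp)).continuousAt
  have hev : ∀ᶠ u in 𝓝 (0 : ℝ × ℝ), ContDiffAt ℝ (⊤ : ℕ∞) f u ∧ ‖fderiv ℝ f u‖ < δ :=
    hf.and (hcont.norm.eventually (gt_mem_nhds hδ))
  obtain ⟨r, hr, hball⟩ := Metric.eventually_nhds_iff_ball.1 hev
  have hfb : ∀ u ∈ Metric.ball (0 : ℝ × ℝ) r, ‖f u‖ ≤ δ * ‖u‖ := by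
    intro u hu
    have := (convex_ball (0 : ℝ × ℝ) r).norm_image_sub_le_of_norm_fderiv_le (𝕜 := ℝ) (f := f)
      (fun x hx => (hball x hx).1.differentiableAt (by simp))
      (fun x hx => (hball x hx).2.le) (Metric.mem_ball_self hr) hu
    simpa [hf0] using this
  have : ∀ᶠ ε in 𝓝[>] (0 : ℝ), 0 < ε ∧ ε < r / 3 := Ioo_mem_nhdsGT (by positivity)
  filter_upwards [this] with ε ⟨hε, hεr⟩
  let g : ℝ × ℝ → ℝ := fun u => χ (ε⁻¹ • u)
  have hgs : ContDiff ℝ (⊤ : ℕ∞) g := hχs.comp (contDiff_const_smul _)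
  have hnorm : ∀ u : ℝ × ℝ, ‖ε⁻¹ • u‖ = ‖u‖ / ε := fun u => by
    rw [norm_smul, norm_inv, Real.norm_of_nonneg hε.le, div_eq_inv_mul]
  have hg1 : ∀ u : ℝ × ℝ, ‖u‖ ≤ ε → g u = 1 := fun u hu => by
    apply χ.one_of_mem_closedBall
    rw [mem_closedBall_zero_iff, hnorm]
    exact (div_le_one hε).2 hu
  have hg0 : ∀ u : ℝ × ℝ, 2 * ε ≤ ‖u‖ → g u = 0 := fun u hu => by
    apply χ.zero_of_le_dist
    rw [dist_zero_right, hnorm]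
    exact (le_div_iff₀ hε).2 hu
  have hgd : ∀ u, ‖fderiv ℝ g u‖ ≤ K / ε := fun u => by
    have h1 : HasFDerivAt (fun u : ℝ × ℝ => ε⁻¹ • u) (ε⁻¹ • ContinuousLinearMap.id ℝ (ℝ × ℝ)) u :=
      (ε⁻¹ • ContinuousLinearMap.id ℝ (ℝ × ℝ)).hasFDerivAt
    have h2 : fderiv ℝ g u = (fderiv ℝ χ (ε⁻¹ • u)).comp (ε⁻¹ • ContinuousLinearMap.id ℝ (ℝ × ℝ)) :=
      (((hχs.differentiable (by simp)) (ε⁻¹ • u)).hasFDerivAt.comp u h1).fderiv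
    rw [h2, ContinuousLinearMap.comp_smul, ContinuousLinearMap.comp_id, norm_smul, norm_inv,
      Real.norm_of_nonneg hε.le, div_eq_inv_mul]
    gcongr
    exact hK _
  have hgle : ∀ u, |g u| ≤ 1 := fun u => by
    rw [abs_of_nonneg χ.nonneg]; exact χ.le_one
  have hout : ∀ u : ℝ × ℝ, 2 * ε < ‖u‖ → (fun u => g u • f u) =ᶠ[𝓝 u] fun _ => 0 := fun u hu => by
    filter_upwards [(isOpen_lt continuous_const continuous_norm).mem_nhds hu] with v hv
    rw [hg0 v (le_of_lt hv), zero_smul]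
  have hin : ∀ u : ℝ × ℝ, ‖u‖ ≤ 2 * ε → u ∈ Metric.ball (0 : ℝ × ℝ) r := fun u hu => by
    rw [mem_ball_zero_iff]; linarith
  refine ⟨fun u => g u • f u, ?_, ?_, ?_, ?_⟩
  · rw [contDiff_iff_contDiffAt]
    intro u
    rcases le_or_gt ‖u‖ (2 * ε) with hu | hu
    · exact hgs.contDiffAt.smul (hball u (hin u hu)).1
    · exact contDiffAt_const.congr_of_eventuallyEq (hout u hu)
  · intro u hu; simp [hg1 u hu.le]
  · intro u hu; simp [hg0 u hu]
  · intro u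
    rcases le_or_gt ‖u‖ (2 * ε) with hu | hu
    · have hb := hball u (hin u hu)
      have h3 := ((hgs.differentiable (by simp)) u).hasFDerivAt.smul
        (hb.1.differentiableAt (by simp)).hasFDerivAt
      have h4 : fderiv ℝ (fun u => g u • f u) u = _ := h3.fderiv
      rw [h4]
      refine (norm_add_le _ _).trans ?_
      have e1 : ‖g u • fderiv ℝ f u‖ ≤ 1 * δ := by
        rw [norm_smul]
        exact mul_le_mul (hgle u) hb.2.le (norm_nonneg _) zero_le_one
      have e2 : ‖(fderiv ℝ g u).smulRight (f u)‖ ≤ K / ε * (δ * (2 * ε)) := by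
        rw [ContinuousLinearMap.norm_smulRight_apply]
        refine mul_le_mul (hgd u) ?_ (norm_nonneg _) (by positivity)
        exact (hfb u (hin u hu)).trans (by gcongr)
      have e3 : K / ε * (δ * (2 * ε)) = 2 * K * δ := by field_simp
      nlinarith [mul_nonneg hK0 hδ0.le]
    · rw [(hout u hu).fderiv_eq]
      simp only [fderiv_fun_const, Pi.zero_apply, norm_zero]
      positivity

/-- Smooth injective immersions of the plane into itself equal to the identity near infinity. -/
structure IsCptDiffeo (Φ : ℝ × ℝ → ℝ × ℝ) : Prop where
  contDiff : ContDiff ℝ (⊤ : ℕ∞) Φ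
  injective : Function.Injective Φ
  immersion : ∀ u, Function.Injective (fderiv ℝ Φ u)
  eq_self : ∃ R : ℝ, ∀ u, R ≤ ‖u‖ → Φ u = u

theorem IsCptDiffeo.comp {Φ Ψ : ℝ × ℝ → ℝ × ℝ} (hΦ : IsCptDiffeo Φ) (hΨ : IsCptDiffeo Ψ) :
    IsCptDiffeo (Φ ∘ Ψ) where
  contDiff := hΦ.contDiff.comp hΨ.contDiff
  injective := hΦ.injective.comp hΨ.injective
  immersion u := by
    rw [fderiv_comp u (hΦ.contDiff.differentiable (by simp) _)
      (hΨ.contDiff.differentiable (by simp) _)]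
    exact (hΦ.immersion _).comp (hΨ.immersion u)
  eq_self := by
    obtain ⟨R, hR⟩ := hΦ.eq_self
    obtain ⟨R', hR'⟩ := hΨ.eq_self
    refine ⟨max R R', fun u hu => ?_⟩
    rw [Function.comp_apply, hR' u ((le_max_right _ _).trans hu), hR u ((le_max_left _ _).trans hu)]

theorem isCptDiffeo_id_add {h : ℝ × ℝ → ℝ × ℝ} (hs : ContDiff ℝ (⊤ : ℕ∞) h)
    (hd : ∀ u, ‖fderiv ℝ h u‖ ≤ 1 / 2) {R : ℝ} (hR : ∀ u, R ≤ ‖u‖ → h u = 0) :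
    IsCptDiffeo (fun u => u + h u) where
  contDiff := contDiff_id.add hs
  injective u v huv := by
    have h1 := convex_univ.norm_image_sub_le_of_norm_fderiv_le (𝕜 := ℝ) (f := h)
      (fun x _ => hs.differentiable (by simp) x) (fun x _ => hd x) (mem_univ u) (mem_univ v)
    have h2 : u - v = h v - h u := by
      have : u + h u = v + h v := huv
      rw [sub_eq_sub_iff_add_eq_add, this, add_comm]
    rw [← h2, norm_sub_rev v u] at h1
    have h3 : ‖u - v‖ ≤ 0 := by linarith
    exact sub_eq_zero.1 (norm_le_zero_iff.1 h3)
  immersion u := by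
    rw [injective_iff_map_eq_zero]
    intro v hv
    have h1 : fderiv ℝ (fun u => u + h u) u = ContinuousLinearMap.id ℝ (ℝ × ℝ) + fderiv ℝ h u :=
      ((hasFDerivAt_id u).add (hs.differentiable (by simp) u).hasFDerivAt).fderiv
    rw [h1] at hv
    have h2 : v = -(fderiv ℝ h u v) := eq_neg_of_add_eq_zero_left hv
    have h3 : ‖v‖ ≤ 1 / 2 * ‖v‖ := by
      calc ‖v‖ = ‖fderiv ℝ h u v‖ := by rw [← norm_neg (fderiv ℝ h u v), ← h2]
        _ ≤ ‖fderiv ℝ h u‖ * ‖v‖ := ContinuousLinearMap.le_opNorm _ _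
        _ ≤ _ := by gcongr; exact hd u
    exact norm_le_zero_iff.1 (by linarith [norm_nonneg v])
  eq_self := ⟨R, fun u hu => by rw [hR u hu, add_zero]⟩

/-- A germ at `0` whose derivative is close to the identity extends to a plane diffeomorphism. -/
theorem exists_isCptDiffeo_of_near_id : ∃ δ : ℝ, 0 < δ ∧ ∀ κ : ℝ × ℝ → ℝ × ℝ,
    (∀ᶠ u in 𝓝 0, ContDiffAt ℝ (⊤ : ℕ∞) κ u) → κ 0 = 0 →
    ‖fderiv ℝ κ 0 - ContinuousLinearMap.id ℝ (ℝ × ℝ)‖ < δ →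
    ∃ Φ, IsCptDiffeo Φ ∧ Φ =ᶠ[𝓝 0] κ := by
  obtain ⟨M, hM, H⟩ := exists_cutoff
  refine ⟨1 / (2 * M), by positivity, fun κ hκ h0 hd => ?_⟩
  have hκd : DifferentiableAt ℝ κ 0 := hκ.self_of_nhds.differentiableAt (by simp)
  have hfd : fderiv ℝ (fun u => κ u - u) 0 = fderiv ℝ κ 0 - ContinuousLinearMap.id ℝ (ℝ × ℝ) :=
    (hκd.hasFDerivAt.sub (hasFDerivAt_id _)).fderiv
  have := H (ℝ × ℝ) (fun u => κ u - u) (hκ.mono fun u hu => hu.sub contDiffAt_id) (by simp [h0])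
    (1 / (2 * M)) (by rw [hfd]; exact hd)
  obtain ⟨ε, ⟨h, hs, hin, hout, hb⟩, hε⟩ := (this.and self_mem_nhdsWithin).exists
  refine ⟨fun u => u + h u, isCptDiffeo_id_add hs (fun u => (hb u).trans_eq (by field_simp)) hout, ?_⟩
  filter_upwards [Metric.ball_mem_nhds (0 : ℝ × ℝ) hε] with u hu
  rw [hin u (mem_ball_zero_iff.1 hu)]
  abel

theorem exists_isCptDiffeo_translation (p : ℝ × ℝ) :
    ∃ Φ, IsCptDiffeo Φ ∧ Φ =ᶠ[𝓝 0] fun u => u + p := by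
  let χ : ContDiffBump (0 : ℝ × ℝ) := ⟨1, 2, one_pos, one_lt_two⟩
  have hχs : ContDiff ℝ (⊤ : ℕ∞) χ := χ.contDiff
  obtain ⟨K, hK⟩ : ∃ K, ∀ u, ‖fderiv ℝ χ u‖ ≤ K :=
    (χ.hasCompactSupport.fderiv ℝ).exists_bound_of_continuous (hχs.continuous_fderiv (by simp))
  have hK0 : 0 ≤ K := (norm_nonneg _).trans (hK 0)
  set c : ℝ := 1 / (2 * (K + 1) * (‖p‖ + 1)) with hc
  have hc0 : 0 < c := by positivity
  let h : ℝ × ℝ → ℝ × ℝ := fun u => χ (c • u) • p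
  have hs : ContDiff ℝ (⊤ : ℕ∞) h :=
    (hχs.comp (contDiff_const_smul _)).smul contDiff_const
  refine ⟨fun u => u + h u, isCptDiffeo_id_add hs (fun u => ?_) (R := 2 / c) fun u hu => ?_, ?_⟩
  · have h1 : HasFDerivAt (fun u : ℝ × ℝ => c • u) (c • ContinuousLinearMap.id ℝ (ℝ × ℝ)) u :=
      (c • ContinuousLinearMap.id ℝ (ℝ × ℝ)).hasFDerivAt
    have h2 : fderiv ℝ h u = ((fderiv ℝ χ (c • u)).comp
        (c • ContinuousLinearMap.id ℝ (ℝ × ℝ))).smulRight p :=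
      ((((hχs.differentiable (by simp)) (c • u)).hasFDerivAt.comp u h1).smul_const p).fderiv
    rw [h2, ContinuousLinearMap.norm_smulRight_apply, ContinuousLinearMap.comp_smul,
      ContinuousLinearMap.comp_id, norm_smul, Real.norm_of_nonneg hc0.le]
    calc c * ‖fderiv ℝ χ (c • u)‖ * ‖p‖ ≤ c * (K + 1) * (‖p‖ + 1) := by
          gcongr
          · exact (hK _).trans (by linarith)
          · linarith
      _ = 1 / 2 := by rw [hc]; field_simp
  · have : χ (c • u) = 0 := by
      apply χ.zero_of_le_dist
      rw [dist_zero_right, norm_smul, Real.norm_of_nonneg hc0.le]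
      exact (div_le_iff₀' hc0).1 hu
    simp [h, this]
  · filter_upwards [Metric.ball_mem_nhds (0 : ℝ × ℝ) (show 0 < 1 / c by positivity)] with u hu
    have : χ (c • u) = 1 := by
      apply χ.one_of_mem_closedBall
      rw [mem_closedBall_zero_iff, norm_smul, Real.norm_of_nonneg hc0.le]
      exact ((lt_div_iff₀' hc0).1 (mem_ball_zero_iff.1 hu)).le
    simp [h, this]

/-- The linear map of the plane with matrix `!![a, b; c, d]`. -/
def planeLin (a b c d : ℝ) : ℝ × ℝ →L[ℝ] ℝ × ℝ :=
  (a • ContinuousLinearMap.fst ℝ ℝ ℝ + b • ContinuousLinearMap.snd ℝ ℝ ℝ).prod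
    (c • ContinuousLinearMap.fst ℝ ℝ ℝ + d • ContinuousLinearMap.snd ℝ ℝ ℝ)

@[simp] theorem planeLin_apply (a b c d : ℝ) (u : ℝ × ℝ) :
    planeLin a b c d u = (a * u.1 + b * u.2, c * u.1 + d * u.2) := by
  simp [planeLin]

theorem eq_planeLin (A : ℝ × ℝ →L[ℝ] ℝ × ℝ) :
    A = planeLin (A (1, 0)).1 (A (0, 1)).1 (A (1, 0)).2 (A (0, 1)).2 := by
  ext <;> simp

theorem isUnit_planeLin {a b c d : ℝ} (h : a * d - b * c ≠ 0) : IsUnit (planeLin a b c d) := by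
  obtain ⟨r, hr⟩ : ∃ r, r * (a * d - b * c) = 1 := ⟨_, inv_mul_cancel₀ h⟩
  refine ⟨⟨planeLin a b c d, planeLin (r * d) (-(r * b)) (-(r * c)) (r * a), ?_, ?_⟩, rfl⟩ <;>
  · ext <;> simp <;> first | ring1 | linear_combination hr

/-- The germ at `0` of the linear automorphism `A` extends to a plane diffeomorphism. -/
def ExtendsToPlane (A : (ℝ × ℝ →L[ℝ] ℝ × ℝ)ˣ) : Prop :=
  ∃ Φ, IsCptDiffeo Φ ∧ Φ =ᶠ[𝓝 0] (A : ℝ × ℝ →L[ℝ] ℝ × ℝ)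

theorem ExtendsToPlane.mul {A B : (ℝ × ℝ →L[ℝ] ℝ × ℝ)ˣ} (hA : ExtendsToPlane A)
    (hB : ExtendsToPlane B) : ExtendsToPlane (A * B) := by
  obtain ⟨Φ, hΦ, hΦA⟩ := hA
  obtain ⟨Ψ, hΨ, hΨB⟩ := hB
  refine ⟨Φ ∘ Ψ, hΦ.comp hΨ, ?_⟩
  have h0 : Ψ 0 = 0 := by rw [hΨB.eq_of_nhds, map_zero]
  have ht : Tendsto Ψ (𝓝 0) (𝓝 0) := by
    have := hΨ.contDiff.continuous.tendsto 0
    rwa [h0] at this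
  filter_upwards [hΨB, ht.eventually hΦA] with u h1 h2
  rw [Function.comp_apply, h2, h1]
  rfl

theorem extendsToPlane_of_connected {X : Type*} [TopologicalSpace X] [PreconnectedSpace X]
    {g : X → (ℝ × ℝ →L[ℝ] ℝ × ℝ)ˣ} (hg : Continuous g) {x₀ : X} (h₀ : g x₀ = 1) (x : X) :
    ExtendsToPlane (g x) ∧ ExtendsToPlane (g x)⁻¹ := by
  obtain ⟨δ, hδ, H⟩ := exists_isCptDiffeo_of_near_id
  let S : Set (ℝ × ℝ →L[ℝ] ℝ × ℝ)ˣ := {A | ‖(A : ℝ × ℝ →L[ℝ] ℝ × ℝ) - 1‖ < δ}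
  have hS : S ∈ 𝓝 (1 : (ℝ × ℝ →L[ℝ] ℝ × ℝ)ˣ) := by
    refine (isOpen_lt ((Units.continuous_val.sub continuous_const).norm) continuous_const).mem_nhds ?_
    simpa using hδ
  have hSe : ∀ A ∈ S, ExtendsToPlane A := fun A hA =>
    H (A : ℝ × ℝ →L[ℝ] ℝ × ℝ) (Eventually.of_forall fun u => (ContinuousLinearMap.contDiff _).contDiffAt)
      (map_zero _) (by rw [ContinuousLinearMap.fderiv]; exact hA)
  have hT : S ∩ S⁻¹ ∈ 𝓝 (1 : (ℝ × ℝ →L[ℝ] ℝ × ℝ)ˣ) :=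
    inter_mem hS (inv_mem_nhds_one _ hS)
  let K := Subgroup.closure (S ∩ S⁻¹)
  have hKo : IsOpen (K : Set (ℝ × ℝ →L[ℝ] ℝ × ℝ)ˣ) :=
    K.isOpen_of_mem_nhds (mem_of_superset hT Subgroup.subset_closure)
  have hK : ∀ A ∈ K, ExtendsToPlane A ∧ ExtendsToPlane A⁻¹ := by
    intro A hA
    induction hA using Subgroup.closure_induction with
    | mem A hA => exact ⟨hSe A hA.1, hSe _ hA.2⟩
    | one => rw [inv_one, and_self]; exact hSe 1 (mem_of_mem_nhds hS)
    | mul A B _ _ hA hB => rw [mul_inv_rev]; exact ⟨hA.1.mul hB.1, hB.2.mul hA.2⟩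
    | inv A _ hA => rw [inv_inv]; exact hA.symm
  refine hK _ ?_
  have hpre : IsPreconnected (range g) := isPreconnected_range hg
  exact hpre.subset_isClopen ⟨K.isClosed_of_isOpen hKo, hKo⟩
    ⟨g x₀, mem_range_self _, by rw [h₀]; exact K.one_mem⟩ (mem_range_self x)

theorem extendsToPlane_of_trace_nonneg {a b c d : ℝ} (hdet : 0 < a * d - b * c) (htr : 0 ≤ a + d)
    (A : (ℝ × ℝ →L[ℝ] ℝ × ℝ)ˣ) (hA : (A : ℝ × ℝ →L[ℝ] ℝ × ℝ) = planeLin a b c d) :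
    ExtendsToPlane A ∧ ExtendsToPlane A⁻¹ := by
  let f : unitInterval → (ℝ × ℝ →L[ℝ] ℝ × ℝ) := fun t =>
    planeLin (1 - t + t * a) (t * b) (t * c) (1 - t + t * d)
  have hf : Continuous f := by
    have : f = fun t : unitInterval => (1 - (t : ℝ)) • (1 : ℝ × ℝ →L[ℝ] ℝ × ℝ)
        + (t : ℝ) • planeLin a b c d := by
      funext t
      ext <;> simp [f]
    rw [this]
    fun_prop
  have hu : ∀ t, IsUnit (f t) := fun t => by
    refine isUnit_planeLin (ne_of_gt ?_)
    obtain ⟨t, h0, h1⟩ := t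
    have e : (1 - t + t * a) * (1 - t + t * d) - t * b * (t * c)
        = (1 - t) ^ 2 + t * (1 - t) * (a + d) + t ^ 2 * (a * d - b * c) := by ring
    simp only [e]
    rcases eq_or_lt_of_le h0 with h | h
    · rw [← h]; norm_num
    · have := mul_nonneg (mul_nonneg h0 (sub_nonneg.2 h1)) htr
      positivity
  choose g hg using hu
  have hgc : Continuous g := by
    rw [Units.isOpenEmbedding_val.continuous_iff]
    exact hf.congr fun t => (hg t).symm
  have h0 : g 0 = 1 := by
    refine Units.ext ((hg 0).trans ?_)
    ext <;> simp [f]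
  have h1 : g 1 = A := by
    refine Units.ext ((hg 1).trans ?_)
    rw [hA]; simp [f]
  simpa [h1] using extendsToPlane_of_connected hgc h0 1

theorem extendsToPlane_of_det_pos {a b c d : ℝ} (hdet : 0 < a * d - b * c)
    (A : (ℝ × ℝ →L[ℝ] ℝ × ℝ)ˣ) (hA : (A : ℝ × ℝ →L[ℝ] ℝ × ℝ) = planeLin a b c d) :
    ExtendsToPlane A ∧ ExtendsToPlane A⁻¹ := by
  rcases le_total 0 (a + d) with h | h
  · exact extendsToPlane_of_trace_nonneg hdet h A hA
  · obtain ⟨J, hJ⟩ := isUnit_planeLin (a := 0) (b := -1) (c := 1) (d := 0) (by norm_num)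
    obtain ⟨B, hB⟩ := isUnit_planeLin (a := -a) (b := -b) (c := -c) (d := -d) (by nlinarith)
    have h1 := extendsToPlane_of_trace_nonneg (by norm_num) (by norm_num) J hJ
    have h2 := extendsToPlane_of_trace_nonneg (by nlinarith) (by linarith) B hB
    have e : A = J * J * B := by
      refine Units.ext ?_
      rw [Units.val_mul, Units.val_mul, hA, hJ, hB]
      ext <;> simp
    rw [e, mul_inv_rev, mul_inv_rev]
    exact ⟨(h1.1.mul h1.1).mul h2.1, h2.2.mul (h1.2.mul h1.2)⟩

/-- A map `q` with positive Jacobian at `p₀` becomes the identity near `0` after composing with a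
suitable plane diffeomorphism. -/
theorem exists_straightening {q : ℝ × ℝ → ℝ × ℝ} {p₀ : ℝ × ℝ} (hq : ContDiff ℝ (⊤ : ℕ∞) q)
    (hq0 : q p₀ = 0)
    (hdet : 0 < (fderiv ℝ q p₀ (1, 0)).1 * (fderiv ℝ q p₀ (0, 1)).2
      - (fderiv ℝ q p₀ (0, 1)).1 * (fderiv ℝ q p₀ (1, 0)).2) :
    ∃ Φ, IsCptDiffeo Φ ∧ Φ 0 = p₀ ∧ ∀ᶠ u in 𝓝 0, q (Φ u) = u := by
  obtain ⟨A, hA⟩ := isUnit_planeLin hdet.ne'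
  have hAe := extendsToPlane_of_det_pos hdet A hA
  rw [← eq_planeLin] at hA
  let L : (ℝ × ℝ) ≃L[ℝ] (ℝ × ℝ) := ContinuousLinearEquiv.unitsEquiv ℝ (ℝ × ℝ) A
  have hL : (L : ℝ × ℝ →L[ℝ] ℝ × ℝ) = fderiv ℝ q p₀ := by rw [← hA]; rfl
  have hd : HasFDerivAt q (L : ℝ × ℝ →L[ℝ] ℝ × ℝ) p₀ := by
    rw [hL]; exact (hq.differentiable (by simp) p₀).hasFDerivAt
  let e := hq.contDiffAt.toOpenPartialHomeomorph q hd (by simp)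
  have heq : ∀ u, e u = q u := fun u => rfl
  have hp0 : p₀ ∈ e.source := hq.contDiffAt.mem_toOpenPartialHomeomorph_source hd (by simp)
  have h0t : (0 : ℝ × ℝ) ∈ e.target := by rw [← hq0, ← heq]; exact e.map_source hp0
  have hs0 : e.symm 0 = p₀ := by rw [← hq0, ← heq]; exact e.left_inv hp0
  have hcs : ContinuousAt e.symm 0 := e.symm.continuousAt h0t
  have hr : ∀ᶠ u in 𝓝 (0 : ℝ × ℝ), q (e.symm u) = u := e.eventually_right_inverse h0t
  have hinv : ∀ᶠ u in 𝓝 (0 : ℝ × ℝ),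
      fderiv ℝ q (e.symm u) ∈ range ((↑) : ((ℝ × ℝ) ≃L[ℝ] (ℝ × ℝ)) → (ℝ × ℝ →L[ℝ] ℝ × ℝ)) := by
    have hc : ContinuousAt (fun u => fderiv ℝ q (e.symm u)) 0 :=
      (hq.continuous_fderiv (by simp)).continuousAt.comp hcs
    refine hc.eventually ?_
    simp only [hs0]
    rw [← hL]
    exact ContinuousLinearEquiv.nhds L
  have hsm : ∀ᶠ u in 𝓝 (0 : ℝ × ℝ), ContDiffAt ℝ (⊤ : ℕ∞) e.symm u := by
    filter_upwards [hinv, e.open_target.mem_nhds h0t] with u ⟨M, hM⟩ hu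
    refine e.contDiffAt_symm (f₀' := M) hu ?_ hq.contDiffAt
    rw [hM]
    exact (hq.differentiable (by simp) _).hasFDerivAt
  have hds : HasFDerivAt e.symm (L.symm : ℝ × ℝ →L[ℝ] ℝ × ℝ) 0 := by
    refine e.hasFDerivAt_symm h0t ?_
    rw [hs0]; exact hd
  obtain ⟨δ, hδ, H⟩ := exists_isCptDiffeo_of_near_id
  obtain ⟨Φ₁, h₁, h₁e⟩ := exists_isCptDiffeo_translation p₀
  obtain ⟨Φ₂, h₂, h₂e⟩ := hAe.2
  have hk : HasFDerivAt (fun u => L (e.symm u - p₀))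
      ((L : ℝ × ℝ →L[ℝ] ℝ × ℝ).comp (L.symm : ℝ × ℝ →L[ℝ] ℝ × ℝ)) 0 :=
    (L : ℝ × ℝ →L[ℝ] ℝ × ℝ).hasFDerivAt.comp 0 (hds.sub_const p₀)
  obtain ⟨Φ₃, h₃, h₃e⟩ := H (fun u => L (e.symm u - p₀))
    (hsm.mono fun u hu => L.contDiff.contDiffAt.comp u (hu.sub contDiffAt_const))
    (by simp [hs0]) (by rw [hk.fderiv]; simpa using hδ)
  have h₃0 : Φ₃ 0 = 0 := by rw [h₃e.eq_of_nhds]; simp [hs0]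
  have h₂0 : Φ₂ 0 = 0 := by rw [h₂e.eq_of_nhds]; simp
  have ht₃ : Tendsto Φ₃ (𝓝 0) (𝓝 0) := by
    have := h₃.contDiff.continuous.tendsto 0
    rwa [h₃0] at this
  have ht₂ : Tendsto Φ₂ (𝓝 0) (𝓝 0) := by
    have := h₂.contDiff.continuous.tendsto 0
    rwa [h₂0] at this
  have key : ∀ᶠ u in 𝓝 0, Φ₁ (Φ₂ (Φ₃ u)) = e.symm u := by
    filter_upwards [h₃e, ht₃.eventually h₂e, (ht₂.comp ht₃).eventually h₁e] with u a b c
    have hLi : ∀ v, ((A⁻¹ : (ℝ × ℝ →L[ℝ] ℝ × ℝ)ˣ) : ℝ × ℝ →L[ℝ] ℝ × ℝ) (L v) = v :=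
      fun v => L.symm_apply_apply v
    simp only [Function.comp_apply] at c
    rw [c, b, a, hLi, sub_add_cancel]
  refine ⟨Φ₁ ∘ Φ₂ ∘ Φ₃, h₁.comp (h₂.comp h₃), ?_, ?_⟩
  · simp only [Function.comp_apply]
    rw [key.self_of_nhds, hs0]
  · filter_upwards [key, hr] with u a b
    simp only [Function.comp_apply]
    rw [a, b]

/-- The data of a family of figure-eight curves `θ ↦ (a sin θ, b sin 2θ)` lying over the levels
`p₁ = c`, with lobe area increasing in `c`. -/
structure TubeProfile (a b c : ℝ → ℝ) : Prop where
  contDiff_a : ContDiff ℝ (⊤ : ℕ∞) a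
  contDiff_b : ContDiff ℝ (⊤ : ℕ∞) b
  contDiff_c : ContDiff ℝ (⊤ : ℕ∞) c
  a_pos : ∀ s, 0 < a s
  b_pos : ∀ s, 0 < b s
  c_pos : ∀ s, 0 < c s
  deriv_c_pos : ∀ s, 0 < deriv c s
  deriv_ab_pos : ∀ s, 0 < deriv a s * b s + a s * deriv b s

theorem deriv_smoothTransition_of_nonpos {x : ℝ} (h : x ≤ 0) :
    deriv Real.smoothTransition x = 0 := by
  refine IsLocalMin.deriv_eq_zero (Eventually.of_forall fun y => ?_)
  rw [Real.smoothTransition.zero_of_nonpos h]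
  exact Real.smoothTransition.nonneg y

theorem deriv_smoothTransition_of_one_le {x : ℝ} (h : 1 ≤ x) :
    deriv Real.smoothTransition x = 0 := by
  refine IsLocalMax.deriv_eq_zero (Eventually.of_forall fun y => ?_)
  rw [Real.smoothTransition.one_of_one_le h]
  exact Real.smoothTransition.le_one y

theorem exists_bound_deriv_smoothTransition :
    ∃ K : ℝ, 0 ≤ K ∧ ∀ x, deriv Real.smoothTransition x ≤ K := by
  have hc : Continuous (deriv Real.smoothTransition) :=
    (Real.smoothTransition.contDiff (n := ⊤)).continuous_deriv (by simp)
  have hs : HasCompactSupport (deriv Real.smoothTransition) := by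
    refine HasCompactSupport.intro (isCompact_Icc (a := (0 : ℝ)) (b := 1)) fun x hx => ?_
    rcases not_and_or.1 hx with h | h
    · exact deriv_smoothTransition_of_nonpos (not_le.1 h).le
    · exact deriv_smoothTransition_of_one_le (not_le.1 h).le
  obtain ⟨K, hK⟩ := hs.exists_bound_of_continuous hc
  exact ⟨K, (norm_nonneg _).trans (hK 0), fun x => (le_abs_self _).trans (hK x)⟩

set_option maxHeartbeats 1000000 in
theorem exists_tubeProfile {c₀ η : ℝ} (hc₀ : 0 < c₀) (hη : 0 < η) :
    ∃ r₀ : ℝ, 0 < r₀ ∧ r₀ < η ∧ ∃ a b c : ℝ → ℝ, TubeProfile a b c ∧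
      (∀ s, Real.log r₀ ≤ s →
        a s = Real.exp s ∧ b s = Real.exp s ^ 2 ∧ c s = c₀ + Real.exp s ^ 2) ∧
      (∃ α β T : ℝ, 0 < α ∧ 0 < β ∧ 0 < T ∧
        ∀ s, s ≤ -T → a s = α ∧ b s = β * Real.exp s ∧ c s = Real.exp s) ∧
      ∀ s, s ≤ Real.log r₀ → a s < η ∧ 2 * b s / c s < η ∧ c s < c₀ * Real.exp η ∧
        (2 * b s * |deriv a s| + 2 / 3 * (deriv a s * b s + a s * deriv b s)) / deriv c s < η := by
  obtain ⟨K, hK0, hK⟩ := exists_bound_deriv_smoothTransition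
  have hsmall : ∀ f : ℝ → ℝ, Continuous f → ∀ B, f 0 < B → ∀ᶠ r in 𝓝[>] (0 : ℝ), f r < B :=
    fun f hf B hB => (hf.continuousAt.eventually (gt_mem_nhds hB)).filter_mono nhdsWithin_le_nhds
  have hexp : c₀ < c₀ * Real.exp η := by
    have := Real.add_one_lt_exp hη.ne'
    nlinarith
  obtain ⟨r, ⟨⟨⟨⟨⟨⟨hr1, hrη⟩, hrc⟩, h5⟩, h6⟩, h7⟩, h8⟩, hr⟩ :=
    ((((((((hsmall id continuous_id 1 one_pos).and
      (hsmall id continuous_id η hη)).and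
      (hsmall id continuous_id c₀ hc₀)).and
      (hsmall (fun r => 2 * (r ^ 2 / (16 * (c₀ + 1)))) (by fun_prop) η (by simpa using hη))).and
      (hsmall (fun r => 2 * (r ^ 2 / c₀)) (by fun_prop) η (by simpa using hη))).and
      (hsmall (fun r => c₀ + r ^ 2) (by fun_prop) _ (by simpa using hexp))).and
      (hsmall (fun r => (5 + 5 * K) * r) (by fun_prop) η (by simpa using hη))).and
      self_mem_nhdsWithin).exists
  simp only [id] at hr1 hrη hrc
  replace hr : 0 < r := hr
  set s₀ := Real.log r with hs₀
  have hrs : Real.exp s₀ = r := Real.exp_log hr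
  set β := r ^ 2 / (16 * (c₀ + 1)) with hβ
  have hβ0 : 0 < β := by positivity
  have hβr : β * (16 * (c₀ + 1)) = r ^ 2 := by rw [hβ]; field_simp
  have hβ1 : β ≤ 1 := by nlinarith
  set α := r / 4 with hα
  have hα0 : 0 < α := by positivity
  let σ := Real.smoothTransition
  have hσs : ContDiff ℝ (⊤ : ℕ∞) σ := Real.smoothTransition.contDiff
  let x : ℝ → ℝ := fun s => σ (s - s₀ + 1)
  let w : ℝ → ℝ := fun s => σ (s - s₀ + 3)
  let c : ℝ → ℝ := fun s => (1 - w s) * Real.exp s + w s * (c₀ + Real.exp s ^ 2)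
  let a : ℝ → ℝ := fun s => (1 - x s) * α + x s * Real.exp s
  let b : ℝ → ℝ := fun s => (1 - x s) * (β * c s) + x s * Real.exp s ^ 2
  let x' : ℝ → ℝ := fun s => deriv σ (s - s₀ + 1)
  let w' : ℝ → ℝ := fun s => deriv σ (s - s₀ + 3)
  have hxd : ∀ s, HasDerivAt x (x' s) s := fun s => by
    exact ((hσs.differentiable (by simp) (s - s₀ + 1)).hasDerivAt.comp s
      (((hasDerivAt_id s).sub_const s₀).add_const 1)).congr_deriv (mul_one _)
  have hwd : ∀ s, HasDerivAt w (w' s) s := fun s => by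
    exact ((hσs.differentiable (by simp) (s - s₀ + 3)).hasDerivAt.comp s
      (((hasDerivAt_id s).sub_const s₀).add_const 3)).congr_deriv (mul_one _)
  have hed : ∀ s, HasDerivAt (fun s => Real.exp s ^ 2) (2 * Real.exp s ^ 2) s := fun s => by
    have := (Real.hasDerivAt_exp s).fun_pow 2
    refine this.congr_deriv ?_
    push_cast; ring
  have hcd : ∀ s, deriv c s = (1 - w s) * Real.exp s + w s * (2 * Real.exp s ^ 2)
      + w' s * (c₀ + Real.exp s ^ 2 - Real.exp s) := fun s => by
    refine HasDerivAt.deriv (((((hwd s).const_sub 1).mul (Real.hasDerivAt_exp s)).add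
      ((hwd s).mul ((hed s).const_add c₀))).congr_deriv ?_)
    ring
  have had : ∀ s, deriv a s = x s * Real.exp s + x' s * (Real.exp s - α) := fun s => by
    refine HasDerivAt.deriv (((((hxd s).const_sub 1).mul_const α).add
      ((hxd s).mul (Real.hasDerivAt_exp s))).congr_deriv ?_)
    ring
  have hcs : ContDiff ℝ (⊤ : ℕ∞) c := by
    have : ContDiff ℝ (⊤ : ℕ∞) w := hσs.comp (by fun_prop)
    have := Real.contDiff_exp (n := (⊤ : ℕ∞))
    fun_prop
  have hxs : ContDiff ℝ (⊤ : ℕ∞) x := hσs.comp (by fun_prop)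
  have has : ContDiff ℝ (⊤ : ℕ∞) a := by
    have := Real.contDiff_exp (n := (⊤ : ℕ∞))
    fun_prop
  have hbs : ContDiff ℝ (⊤ : ℕ∞) b := by
    have := Real.contDiff_exp (n := (⊤ : ℕ∞))
    fun_prop
  have hbd : ∀ s, deriv b s = (1 - x s) * (β * deriv c s) + x s * (2 * Real.exp s ^ 2)
      + x' s * (Real.exp s ^ 2 - β * c s) := fun s => by
    have hc := (hcs.differentiable (by simp) s).hasDerivAt
    refine HasDerivAt.deriv (((((hxd s).const_sub 1).mul (hc.const_mul β)).add
      ((hxd s).mul (hed s))).congr_deriv ?_)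
    ring
  have hσ' : ∀ y, 0 ≤ deriv σ y := fun y => Real.smoothTransition.monotone.deriv_nonneg
  have hx0 : ∀ s, 0 ≤ x s := fun s => Real.smoothTransition.nonneg _
  have hx1 : ∀ s, x s ≤ 1 := fun s => Real.smoothTransition.le_one _
  have hw0 : ∀ s, 0 ≤ w s := fun s => Real.smoothTransition.nonneg _
  have hw1 : ∀ s, w s ≤ 1 := fun s => Real.smoothTransition.le_one _
  have hx'0 : ∀ s, 0 ≤ x' s := fun s => hσ' _
  have hx'K : ∀ s, x' s ≤ K := fun s => hK _
  have hw'0 : ∀ s, 0 ≤ w' s := fun s => hσ' _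
  have hE : ∀ s, 0 < Real.exp s := Real.exp_pos
  have hmix : ∀ y u v : ℝ, 0 ≤ y → y ≤ 1 → 0 < u → 0 < v → 0 < (1 - y) * u + y * v := by
    intro y u v h0 h1 hu hv
    rcases eq_or_lt_of_le h0 with h | h
    · rw [← h]; simpa using hu
    · have := mul_nonneg (sub_nonneg.2 h1) hu.le
      have := mul_pos h hv
      linarith
  have hmixle : ∀ y u v B : ℝ, 0 ≤ y → y ≤ 1 → u ≤ B → v ≤ B → (1 - y) * u + y * v ≤ B := by
    intro y u v B h0 h1 hu hv
    nlinarith [mul_le_mul_of_nonneg_left hu (sub_nonneg.2 h1), mul_le_mul_of_nonneg_left hv h0]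
  have hcpos : ∀ s, 0 < c s := fun s =>
    hmix _ _ _ (hw0 s) (hw1 s) (hE s) (by have := hE s; positivity)
  have hlow : ∀ s, s ≤ s₀ - 1 → x s = 0 ∧ x' s = 0 := fun s hs =>
    ⟨Real.smoothTransition.zero_of_nonpos (by linarith),
      deriv_smoothTransition_of_nonpos (by linarith)⟩
  have hhigh : ∀ s, s₀ ≤ s → x s = 1 ∧ x' s = 0 := fun s hs =>
    ⟨Real.smoothTransition.one_of_one_le (by linarith),
      deriv_smoothTransition_of_one_le (by linarith)⟩
  have hwhigh : ∀ s, s₀ - 1 ≤ s → w s = 1 ∧ w' s = 0 := fun s hs =>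
    ⟨Real.smoothTransition.one_of_one_le (by linarith),
      deriv_smoothTransition_of_one_le (by linarith)⟩
  have hchigh : ∀ s, s₀ - 1 ≤ s → c s = c₀ + Real.exp s ^ 2 ∧ deriv c s = 2 * Real.exp s ^ 2 :=
    fun s hs => by
      obtain ⟨h1, h2⟩ := hwhigh s hs
      rw [hcd]; simp [c, h1, h2]
  have hEr : ∀ s, s ≤ s₀ → Real.exp s ≤ r := fun s hs => by rw [← hrs]; exact Real.exp_le_exp.2 hs
  have hcdpos : ∀ s, 0 < deriv c s := fun s => by
    rcases le_total s s₀ with h | h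
    · rw [hcd]
      have h1 := hmix _ _ _ (hw0 s) (hw1 s) (hE s) (show 0 < 2 * Real.exp s ^ 2 by have := hE s; positivity)
      have h2 : 0 ≤ w' s * (c₀ + Real.exp s ^ 2 - Real.exp s) :=
        mul_nonneg (hw'0 s) (by nlinarith [hEr s h, sq_nonneg (Real.exp s)])
      linarith
    · rw [(hchigh s (by linarith)).2]
      have := hE s; positivity
  have hEα : ∀ s, s₀ - 1 ≤ s → α ≤ Real.exp s := fun s hs => by
    have h1 : Real.exp (s₀ - 1) ≤ Real.exp s := Real.exp_le_exp.2 hs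
    rw [Real.exp_sub, hrs] at h1
    refine le_trans ?_ h1
    have := Real.exp_one_lt_d9
    exact div_le_div_of_nonneg_left hr.le (Real.exp_pos 1) (by linarith)
  have hβE : ∀ s, s₀ - 1 ≤ s → s ≤ s₀ → β * c s ≤ Real.exp s ^ 2 := fun s h1 h2 => by
    rw [(hchigh s h1).1]
    have e1 := hEα s h1
    have e2 := hEr s h2
    have e3 : r ^ 2 ≤ 16 * Real.exp s ^ 2 := by nlinarith
    have e4 : Real.exp s ^ 2 ≤ 1 := by nlinarith [hE s]
    have e5 : β * (c₀ + Real.exp s ^ 2) ≤ β * (c₀ + 1) := by gcongr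
    linarith
  have hapos : ∀ s, 0 < a s := fun s => hmix _ _ _ (hx0 s) (hx1 s) hα0 (hE s)
  have hbpos : ∀ s, 0 < b s := fun s =>
    hmix _ _ _ (hx0 s) (hx1 s) (mul_pos hβ0 (hcpos s)) (by have := hE s; positivity)
  have hadnn : ∀ s, 0 ≤ deriv a s := fun s => by
    rw [had]
    have h1 := mul_nonneg (hx0 s) (hE s).le
    rcases le_total s (s₀ - 1) with h | h
    · rw [(hlow s h).2]; linarith
    · have := mul_nonneg (hx'0 s) (sub_nonneg.2 (hEα s h)); linarith
  have hbdpos : ∀ s, 0 < deriv b s := fun s => by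
    rw [hbd]
    have h1 := hmix _ _ _ (hx0 s) (hx1 s) (mul_pos hβ0 (hcdpos s))
      (show 0 < 2 * Real.exp s ^ 2 by have := hE s; positivity)
    rcases le_total s (s₀ - 1) with h | h
    · rw [(hlow s h).2]; linarith
    · rcases le_total s s₀ with h' | h'
      · have := mul_nonneg (hx'0 s) (sub_nonneg.2 (hβE s h h')); linarith
      · rw [(hhigh s h').2]; linarith
  refine ⟨r, hr, hrη, a, b, c, ⟨has, hbs, hcs, hapos, hbpos, hcpos, hcdpos, fun s => ?_⟩, ?_, ?_, ?_⟩
  · have := mul_nonneg (hadnn s) (hbpos s).le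
    have := mul_pos (hapos s) (hbdpos s)
    linarith
  · intro s hs
    refine ⟨?_, ?_, (hchigh s (by linarith)).1⟩ <;> simp [a, b, (hhigh s hs).1]
  · refine ⟨α, β, |s₀| + 3, hα0, hβ0, by positivity, fun s hs => ?_⟩
    have h1 : s ≤ s₀ - 3 := by linarith [neg_abs_le s₀]
    have h2 : w s = 0 := Real.smoothTransition.zero_of_nonpos (by linarith)
    simp [a, b, c, (hlow s (by linarith)).1, h2]
  · intro s hs
    have hEs := hE s
    have hEr' := hEr s hs
    have hE1 : Real.exp s ^ 2 ≤ r ^ 2 := by gcongr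
    refine ⟨(hmixle _ _ _ r (hx0 s) (hx1 s) (by linarith) hEr').trans_lt hrη, ?_, ?_, ?_⟩
    · rcases le_total s (s₀ - 1) with h | h
      · have : b s = β * c s := by simp [b, (hlow s h).1]
        rw [this, ← mul_assoc, mul_div_cancel_right₀ _ (hcpos s).ne']
        exact h5
      · refine lt_of_le_of_lt ?_ h6
        have h1 : b s ≤ r ^ 2 := (hmixle _ _ _ _ (hx0 s) (hx1 s) (hβE s h hs) le_rfl).trans hE1
        have h2 : c₀ ≤ c s := by rw [(hchigh s h).1]; nlinarith
        rw [← mul_div_assoc]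
        gcongr
    · refine lt_of_le_of_lt (hmixle _ _ _ _ (hw0 s) (hw1 s) ?_ ?_) h7
      · nlinarith
      · linarith
    · rw [abs_of_nonneg (hadnn s), div_lt_iff₀ (hcdpos s)]
      rcases le_total s (s₀ - 1) with h | h
      · obtain ⟨e1, e2⟩ := hlow s h
        have e3 : deriv a s = 0 := by rw [had]; simp [e1, e2]
        have e4 : deriv b s = β * deriv c s := by rw [hbd]; simp [e1, e2]
        have e5 : a s = α := by simp [a, e1]
        have e6 : α * β < η := by nlinarith
        rw [e3, e4, e5]
        have e7 := mul_lt_mul_of_pos_right e6 (hcdpos s)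
        have e8 := mul_pos (mul_pos hα0 hβ0) (hcdpos s)
        rw [mul_zero, zero_mul, zero_add, zero_add]
        linarith
      · have hb : b s ≤ Real.exp s ^ 2 := hmixle _ _ _ _ (hx0 s) (hx1 s) (hβE s h hs) le_rfl
        have ha : a s ≤ r := hmixle _ _ _ r (hx0 s) (hx1 s) (by linarith) hEr'
        have ha' : deriv a s ≤ (1 + K) * r := by
          rw [had]
          have e1 : x s * Real.exp s ≤ 1 * r := mul_le_mul (hx1 s) hEr' hEs.le zero_le_one
          have e2 : x' s * (Real.exp s - α) ≤ K * r :=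
            mul_le_mul (hx'K s) (by linarith) (sub_nonneg.2 (hEα s h)) hK0
          linarith
        rw [(hchigh s h).2]
        have hb' : deriv b s ≤ (2 + K) * Real.exp s ^ 2 := by
          rw [hbd, (hchigh s h).2]
          have e1 : (1 - x s) * (β * (2 * Real.exp s ^ 2)) + x s * (2 * Real.exp s ^ 2)
              ≤ 2 * Real.exp s ^ 2 :=
            hmixle _ _ _ _ (hx0 s) (hx1 s) (by nlinarith [sq_nonneg (Real.exp s)]) le_rfl
          have e2 : x' s * (Real.exp s ^ 2 - β * c s) ≤ K * Real.exp s ^ 2 :=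
            mul_le_mul (hx'K s) (by nlinarith [mul_pos hβ0 (hcpos s)])
              (sub_nonneg.2 (hβE s h hs)) hK0
          linarith
        have e1 : b s * deriv a s ≤ Real.exp s ^ 2 * ((1 + K) * r) :=
          mul_le_mul hb ha' (hadnn s) (by positivity)
        have e2 : a s * deriv b s ≤ r * ((2 + K) * Real.exp s ^ 2) :=
          mul_le_mul ha hb' (hbdpos s).le hr.le
        have e3 : (5 + 5 * K) * r * Real.exp s ^ 2 < η * Real.exp s ^ 2 := by gcongr
        have e4 : 0 ≤ K * r * Real.exp s ^ 2 := by positivity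
        have e5 : 0 < r * Real.exp s ^ 2 := by positivity
        linarith

theorem exists_eq_add_two_pi_mul {θ θ' : ℝ} (hcos : Real.cos θ = Real.cos θ')
    (hsin : Real.sin θ = Real.sin θ') : ∃ k : ℤ, θ' = θ + 2 * π * k := by
  obtain ⟨k, hk⟩ := Real.Angle.angle_eq_iff_two_pi_dvd_sub.1 (Real.Angle.cos_sin_inj hcos hsin)
  refine ⟨-k, ?_⟩
  push_cast
  linarith

/-- The coordinate `z` making the family of figure-eight curves Lagrangian. -/
def tubeZ (a b c : ℝ → ℝ) (p : ℝ × ℝ) : ℝ :=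
  (2 * b p.1 * deriv a p.1 * Real.sin p.2 ^ 2 * Real.cos p.2
    + 2 / 3 * (deriv a p.1 * b p.1 + a p.1 * deriv b p.1) * Real.cos p.2 ^ 3) / deriv c p.1

/-- The Lagrangian tube swept out by a family of figure-eight curves, in the coordinates
`(p₁, p₂, q₁, q₂)`. -/
def tubeCan (a b c : ℝ → ℝ) (p : ℝ × ℝ) : R4 :=
  (c p.1, 2 * b p.1 * (Real.sin p.2 * Real.cos p.2), tubeZ a b c p, a p.1 * Real.sin p.2)

namespace TubeProfile

variable {a b c : ℝ → ℝ}

theorem contDiff_tubeCan (h : TubeProfile a b c) : ContDiff ℝ (⊤ : ℕ∞) (tubeCan a b c) := by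
  have ha := h.contDiff_a
  have hb := h.contDiff_b
  have hc := h.contDiff_c
  have ha' : ContDiff ℝ (⊤ : ℕ∞) (deriv a) := ((contDiff_infty_iff_deriv (𝕜 := ℝ)).1 ha).2
  have hb' : ContDiff ℝ (⊤ : ℕ∞) (deriv b) := ((contDiff_infty_iff_deriv (𝕜 := ℝ)).1 hb).2
  have hc' : ContDiff ℝ (⊤ : ℕ∞) (deriv c) := ((contDiff_infty_iff_deriv (𝕜 := ℝ)).1 hc).2
  have hz : ContDiff ℝ (⊤ : ℕ∞) (tubeZ a b c) :=
    ContDiff.div (by fun_prop) (by fun_prop) fun p => (h.deriv_c_pos p.1).ne'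
  unfold tubeCan
  fun_prop

theorem fderiv_tubeCan (h : TubeProfile a b c) (s θ : ℝ) :
    ∃ z : ℝ, ∀ v : ℝ × ℝ, fderiv ℝ (tubeCan a b c) (s, θ) v =
      v.1 • ((deriv c s, 2 * deriv b s * (Real.sin θ * Real.cos θ), z, deriv a s * Real.sin θ) : R4)
      + v.2 • ((0, 2 * b s * (Real.cos θ ^ 2 - Real.sin θ ^ 2),
        2 * (b s * deriv a s * (Real.sin θ * Real.cos θ ^ 2 - Real.sin θ ^ 3)
          - a s * deriv b s * (Real.cos θ ^ 2 * Real.sin θ)) / deriv c s,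
        a s * Real.cos θ) : R4) := by
  have hd : HasFDerivAt (tubeCan a b c) (fderiv ℝ (tubeCan a b c) (s, θ)) (s, θ) :=
    (h.contDiff_tubeCan.differentiable (by simp) _).hasFDerivAt
  set D := fderiv ℝ (tubeCan a b c) (s, θ)
  have h1 : HasDerivAt (fun s => tubeCan a b c (s, θ)) (D (1, 0)) s :=
    hd.comp_hasDerivAt (f := fun s => (s, θ)) s ((hasDerivAt_id s).prodMk (hasDerivAt_const s θ))
  have h2 : HasDerivAt (fun θ => tubeCan a b c (s, θ)) (D (0, 1)) θ :=
    hd.comp_hasDerivAt (f := fun θ => (s, θ)) θ ((hasDerivAt_const θ s).prodMk (hasDerivAt_id θ))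
  have hsc : HasDerivAt (fun θ => Real.sin θ * Real.cos θ)
      (Real.cos θ ^ 2 - Real.sin θ ^ 2) θ :=
    ((Real.hasDerivAt_sin θ).mul (Real.hasDerivAt_cos θ)).congr_deriv (by ring)
  have hz : HasDerivAt (fun θ => tubeZ a b c (s, θ))
      (2 * (b s * deriv a s * (Real.sin θ * Real.cos θ ^ 2 - Real.sin θ ^ 3)
          - a s * deriv b s * (Real.cos θ ^ 2 * Real.sin θ)) / deriv c s) θ := by
    have e1 := ((((Real.hasDerivAt_sin θ).fun_pow 2).const_mul (2 * b s * deriv a s)).mul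
      (Real.hasDerivAt_cos θ)).add (((Real.hasDerivAt_cos θ).fun_pow 3).const_mul
        (2 / 3 * (deriv a s * b s + a s * deriv b s)))
    refine (e1.div_const (deriv c s)).congr_deriv ?_
    congr 1
    push_cast
    ring
  have e2 : D (0, 1) = (0, 2 * b s * (Real.cos θ ^ 2 - Real.sin θ ^ 2),
        2 * (b s * deriv a s * (Real.sin θ * Real.cos θ ^ 2 - Real.sin θ ^ 3)
          - a s * deriv b s * (Real.cos θ ^ 2 * Real.sin θ)) / deriv c s,
        a s * Real.cos θ) :=
    h2.unique ((hasDerivAt_const θ (c s)).prodMk ((hsc.const_mul (2 * b s)).prodMk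
      (hz.prodMk ((Real.hasDerivAt_sin θ).const_mul (a s)))))
  have da := (h.contDiff_a.differentiable (by simp) s).hasDerivAt
  have db := (h.contDiff_b.differentiable (by simp) s).hasDerivAt
  have dc := (h.contDiff_c.differentiable (by simp) s).hasDerivAt
  have dz : HasDerivAt (fun s => tubeZ a b c (s, θ)) (D (1, 0)).2.2.1 s :=
    (hasFDerivAt_fst (𝕜 := ℝ) (E := ℝ) (F := ℝ)).comp_hasDerivAt s
      ((hasFDerivAt_snd (𝕜 := ℝ) (E := ℝ) (F := ℝ × ℝ)).comp_hasDerivAt s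
        ((hasFDerivAt_snd (𝕜 := ℝ) (E := ℝ) (F := ℝ × ℝ × ℝ)).comp_hasDerivAt s h1))
  have e1 : D (1, 0) = (deriv c s, 2 * deriv b s * (Real.sin θ * Real.cos θ), (D (1, 0)).2.2.1,
      deriv a s * Real.sin θ) :=
    h1.unique (dc.prodMk (((db.const_mul 2).mul_const (Real.sin θ * Real.cos θ)).prodMk
      (dz.prodMk (da.mul_const (Real.sin θ)))))
  refine ⟨(D (1, 0)).2.2.1, fun v => ?_⟩
  rw [← e1, ← e2, ← map_smul, ← map_smul, ← map_add]
  simp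

theorem isLagImmAt (h : TubeProfile a b c) (p : ℝ × ℝ) :
    IsLagImmAt (fun p => ofCanonical (tubeCan a b c p)) p := by
  obtain ⟨s, θ⟩ := p
  have hc' := h.deriv_c_pos s
  have ha := h.a_pos s
  have hb := h.b_pos s
  refine IsLagImmAt.ofCanonical h.contDiff_tubeCan.contDiffAt (h.c_pos s) ?_ fun u v => ?_
  · refine (injective_iff_map_eq_zero _).2 fun v hv => ?_
    obtain ⟨z, hz⟩ := h.fderiv_tubeCan s θ
    rw [hz] at hv
    simp only [Prod.ext_iff, Prod.fst_add, Prod.snd_add, Prod.smul_fst, Prod.smul_snd,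
      smul_eq_mul, Prod.fst_zero, Prod.snd_zero, mul_zero, add_zero] at hv
    obtain ⟨h1, h2, -, h4⟩ := hv
    have hv1 : v.1 = 0 := (mul_eq_zero.1 h1).resolve_right hc'.ne'
    simp only [hv1, zero_mul, zero_add, mul_eq_zero, ha.ne', hb.ne', false_or] at h2 h4
    have hsc := Real.sin_sq_add_cos_sq θ
    have hv2 : v.2 = 0 := by
      rcases h4 with h4 | h4
      · exact h4
      · rcases h2 with h2 | h2 | h2
        · exact h2
        · norm_num at h2
        · rw [h4] at h2 hsc
          nlinarith
    exact Prod.ext hv1 hv2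
  · obtain ⟨z, hz⟩ := h.fderiv_tubeCan s θ
    rw [hz u, hz v]
    simp only [Prod.fst_add, Prod.snd_add, Prod.smul_fst, Prod.smul_snd, smul_eq_mul]
    field_simp
    ring

end TubeProfile

/-- A Legendrian unknot whose projection to the `(x, y)`-plane is a figure-eight curve. -/
def unknotCurve (α β θ : ℝ) : R3 :=
  (α * Real.sin θ, -(2 * β * (Real.sin θ * Real.cos θ)), 2 / 3 * (α * β) * Real.cos θ ^ 3)

theorem hasDerivAt_unknotCurve (α β θ : ℝ) :
    HasDerivAt (unknotCurve α β) (α * Real.cos θ, -(2 * β * (Real.cos θ ^ 2 - Real.sin θ ^ 2)),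
      -(2 * (α * β) * (Real.cos θ ^ 2 * Real.sin θ))) θ := by
  refine ((Real.hasDerivAt_sin θ).const_mul α).prodMk ((HasDerivAt.congr_deriv
    (((Real.hasDerivAt_sin θ).mul (Real.hasDerivAt_cos θ)).const_mul (2 * β)).neg ?_).prodMk
    (HasDerivAt.congr_deriv (((Real.hasDerivAt_cos θ).fun_pow 3).const_mul _) ?_))
  · ring
  · push_cast; ring

theorem isLegendrianKnot_unknotCurve {α β : ℝ} (hα : 0 < α) (hβ : 0 < β) :
    IsLegendrianKnot (unknotCurve α β) := by
  refine ⟨by unfold unknotCurve; fun_prop, fun t => by simp [unknotCurve], fun t t' h => ?_,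
    fun t h => ?_, fun t => ?_⟩
  · simp only [unknotCurve, Prod.ext_iff] at h
    refine exists_eq_add_two_pi_mul ?_ (mul_left_cancel₀ hα.ne' h.1)
    exact (Odd.strictMono_pow (by decide : Odd 3)).injective
      (mul_left_cancel₀ (by positivity : 2 / 3 * (α * β) ≠ 0) h.2.2)
  · rw [(hasDerivAt_unknotCurve α β t).deriv] at h
    simp only [Prod.ext_iff, Prod.fst_zero, Prod.snd_zero, neg_eq_zero, mul_eq_zero, hα.ne', hβ.ne',
      false_or, OfNat.ofNat_ne_zero] at h
    have hsc := Real.sin_sq_add_cos_sq t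
    rw [h.1] at hsc h
    nlinarith [h.2.1]
  · rw [(hasDerivAt_unknotCurve α β t).deriv]
    simp only [unknotCurve]
    ring

theorem smoothlyUnknotted_unknotCurve {α β : ℝ} (hα : 0 < α) (hβ : 0 < β) :
    SmoothlyUnknotted (unknotCurve α β) := by
  have hκ : 2 / 3 * (α * β) ≠ 0 := by positivity
  refine ⟨fun u => (α * u.2, -(2 * β * (u.2 * u.1)), 2 / 3 * (α * β) * (u.1 * (1 - u.2 ^ 2))),
    by fun_prop, fun u _ v _ h => ?_, fun p _ => ?_, fun θ => ?_⟩
  · simp only [Prod.ext_iff, neg_inj] at h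
    obtain ⟨h1, h2, h3⟩ := h
    have e1 : u.2 = v.2 := mul_left_cancel₀ hα.ne' h1
    have e2 := mul_left_cancel₀ (by positivity : 2 * β ≠ 0) h2
    have e3 := mul_left_cancel₀ hκ h3
    rw [e1] at e2 e3
    refine Prod.ext ?_ e1
    linear_combination v.2 * e2 + e3
  · have hd : HasFDerivAt (fun u : ℝ × ℝ =>
        ((α * u.2, -(2 * β * (u.2 * u.1)), 2 / 3 * (α * β) * (u.1 * (1 - u.2 ^ 2))) : R3)) _ p :=
      (hasFDerivAt_snd.const_mul α).prodMk
        (((hasFDerivAt_snd.fun_mul hasFDerivAt_fst).const_mul (2 * β)).fun_neg.prodMk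
        ((hasFDerivAt_fst.fun_mul (((hasFDerivAt_snd (𝕜 := ℝ) (E := ℝ) (F := ℝ) (p := p)).pow 2).const_sub 1)).const_mul (2 / 3 * (α * β))))
    rw [hd.fderiv]
    refine (injective_iff_map_eq_zero _).2 fun v hv => ?_
    simp [Prod.ext_iff, hα.ne'] at hv
    obtain ⟨h1, h2, h3⟩ := hv
    simp [h1, hα.ne', hβ.ne'] at h2 h3
    refine Prod.ext ?_ h1
    rcases h2 with h2 | h2
    · simpa [h2, hα.ne'] using h3
    · exact h2
  · simp only [unknotCurve, Prod.mk.injEq, true_and]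
    linear_combination (-(2 / 3 * (α * β) * Real.cos θ)) * Real.sin_sq_add_cos_sq θ

namespace TubeProfile

variable {a b c : ℝ → ℝ}

theorem ofCanonical_tubeCan_inj (h : TubeProfile a b c) {s θ s' θ' : ℝ}
    (heq : ofCanonical (tubeCan a b c (s, θ)) = ofCanonical (tubeCan a b c (s', θ'))) :
    s = s' ∧ ∃ k : ℤ, θ' = θ + 2 * π * k := by
  simp only [ofCanonical, tubeCan, Prod.mk.injEq] at heq
  obtain ⟨h1, h2, h3, h4⟩ := heq
  have hs : s = s' := (strictMono_of_deriv_pos h.deriv_c_pos).injective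
    (Real.log_injOn_pos (h.c_pos s) (h.c_pos s') h1)
  subst hs
  refine ⟨rfl, ?_⟩
  have hsin := mul_left_cancel₀ (h.a_pos s).ne' h2
  refine exists_eq_add_two_pi_mul ?_ hsin
  have h5 := neg_injective ((div_left_inj' (h.c_pos s).ne').1 h3)
  have h6 := mul_left_cancel₀ (by have := h.b_pos s; positivity) h5
  rw [← hsin] at h6
  rcases eq_or_ne (Real.sin θ) 0 with h0 | h0
  · have h7 := (div_left_inj' (h.deriv_c_pos s).ne').1 h4
    have h8 := h.deriv_ab_pos s
    simp only [← hsin, h0] at h7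
    refine (Odd.strictMono_pow (by decide : Odd 3)).injective
      (mul_left_cancel₀ (by positivity : 2 / 3 * (deriv a s * b s + a s * deriv b s) ≠ 0) ?_)
    linear_combination h7
  · exact mul_left_cancel₀ h0 h6

theorem abs_tubeZ_le (h : TubeProfile a b c) (s θ : ℝ) :
    |tubeZ a b c (s, θ)| ≤ (2 * b s * |deriv a s|
      + 2 / 3 * (deriv a s * b s + a s * deriv b s)) / deriv c s := by
  have hb := h.b_pos s
  have hab := h.deriv_ab_pos s
  have hc := Real.abs_cos_le_one θ
  have hs : |Real.sin θ ^ 2| ≤ 1 := by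
    rw [abs_pow]
    exact pow_le_one₀ (abs_nonneg _) (Real.abs_sin_le_one θ)
  have hc3 : |Real.cos θ ^ 3| ≤ 1 := by
    rw [abs_pow]
    exact pow_le_one₀ (abs_nonneg _) hc
  rw [tubeZ, abs_div, abs_of_pos (h.deriv_c_pos s)]
  refine div_le_div_of_nonneg_right ((abs_add_le _ _).trans (add_le_add ?_ ?_))
    (h.deriv_c_pos s).le
  · rw [abs_mul, abs_mul, abs_mul, abs_of_pos (by positivity : 0 < 2 * b s)]
    have h0 : 0 ≤ 2 * b s * |deriv a s| := by positivity
    refine (mul_le_of_le_one_right (by positivity) hc).trans (mul_le_of_le_one_right h0 hs)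
  · rw [abs_mul, abs_of_pos (by positivity)]
    exact mul_le_of_le_one_right (by positivity) hc3

end TubeProfile

/-- A Lagrangian tube from a Legendrian unknot to the graph of `d(u₁³ / 3 + u₁ u₂²)`, whose lower
part projects to a prescribed small box. -/
theorem exists_lagrangian_tube {c₀ η : ℝ} (hc₀ : 0 < c₀) (hη : 0 < η) :
    ∃ (r₀ : ℝ) (γ₀ : ℝ → R3) (T : ℝ × ℝ → R4), 0 < r₀ ∧ r₀ < η ∧ IsLegendrianKnot γ₀ ∧
      SmoothlyUnknotted γ₀ ∧ (∀ p, IsLagImmAt T p) ∧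
      (∀ s θ, T (s, θ + 2 * π) = T (s, θ)) ∧
      (∀ s θ s' θ', T (s, θ) = T (s', θ') → s = s' ∧ ∃ k : ℤ, θ' = θ + 2 * π * k) ∧
      (∀ s θ, Real.log r₀ < s → T (s, θ) = ofCanonical
        (c₀ + Real.exp s ^ 2, 2 * Real.exp s ^ 2 * (Real.sin θ * Real.cos θ),
          Real.exp s * Real.cos θ, Real.exp s * Real.sin θ)) ∧
      (∃ T₀ : ℝ, 0 < T₀ ∧ ∀ s θ, s ≤ -T₀ → T (s, θ) = (s, γ₀ θ)) ∧
      ∀ s θ, s ≤ Real.log r₀ → (T (s, θ)).1 < Real.log c₀ + η ∧ |(T (s, θ)).2.1| < η ∧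
        |(T (s, θ)).2.2.1| < η ∧ |(T (s, θ)).2.2.2| < η := by
  obtain ⟨r₀, hr₀, hr₀η, a, b, c, h, hup, ⟨α, β, T₀, hα, hβ, hT₀, hlow⟩, hbox⟩ :=
    exists_tubeProfile hc₀ hη
  have hed : ∀ s, HasDerivAt (fun s => Real.exp s ^ 2) (2 * Real.exp s ^ 2) s := fun s =>
    ((Real.hasDerivAt_exp s).fun_pow 2).congr_deriv (by push_cast; ring)
  refine ⟨r₀, unknotCurve α β, fun p => ofCanonical (tubeCan a b c p), hr₀, hr₀η,
    isLegendrianKnot_unknotCurve hα hβ, smoothlyUnknotted_unknotCurve hα hβ, h.isLagImmAt,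
    fun s θ => by simp [tubeCan, tubeZ], fun s θ s' θ' => h.ofCanonical_tubeCan_inj,
    fun s θ hs => ?_, ⟨T₀ + 1, by positivity, fun s θ hs => ?_⟩, fun s θ hs => ?_⟩
  · have hev : ∀ᶠ x in 𝓝 s, Real.log r₀ ≤ x := (lt_mem_nhds hs).mono fun _ => le_of_lt
    have da : deriv a s = Real.exp s :=
      ((Real.hasDerivAt_exp s).congr_of_eventuallyEq (hev.mono fun x hx => (hup x hx).1)).deriv
    have db : deriv b s = 2 * Real.exp s ^ 2 :=
      ((hed s).congr_of_eventuallyEq (hev.mono fun x hx => (hup x hx).2.1)).deriv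
    have dc : deriv c s = 2 * Real.exp s ^ 2 :=
      (((hed s).const_add c₀).congr_of_eventuallyEq (hev.mono fun x hx => (hup x hx).2.2)).deriv
    obtain ⟨ha, hb, hc⟩ := hup s hs.le
    refine congrArg ofCanonical ?_
    simp only [tubeCan, tubeZ, ha, hb, hc, da, db, dc, Prod.mk.injEq, true_and, and_true]
    have := Real.exp_pos s
    rw [div_eq_iff (by positivity)]
    linear_combination (2 * Real.exp s ^ 3 * Real.cos θ) * Real.sin_sq_add_cos_sq θ
  · have hev : ∀ᶠ x in 𝓝 s, x ≤ -T₀ := (gt_mem_nhds (by linarith)).mono fun _ => le_of_lt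
    have da : deriv a s = 0 :=
      ((hasDerivAt_const s α).congr_of_eventuallyEq (hev.mono fun x hx => (hlow x hx).1)).deriv
    have db : deriv b s = β * Real.exp s := (((Real.hasDerivAt_exp s).const_mul β
      ).congr_of_eventuallyEq (hev.mono fun x hx => (hlow x hx).2.1)).deriv
    have dc : deriv c s = Real.exp s := ((Real.hasDerivAt_exp s
      ).congr_of_eventuallyEq (hev.mono fun x hx => (hlow x hx).2.2)).deriv
    obtain ⟨ha, hb, hc⟩ := hlow s (by linarith)
    have := Real.exp_pos s
    simp only [ofCanonical, unknotCurve, tubeCan, tubeZ, ha, hb, hc, da, db, dc, Real.log_exp,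
      Prod.mk.injEq, true_and]
    constructor
    · field_simp
    · field_simp
      ring
  · obtain ⟨h1, h2, h3, h4⟩ := hbox s hs
    have ha := h.a_pos s
    have hb := h.b_pos s
    have hc := h.c_pos s
    refine ⟨?_, ?_, ?_, (h.abs_tubeZ_le s θ).trans_lt h4⟩
    · have := Real.log_lt_log hc h3
      rwa [Real.log_mul hc₀.ne' (Real.exp_pos η).ne', Real.log_exp] at this
    · refine lt_of_le_of_lt ?_ h1
      simp only [ofCanonical, tubeCan, abs_mul, abs_of_pos ha]
      exact mul_le_of_le_one_right ha.le (Real.abs_sin_le_one θ)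
    · refine lt_of_le_of_lt ?_ h2
      simp only [ofCanonical, tubeCan, abs_div, abs_neg, abs_of_pos hc]
      gcongr
      rw [abs_mul (2 * b s), abs_mul (Real.sin θ), abs_of_pos (by positivity : 0 < 2 * b s)]
      exact mul_le_of_le_one_right (by positivity)
        (mul_le_one₀ (Real.abs_sin_le_one θ) (abs_nonneg _) (Real.abs_cos_le_one θ))

/-- The graph of `dg`, in the symplectization. -/
def gradGraph (g : ℝ × ℝ → ℝ) (u : ℝ × ℝ) : R4 :=
  ofCanonical (fderiv ℝ g u (1, 0), fderiv ℝ g u (0, 1), u.1, u.2)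

theorem gradGraph_congr {g g' : ℝ × ℝ → ℝ} {u : ℝ × ℝ} (h : g =ᶠ[𝓝 u] g') :
    gradGraph g u = gradGraph g' u := by
  rw [gradGraph, gradGraph, h.fderiv_eq]

theorem isLagImmAt_gradGraph {g : ℝ × ℝ → ℝ} {p : ℝ × ℝ} (hg : ContDiffAt ℝ (⊤ : ℕ∞) g p)
    (hpos : 0 < fderiv ℝ g p (1, 0)) : IsLagImmAt (gradGraph g) p := by
  have hs : ContDiffAt ℝ (⊤ : ℕ∞) (fderiv ℝ g) p := hg.fderiv_right (by simp)
  have hsym : IsSymmSndFDerivAt ℝ g p := hg.isSymmSndFDerivAt (by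
    rw [minSmoothness_of_isRCLikeNormedField]
    exact WithTop.coe_le_coe.2 (le_top : (2 : ℕ∞) ≤ ⊤))
  have hd : HasFDerivAt (fderiv ℝ g) (fderiv ℝ (fderiv ℝ g) p) p :=
    (hs.differentiableAt (by simp)).hasFDerivAt
  have hD : ∀ e : ℝ × ℝ, HasFDerivAt (fun u => fderiv ℝ g u e)
      ((ContinuousLinearMap.apply ℝ ℝ e).comp (fderiv ℝ (fderiv ℝ g) p)) p := fun e =>
    (ContinuousLinearMap.apply ℝ ℝ e).hasFDerivAt.comp p hd
  have hH : HasFDerivAt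
      (fun u : ℝ × ℝ => ((fderiv ℝ g u (1, 0), fderiv ℝ g u (0, 1), u.1, u.2) : R4)) _ p :=
    (hD (1, 0)).prodMk ((hD (0, 1)).prodMk (hasFDerivAt_fst.prodMk hasFDerivAt_snd))
  have hc : ∀ e : ℝ × ℝ, ContDiffAt ℝ (⊤ : ℕ∞) (fun u => fderiv ℝ g u e) p := fun e =>
    hs.clm_apply contDiffAt_const
  refine IsLagImmAt.ofCanonical ((hc (1, 0)).prodMk ((hc (0, 1)).prodMk (by fun_prop))) hpos ?_ ?_
  · rw [hH.fderiv]
    refine (injective_iff_map_eq_zero _).2 fun v hv => ?_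
    simp only [Prod.ext_iff] at hv
    exact Prod.ext hv.2.2.1 hv.2.2.2
  · intro u v
    rw [hH.fderiv]
    have hsplit : ∀ w : ℝ × ℝ, w = w.1 • (1, 0) + w.2 • (0, 1) := fun w => by simp
    have h1 := hsym (1, 0) (0, 1)
    have key : ∀ w e, fderiv ℝ (fderiv ℝ g) p w e = w.1 * fderiv ℝ (fderiv ℝ g) p (1, 0) e
        + w.2 * fderiv ℝ (fderiv ℝ g) p (0, 1) e := fun w e => by
      calc _ = fderiv ℝ (fderiv ℝ g) p (w.1 • (1, 0) + w.2 • (0, 1)) e := by rw [← hsplit]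
        _ = _ := by rw [map_add, map_smul, map_smul]; rfl
    simp only [ContinuousLinearMap.prod_apply, ContinuousLinearMap.comp_apply,
      ContinuousLinearMap.apply_apply, ContinuousLinearMap.coe_fst', ContinuousLinearMap.coe_snd']
    rw [key u, key v, key u, key v, h1]
    ring

theorem exists_gradGraph_eq {F : ℝ × ℝ → R4} {ρ : ℝ}
    (hF : ∀ u, ‖u‖ < ρ → IsLagImmAt F u ∧ (F u).2.2.2 = u.1 ∧ (F u).2.1 = u.2) :
    ∃ g : ℝ × ℝ → ℝ, ∀ u, ‖u‖ < ρ → ContDiffAt ℝ (⊤ : ℕ∞) g u ∧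
      fderiv ℝ g u (1, 0) = Real.exp (F u).1 ∧
      fderiv ℝ g u (0, 1) = -(Real.exp (F u).1 * (F u).2.2.1) ∧ gradGraph g u = F u := by
  let P : ℝ × ℝ → ℝ := fun u => Real.exp (F u).1
  let Q : ℝ × ℝ → ℝ := fun u => -(Real.exp (F u).1 * (F u).2.2.1)
  let ω : ℝ × ℝ → ℝ × ℝ →L[ℝ] ℝ := fun u =>
    P u • ContinuousLinearMap.fst ℝ ℝ ℝ + Q u • ContinuousLinearMap.snd ℝ ℝ ℝ
  have hball : ∀ u : ℝ × ℝ, u ∈ Metric.ball (0 : ℝ × ℝ) ρ ↔ ‖u‖ < ρ := fun u => by simp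
  have hωs : ∀ u, ‖u‖ < ρ → ContDiffAt ℝ (⊤ : ℕ∞) ω u := fun u hu => by
    have := (hF u hu).1.1
    have hP : ContDiffAt ℝ (⊤ : ℕ∞) P u := ContDiffAt.exp (by fun_prop)
    have hQ : ContDiffAt ℝ (⊤ : ℕ∞) Q u := (hP.mul (by fun_prop)).neg
    exact (hP.smul contDiffAt_const).add (hQ.smul contDiffAt_const)
  have hnhds : ∀ u : ℝ × ℝ, ‖u‖ < ρ → ∀ᶠ v in 𝓝 u, ‖v‖ < ρ := fun u hu =>
    continuous_norm.continuousAt.eventually (gt_mem_nhds hu)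
  obtain ⟨g, hg⟩ := (convex_ball (0 : ℝ × ℝ) ρ).exists_forall_hasFDerivAt_of_fderiv_symmetric
    (ω := ω) Metric.isOpen_ball
    (fun u hu => ((hωs u ((hball u).1 hu)).differentiableAt (by simp)).differentiableWithinAt) (by
      intro p hp x y
      replace hp := (hball p).1 hp
      obtain ⟨⟨hs, -, hL⟩, -, -⟩ := hF p hp
      have hd : HasFDerivAt F (fderiv ℝ F p) p := (hs.differentiableAt (by simp)).hasFDerivAt
      set D := fderiv ℝ F p
      have d3 : ∀ w, (D w).2.2.2 = w.1 := fun w => by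
        have e : (fun u => (F u).2.2.2) =ᶠ[𝓝 p] Prod.fst :=
          (hnhds p hp).mono fun v hv => (hF v hv).2.1
        have := (hd.snd.snd.snd.congr_of_eventuallyEq e.symm).unique hasFDerivAt_fst
        simpa using DFunLike.congr_fun this w
      have d1 : ∀ w, (D w).2.1 = w.2 := fun w => by
        have e : (fun u => (F u).2.1) =ᶠ[𝓝 p] Prod.snd :=
          (hnhds p hp).mono fun v hv => (hF v hv).2.2
        have := (hd.snd.fst.congr_of_eventuallyEq e.symm).unique hasFDerivAt_snd
        simpa using DFunLike.congr_fun this w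
      have hP := hd.fst.exp
      have hQ := (hP.fun_mul hd.snd.snd.fst).fun_neg
      have hω := (hP.smul_const (ContinuousLinearMap.fst ℝ ℝ ℝ)).fun_add
        (hQ.smul_const (ContinuousLinearMap.snd ℝ ℝ ℝ))
      have e : fderiv ℝ ω p = _ := hω.fderiv
      have := hL x y
      simp only [symplForm, d1, d3] at this
      rw [e]
      simp
      linear_combination this)
  have hgd : ∀ u, ‖u‖ < ρ → HasFDerivAt g (ω u) u := fun u hu => hg u ((hball u).2 hu)
  refine ⟨g, fun u hu => ?_⟩
  have e1 : fderiv ℝ g u (1, 0) = P u := by rw [(hgd u hu).fderiv]; simp [ω]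
  have e2 : fderiv ℝ g u (0, 1) = Q u := by rw [(hgd u hu).fderiv]; simp [ω]
  refine ⟨?_, e1, e2, ?_⟩
  · refine ContDiffOn.contDiffAt ((contDiffOn_infty_iff_fderiv_of_isOpen Metric.isOpen_ball).2
      ⟨fun v hv => ((hg v hv).differentiableAt).differentiableWithinAt, fun v hv => ?_⟩)
      (Metric.isOpen_ball.mem_nhds ((hball u).2 hu))
    refine ((hωs v ((hball v).1 hv)).congr_of_eventuallyEq ?_).contDiffWithinAt
    exact (hnhds v ((hball v).1 hv)).mono fun w hw => (hgd w hw).fderiv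
  · rw [gradGraph, e1, e2, ← (hF u hu).2.1, ← (hF u hu).2.2]
    have := Real.exp_pos (F u).1
    simp only [ofCanonical, P, Q, Real.log_exp, neg_neg, mul_div_cancel_left₀ _ this.ne']

theorem hasFDerivAt_modelPotential (c₀ : ℝ) (u : ℝ × ℝ) :
    HasFDerivAt (fun u : ℝ × ℝ => c₀ * u.1 + (u.1 ^ 3 / 3 + u.1 * u.2 ^ 2))
      ((c₀ + (u.1 ^ 2 + u.2 ^ 2)) • ContinuousLinearMap.fst ℝ ℝ ℝ
        + (2 * (u.1 * u.2)) • ContinuousLinearMap.snd ℝ ℝ ℝ) u := by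
  have h1 : HasFDerivAt (fun u : ℝ × ℝ => u.1) (ContinuousLinearMap.fst ℝ ℝ ℝ) u := hasFDerivAt_fst
  have h2 : HasFDerivAt (fun u : ℝ × ℝ => u.2) (ContinuousLinearMap.snd ℝ ℝ ℝ) u := hasFDerivAt_snd
  refine ((h1.const_mul c₀).add (((h1.pow 3).mul_const (1 / 3)).add
    (h1.fun_mul (h2.pow 2)))).congr_fderiv ?_ |>.congr_of_eventuallyEq
      (Eventually.of_forall fun v => ?_)
  · ext
    · simp
    · simp; ring
  · simp only [Pi.add_apply]; ring

theorem gradGraph_modelPotential (c₀ k : ℝ) (u : ℝ × ℝ) :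
    gradGraph (fun u => c₀ * u.1 + (u.1 ^ 3 / 3 + u.1 * u.2 ^ 2) + k) u
      = ofCanonical (c₀ + (u.1 ^ 2 + u.2 ^ 2), 2 * (u.1 * u.2), u.1, u.2) := by
  rw [gradGraph, ((hasFDerivAt_modelPotential c₀ u).add_const k).fderiv]
  simp

/-- Near a minimum of `t` at which it is a graph over the `(z, x)`-plane, an embedded Lagrangian
disc can be modified to a standard model, which is separated from the rest of the disc by a box. -/
theorem exists_local_modification {F : ℝ × ℝ → R4} {t₀ : ℝ} (hlag : ∀ p, IsLagImmAt F p)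
    (hinj : Function.Injective F)
    (hprop : ∀ K : Set R4, IsCompact K → ∃ M : ℝ, ∀ p : ℝ × ℝ, F p ∈ K → ‖p‖ ≤ M)
    (h0 : F 0 = (t₀, 0, 0, 0)) (hmin : ∀ u, t₀ ≤ (F u).1)
    (hgraph : ∀ᶠ u in 𝓝 0, (F u).2.2.2 = u.1 ∧ (F u).2.1 = u.2) :
    ∃ (G : ℝ × ℝ → R4) (ε η : ℝ), 0 < ε ∧ 0 < η ∧ (∀ p, IsLagImmAt G p) ∧
      Function.Injective G ∧ (∃ R, ∀ u, R ≤ ‖u‖ → G u = F u) ∧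
      (∀ u, ‖u‖ < ε → G u
        = ofCanonical (Real.exp t₀ + (u.1 ^ 2 + u.2 ^ 2), 2 * (u.1 * u.2), u.1, u.2)) ∧
      ∀ u, ε / 2 ≤ ‖u‖ → ¬ ((G u).1 < t₀ + η ∧ |(G u).2.1| < η ∧ |(G u).2.2.1| < η ∧
        |(G u).2.2.2| < η) := by
  have hFc : Continuous F := continuous_iff_continuousAt.2 fun p => (hlag p).1.continuousAt
  obtain ⟨ρ, hρ, hgr⟩ := Metric.eventually_nhds_iff.1 hgraph
  simp only [dist_zero_right] at hgr
  obtain ⟨g, hg⟩ := exists_gradGraph_eq fun u hu => ⟨hlag u, hgr hu⟩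
  -- the part of the disc away from `0` avoids a box
  obtain ⟨η₁, hη₁, hbox⟩ : ∃ η₁ > 0, ∀ u, ρ / 2 ≤ ‖u‖ → ¬ ((F u).1 < t₀ + η₁ ∧
      |(F u).2.1| < η₁ ∧ |(F u).2.2.1| < η₁ ∧ |(F u).2.2.2| < η₁) := by
    obtain ⟨M, hM⟩ := hprop _ (isCompact_closedBall (F 0) 1)
    have hA : IsCompact (F '' {u | ρ / 2 ≤ ‖u‖ ∧ ‖u‖ ≤ M}) := by
      refine IsCompact.image ?_ hFc
      refine (isCompact_closedBall (0 : ℝ × ℝ) M).of_isClosed_subset ?_ fun u hu => by simpa using hu.2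
      exact (isClosed_le continuous_const continuous_norm).inter
        (isClosed_le continuous_norm continuous_const)
    have hn : F 0 ∉ F '' {u | ρ / 2 ≤ ‖u‖ ∧ ‖u‖ ≤ M} := by
      rintro ⟨u, hu, h⟩
      have := hu.1
      rw [hinj h, norm_zero] at this
      linarith
    obtain ⟨η, hη, hd⟩ := Metric.mem_nhds_iff.1 (hA.isClosed.isOpen_compl.mem_nhds hn)
    refine ⟨min η 1, by positivity, fun u hu ⟨h1, h2, h3, h4⟩ => ?_⟩
    have hdist : dist (F u) (F 0) < min η 1 := by
      rw [h0]
      simp only [Prod.dist_eq, Real.dist_eq, sub_zero, max_lt_iff]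
      refine ⟨?_, h2, h3, h4⟩
      rw [abs_of_nonneg (sub_nonneg.2 (hmin u))]
      linarith
    exact hd (Metric.mem_ball.2 (hdist.trans_le (min_le_left _ _)))
      ⟨u, ⟨hu, hM u (Metric.mem_closedBall.2 (hdist.le.trans (min_le_right _ _)))⟩, rfl⟩
  -- a neighbourhood in canonical coordinates mapped into the box
  obtain ⟨κ, hκ, hκbox⟩ : ∃ κ > 0, ∀ w : R4, ‖w - (Real.exp t₀, 0, 0, 0)‖ < κ → 0 < w.1 ∧
      (ofCanonical w).1 < t₀ + η₁ ∧ |(ofCanonical w).2.1| < η₁ ∧ |(ofCanonical w).2.2.1| < η₁ ∧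
      |(ofCanonical w).2.2.2| < η₁ := by
    have hpos : 0 < ((Real.exp t₀, 0, 0, 0) : R4).1 := Real.exp_pos t₀
    have hc := (contDiffAt_ofCanonical hpos).continuousAt
    have hv : ofCanonical (Real.exp t₀, 0, 0, 0) = (t₀, 0, 0, 0) := by simp [ofCanonical]
    have e1 : ∀ᶠ w : R4 in 𝓝 (Real.exp t₀, 0, 0, 0), 0 < w.1 :=
      continuous_fst.continuousAt.eventually (lt_mem_nhds hpos)
    have e2 := (hc.fst.eventually (gt_mem_nhds (show _ < t₀ + η₁ by simp only [hv]; simpa using hη₁)))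
    have e3 := (hc.snd.fst.abs.eventually (gt_mem_nhds (show _ < η₁ by simp only [hv]; simpa using hη₁)))
    have e4 := (hc.snd.snd.fst.abs.eventually
      (gt_mem_nhds (show _ < η₁ by simp only [hv]; simpa using hη₁)))
    have e5 := (hc.snd.snd.snd.abs.eventually
      (gt_mem_nhds (show _ < η₁ by simp only [hv]; simpa using hη₁)))
    obtain ⟨κ, hκ, h⟩ := Metric.eventually_nhds_iff.1 (e1.and (e2.and (e3.and (e4.and e5))))
    exact ⟨κ, hκ, fun w hw => h (by rwa [dist_eq_norm])⟩
  obtain ⟨ρ₁, hρ₁, hclose⟩ : ∃ ρ₁ > 0, ∀ u, ‖u‖ < ρ₁ →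
      ‖(((Real.exp (F u).1, -(Real.exp (F u).1 * (F u).2.2.1), u.1, u.2) : R4)
        - (Real.exp t₀, 0, 0, 0))‖ < κ / 2 := by
    have hcont : Continuous fun u : ℝ × ℝ =>
      ‖(((Real.exp (F u).1, -(Real.exp (F u).1 * (F u).2.2.1), u.1, u.2) : R4)
        - (Real.exp t₀, 0, 0, 0))‖ := by fun_prop
    obtain ⟨ρ₁, hρ₁, h⟩ := Metric.eventually_nhds_iff.1 ((hcont.continuousAt (x := 0)).eventually
      (gt_mem_nhds (show _ < κ / 2 by simp [h0, hκ])))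
    exact ⟨ρ₁, hρ₁, fun u hu => h (by simpa using hu)⟩
  -- the cutoff function
  obtain ⟨M, hM, hcut⟩ := exists_cutoff
  let k : ℝ × ℝ → ℝ := fun u => Real.exp t₀ * u.1 + (u.1 ^ 3 / 3 + u.1 * u.2 ^ 2)
  have hk : ContDiff ℝ (⊤ : ℕ∞) k := by fun_prop
  have hgs0 := hg 0 (by simpa using hρ)
  have hDf : fderiv ℝ (fun u => k u + g 0 - g u) 0 = 0 := by
    rw [(((hasFDerivAt_modelPotential (Real.exp t₀) 0).add_const (g 0)).fun_sub
      (hgs0.1.differentiableAt (by simp)).hasFDerivAt).fderiv]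
    ext
    · simp [hgs0.2.1, h0]
    · simp [hgs0.2.2.1, h0]
  have hε := hcut ℝ (fun u => k u + g 0 - g u) (by
      filter_upwards [Metric.ball_mem_nhds (0 : ℝ × ℝ) hρ] with u hu
      exact (hk.contDiffAt.add contDiffAt_const).sub (hg u (by simpa using hu)).1)
    (by simp [k]) (κ / (2 * M)) (by rw [hDf, norm_zero]; positivity)
  obtain ⟨ε, ⟨h, hhs, hhin, hhout, hhd⟩, hε4, hε0⟩ := (hε.and
    ((eventually_nhdsWithin_of_eventually_nhds (gt_mem_nhds
      (show (0 : ℝ) < min (ρ / 2) ρ₁ / 2 by positivity))).and self_mem_nhdsWithin)).exists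
  replace hε0 : 0 < ε := hε0
  have hερ : 2 * ε < ρ / 2 := by have := min_le_left (ρ / 2) ρ₁; linarith
  have hερ₁ : 2 * ε < ρ₁ := by have := min_le_right (ρ / 2) ρ₁; linarith
  have hhd' : ∀ u e, ‖e‖ ≤ 1 → ‖fderiv ℝ h u e‖ ≤ κ / 2 := fun u e he => by
    have h1 := (fderiv ℝ h u).le_opNorm e
    have h2 : ‖fderiv ℝ h u‖ * ‖e‖ ≤ (M * (κ / (2 * M))) * 1 :=
      mul_le_mul (hhd u) he (norm_nonneg _) (by positivity)
    have h3 : (M * (κ / (2 * M))) * 1 = κ / 2 := by field_simp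
    linarith
  have hsum : ∀ u e, ‖u‖ < ρ → fderiv ℝ (fun u => g u + h u) u e
      = fderiv ℝ g u e + fderiv ℝ h u e := fun u e hu => by
    rw [((hg u hu).1.differentiableAt (by simp)).hasFDerivAt.fun_add
      (hhs.differentiable (by simp) u).hasFDerivAt |>.fderiv]
    rfl
  have hnear : ∀ u, ‖u‖ < ρ → ‖u‖ < ρ₁ → ‖((fderiv ℝ (fun u => g u + h u) u (1, 0),
      fderiv ℝ (fun u => g u + h u) u (0, 1), u.1, u.2) : R4) - (Real.exp t₀, 0, 0, 0)‖ < κ := by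
    intro u hu hu1
    rw [hsum u _ hu, hsum u _ hu, (hg u hu).2.1, (hg u hu).2.2.1]
    have e1 := hclose u hu1
    have e2 : ‖((fderiv ℝ h u (1, 0), fderiv ℝ h u (0, 1), 0, 0) : R4)‖ ≤ κ / 2 := by
      simp only [Prod.norm_def, norm_zero, max_le_iff]
      exact ⟨hhd' u _ (by simp [Prod.norm_def]), hhd' u _ (by simp [Prod.norm_def]),
        by positivity, by positivity⟩
    have e3 := (norm_add_le _ _).trans_lt (add_lt_add_of_lt_of_le e1 e2)
    rw [add_halves] at e3
    refine lt_of_le_of_lt (le_of_eq (congrArg _ ?_)) e3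
    ext <;> simp
    ring
  let G : ℝ × ℝ → R4 := fun u => if ‖u‖ < ρ then gradGraph (fun u => g u + h u) u else F u
  have hGin : ∀ u, ‖u‖ < ρ → G u = gradGraph (fun u => g u + h u) u := fun u hu => if_pos hu
  have hGq : ∀ u, ‖u‖ < ρ → (G u).2.2.2 = u.1 ∧ (G u).2.1 = u.2 := fun u hu => by
    rw [hGin u hu]; exact ⟨rfl, rfl⟩
  have hGout : ∀ u, 2 * ε < ‖u‖ → G u = F u := fun u hu => by
    by_cases hρu : ‖u‖ < ρ
    · rw [hGin u hρu, ← (hg u hρu).2.2.2]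
      refine gradGraph_congr ?_
      filter_upwards [continuous_norm.continuousAt.eventually (lt_mem_nhds hu)] with v hv
      rw [hhout v hv.le, add_zero]
    · exact if_neg hρu
  have hGbox : ∀ u, ‖u‖ < ρ → ‖u‖ < ρ₁ → (G u).1 < t₀ + η₁ ∧
      |(G u).2.1| < η₁ ∧ |(G u).2.2.1| < η₁ ∧ |(G u).2.2.2| < η₁ := fun u hu hu1 => by
    rw [hGin u hu]
    exact (hκbox _ (hnear u hu hu1)).2
  have hsep : ∀ u v, ‖u‖ ≤ 2 * ε → ρ ≤ ‖v‖ → G u ≠ G v := fun u v hu hv huv => by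
    have := hGbox u (by linarith) (by linarith)
    rw [huv, hGout v (by linarith)] at this
    exact hbox v (by linarith) this
  refine ⟨G, ε, min η₁ (ε / 2), hε0, by positivity, fun p => ?_, fun u v huv => ?_,
    ⟨2 * ε + 1, fun u hu => hGout u (by linarith)⟩, fun u hu => ?_, fun u hu => ?_⟩
  · rcases lt_or_ge (2 * ε) ‖p‖ with hp | hp
    · exact (hlag p).congr
        ((continuous_norm.continuousAt.eventually (lt_mem_nhds hp)).mono hGout)
    · have hpρ : ‖p‖ < ρ := by linarith
      refine (isLagImmAt_gradGraph ((hg p hpρ).1.add hhs.contDiffAt) ?_).congr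
        ((continuous_norm.continuousAt.eventually (gt_mem_nhds hpρ)).mono hGin)
      exact (hκbox _ (hnear p hpρ (by linarith))).1
  · rcases lt_or_ge ‖u‖ ρ with hu | hu <;> rcases lt_or_ge ‖v‖ ρ with hv | hv
    · refine Prod.ext ?_ ?_
      · rw [← (hGq u hu).1, ← (hGq v hv).1, huv]
      · rw [← (hGq u hu).2, ← (hGq v hv).2, huv]
    · rcases lt_or_ge (2 * ε) ‖u‖ with hu' | hu'
      · rw [hGout u hu', hGout v (by linarith)] at huv
        exact hinj huv
      · exact absurd huv (hsep u v hu' hv)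
    · rcases lt_or_ge (2 * ε) ‖v‖ with hv' | hv'
      · rw [hGout v hv', hGout u (by linarith)] at huv
        exact hinj huv
      · exact absurd huv.symm (hsep v u hv' hu)
    · rw [hGout v (by linarith), hGout u (by linarith)] at huv
      exact hinj huv
  · rw [hGin u (by linarith), ← gradGraph_modelPotential _ (g 0)]
    refine gradGraph_congr ?_
    filter_upwards [continuous_norm.continuousAt.eventually (gt_mem_nhds hu)] with v hv
    rw [hhin v hv]
    simp [k]
  · rintro ⟨h1, h2, h3, h4⟩
    rcases lt_or_ge ‖u‖ ρ with hρu | hρu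
    · rw [(hGq u hρu).1] at h4
      rw [(hGq u hρu).2] at h2
      have : ‖u‖ < ε / 2 := by
        rw [Prod.norm_def, max_lt_iff]
        exact ⟨h4.trans_le (min_le_right _ _), h2.trans_le (min_le_right _ _)⟩
      linarith
    · rw [hGout u (by linarith)] at h1 h2 h3 h4
      have hm := min_le_left η₁ (ε / 2)
      exact hbox u (by linarith) ⟨by linarith, by linarith, by linarith, by linarith⟩

/-- Exponential polar coordinates on the punctured plane. -/
def expPolar (p : ℝ × ℝ) : ℝ × ℝ :=
  (Real.exp p.1 * Real.cos p.2, Real.exp p.1 * Real.sin p.2)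

theorem contDiff_expPolar : ContDiff ℝ (⊤ : ℕ∞) expPolar := by
  have := Real.contDiff_exp (n := (⊤ : ℕ∞))
  unfold expPolar
  fun_prop

theorem fderiv_expPolar_injective (p : ℝ × ℝ) : Function.Injective (fderiv ℝ expPolar p) := by
  have h1 : HasFDerivAt (fun p : ℝ × ℝ => p.1) (ContinuousLinearMap.fst ℝ ℝ ℝ) p := hasFDerivAt_fst
  have h2 : HasFDerivAt (fun p : ℝ × ℝ => p.2) (ContinuousLinearMap.snd ℝ ℝ ℝ) p := hasFDerivAt_snd
  have hd : HasFDerivAt expPolar _ p := (h1.exp.fun_mul h2.cos).prodMk (h1.exp.fun_mul h2.sin)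
  rw [hd.fderiv]
  refine (injective_iff_map_eq_zero _).2 fun v hv => ?_
  have hE := Real.exp_pos p.1
  have hsc := Real.sin_sq_add_cos_sq p.2
  simp [Prod.ext_iff] at hv
  obtain ⟨e1, e2⟩ := hv
  have e3 : Real.exp p.1 * v.1 = 0 := by
    linear_combination Real.cos p.2 * e1 + Real.sin p.2 * e2 - Real.exp p.1 * v.1 * hsc
  have e4 : Real.exp p.1 * v.2 = 0 := by
    linear_combination Real.cos p.2 * e2 - Real.sin p.2 * e1 - Real.exp p.1 * v.2 * hsc
  exact Prod.ext ((mul_eq_zero.1 e3).resolve_left hE.ne') ((mul_eq_zero.1 e4).resolve_left hE.ne')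

theorem expPolar_inj {s θ s' θ' : ℝ} (h : expPolar (s, θ) = expPolar (s', θ')) :
    s = s' ∧ ∃ k : ℤ, θ' = θ + 2 * π * k := by
  simp only [expPolar, Prod.mk.injEq] at h
  obtain ⟨h1, h2⟩ := h
  have hE := Real.exp_pos s
  have hE' := Real.exp_pos s'
  have hs : s = s' := by
    refine Real.exp_injective ((sq_eq_sq₀ hE.le hE'.le).1 ?_)
    have e1 := Real.sin_sq_add_cos_sq θ
    have e2 := Real.sin_sq_add_cos_sq θ'
    linear_combination (Real.exp s * Real.cos θ + Real.exp s' * Real.cos θ') * h1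
      + (Real.exp s * Real.sin θ + Real.exp s' * Real.sin θ') * h2
      - Real.exp s ^ 2 * e1 + Real.exp s' ^ 2 * e2
  subst hs
  exact ⟨rfl, exists_eq_add_two_pi_mul (mul_left_cancel₀ hE.ne' h1) (mul_left_cancel₀ hE.ne' h2)⟩

theorem norm_expPolar_le (p : ℝ × ℝ) : ‖expPolar p‖ ≤ Real.exp p.1 := by
  have hE := Real.exp_pos p.1
  simp only [expPolar, Prod.norm_def, Real.norm_eq_abs, abs_mul, Real.abs_exp, max_le_iff]
  exact ⟨mul_le_of_le_one_right hE.le (Real.abs_cos_le_one _),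
    mul_le_of_le_one_right hE.le (Real.abs_sin_le_one _)⟩

theorem exp_div_two_le_norm_expPolar (p : ℝ × ℝ) : Real.exp p.1 / 2 ≤ ‖expPolar p‖ := by
  by_contra! h
  have hE := Real.exp_pos p.1
  simp only [expPolar, Prod.norm_def, Real.norm_eq_abs, max_lt_iff] at h
  have h1 := sq_lt_sq' (abs_lt.1 h.1).1 (abs_lt.1 h.1).2
  have h2 := sq_lt_sq' (abs_lt.1 h.2).1 (abs_lt.1 h.2).2
  have h3 : (Real.exp p.1 * Real.cos p.2) ^ 2 + (Real.exp p.1 * Real.sin p.2) ^ 2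
      = Real.exp p.1 ^ 2 := by
    linear_combination Real.exp p.1 ^ 2 * Real.sin_sq_add_cos_sq p.2
  nlinarith

theorem Ds_eq_fderiv {C : ℝ × ℝ → R4} {p : ℝ × ℝ} (hC : DifferentiableAt ℝ C p) :
    Ds C p = fderiv ℝ C p (1, 0) :=
  (hC.hasFDerivAt.comp_hasDerivAt (f := fun s => (s, p.2)) p.1
    ((hasDerivAt_id p.1).prodMk (hasDerivAt_const p.1 p.2))).deriv

theorem Dtheta_eq_fderiv {C : ℝ × ℝ → R4} {p : ℝ × ℝ} (hC : DifferentiableAt ℝ C p) :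
    Dtheta C p = fderiv ℝ C p (0, 1) :=
  (hC.hasFDerivAt.comp_hasDerivAt (f := fun θ => (p.1, θ)) p.2
    ((hasDerivAt_const p.2 p.1).prodMk (hasDerivAt_id p.2))).deriv

theorem isLagrangianConcordance_of_isLagImmAt {C : ℝ × ℝ → R4} {γ₀ γ : ℝ → R3}
    (hC : ∀ p, IsLagImmAt C p) (hper : ∀ s θ : ℝ, C (s, θ + 2 * π) = C (s, θ))
    (hinj : ∀ s θ s' θ' : ℝ, C (s, θ) = C (s', θ') → s = s' ∧ ∃ k : ℤ, θ' = θ + 2 * π * k)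
    (hends : ∃ T : ℝ, 0 < T ∧ (∀ s θ : ℝ, s ≤ -T → C (s, θ) = (s, γ₀ θ)) ∧
      (∀ s θ : ℝ, T ≤ s → C (s, θ) = (s, γ θ))) :
    IsLagrangianConcordance C γ₀ γ := by
  have hd : ∀ p, DifferentiableAt ℝ C p := fun p => (hC p).1.differentiableAt (by simp)
  refine ⟨contDiff_iff_contDiffAt.2 fun p => (hC p).1, hper, hinj, fun p a b h => ?_,
    fun K hK => ?_, fun p => ?_, hends⟩
  · rw [Ds_eq_fderiv (hd p), Dtheta_eq_fderiv (hd p), ← map_smul, ← map_smul, ← map_add] at h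
    have := (injective_iff_map_eq_zero _).1 (hC p).2.1 _ h
    simpa using this
  · obtain ⟨T, hT, hlow, hup⟩ := hends
    obtain ⟨B, hB⟩ := hK.isBounded.exists_norm_le
    refine ⟨max T B, fun s θ hs => ?_⟩
    by_contra! hM
    obtain ⟨h1, h2⟩ := max_lt_iff.1 hM
    have h3 : (C (s, θ)).1 = s := by
      rcases lt_abs.1 h1 with h | h
      · rw [hup s θ h.le]
      · rw [hlow s θ (by linarith)]
    have h4 := (norm_fst_le (C (s, θ))).trans (hB _ hs)
    rw [h3, Real.norm_eq_abs] at h4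
    linarith
  · rw [Ds_eq_fderiv (hd p), Dtheta_eq_fderiv (hd p)]
    exact (hC p).2.2 _ _

theorem IsLagrangianDiscFilling.isLagImmAt {F : ℝ × ℝ → R4} {γ : ℝ → R3}
    (hF : IsLagrangianDiscFilling F γ) (p : ℝ × ℝ) : IsLagImmAt F p :=
  ⟨hF.1.contDiffAt, hF.2.2.2.1 p, hF.2.2.2.2.1 p⟩

/-- A filling which is a graph over the `(z, x)`-plane near a minimum of `t` can be replaced near
this minimum by a Lagrangian tube starting from an unknot. -/
theorem exists_concordance_of_graph_at_min {F : ℝ × ℝ → R4} {γ : ℝ → R3}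
    (hF : IsLagrangianDiscFilling F γ) {t₀ : ℝ} (h0 : F 0 = (t₀, 0, 0, 0))
    (hmin : ∀ u, t₀ ≤ (F u).1)
    (hgraph : ∀ᶠ u in 𝓝 0, (F u).2.2.2 = u.1 ∧ (F u).2.1 = u.2) :
    ∃ (γ₀ : ℝ → R3) (C : ℝ × ℝ → R4),
      IsLegendrianKnot γ₀ ∧ SmoothlyUnknotted γ₀ ∧ IsLagrangianConcordance C γ₀ γ := by
  obtain ⟨G, ε, η, hε, hη, hG, hGinj, ⟨R₁, hR₁⟩, hGin, hGbox⟩ :=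
    exists_local_modification hF.isLagImmAt hF.2.1 hF.2.2.1 h0 hmin hgraph
  obtain ⟨R₂, hR₂, hFend⟩ := hF.2.2.2.2.2
  obtain ⟨r₀, γ₀, T, hr₀, hr₀ε, hγ₀, hγ₀', hT, hTper, hTinj, hTup, ⟨T₀, hT₀, hTlow⟩, hTbox⟩ :=
    exists_lagrangian_tube (Real.exp_pos t₀) (lt_min hη hε)
  rw [Real.log_exp] at hTbox
  have hrε : Real.log r₀ < Real.log ε := Real.log_lt_log hr₀ (hr₀ε.trans_le (min_le_right _ _))
  have hmη : min η ε ≤ η := min_le_left _ _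
  let C : ℝ × ℝ → R4 := fun p => if p.1 < Real.log ε then T p else G (expPolar p)
  have hCT : ∀ p : ℝ × ℝ, p.1 < Real.log ε → C p = T p := fun p hp => if_pos hp
  have hCG : ∀ p : ℝ × ℝ, Real.log r₀ < p.1 → C p = G (expPolar p) := fun p hp => by
    by_cases hp' : p.1 < Real.log ε
    · have hn : ‖expPolar p‖ < ε :=
        (norm_expPolar_le p).trans_lt ((Real.lt_log_iff_exp_lt hε).1 hp')
      rw [hCT p hp', hGin _ hn]
      refine (hTup p.1 p.2 hp).trans (congrArg ofCanonical ?_)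
      simp only [expPolar, Prod.mk.injEq, and_true]
      constructor
      · linear_combination -Real.exp p.1 ^ 2 * Real.sin_sq_add_cos_sq p.2
      · ring
    · exact if_neg hp'
  have hsep : ∀ p q : ℝ × ℝ, p.1 ≤ Real.log r₀ → Real.log ε ≤ q.1 → C p ≠ C q := by
    intro p q hp hq h
    obtain ⟨b1, b2, b3, b4⟩ := hTbox p.1 p.2 hp
    rw [hCT p (hp.trans_lt hrε), hCG q (hrε.trans_le hq)] at h
    refine hGbox (expPolar q) ?_ ?_
    · have := exp_div_two_le_norm_expPolar q
      have := (Real.log_le_iff_le_exp hε).1 hq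
      linarith
    · rw [← h]
      exact ⟨by linarith, by linarith, by linarith, by linarith⟩
  refine ⟨γ₀, C, hγ₀, hγ₀', isLagrangianConcordance_of_isLagImmAt (fun p => ?_) (fun s θ => ?_)
    (fun s θ s' θ' h => ?_)
    ⟨T₀ + |Real.log ε| + 1 + 2 * |R₁| + R₂, by positivity, fun s θ hs => ?_, fun s θ hs => ?_⟩⟩
  · rcases lt_or_ge p.1 (Real.log ε) with hp | hp
    · exact (hT p).congr ((continuous_fst.continuousAt.eventually (gt_mem_nhds hp)).mono hCT)
    · exact ((hG _).comp contDiff_expPolar.contDiffAt (fderiv_expPolar_injective p)).congr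
        ((continuous_fst.continuousAt.eventually (lt_mem_nhds (hrε.trans_le hp))).mono hCG)
  · simp only [C, hTper, expPolar, Real.cos_add_two_pi, Real.sin_add_two_pi]
  · rcases lt_or_ge (Real.log r₀) s with h1 | h1 <;> rcases lt_or_ge (Real.log r₀) s' with h2 | h2
    · rw [hCG _ h1, hCG _ h2] at h
      exact expPolar_inj (hGinj h)
    · rcases lt_or_ge s (Real.log ε) with h3 | h3
      · rw [hCT _ h3, hCT _ (h2.trans_lt hrε)] at h
        exact hTinj _ _ _ _ h
      · exact absurd h.symm (hsep _ _ h2 h3)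
    · rcases lt_or_ge s' (Real.log ε) with h3 | h3
      · rw [hCT _ (h1.trans_lt hrε), hCT _ h3] at h
        exact hTinj _ _ _ _ h
      · exact absurd h (hsep _ _ h1 h3)
    · rw [hCT _ (h1.trans_lt hrε), hCT _ (h2.trans_lt hrε)] at h
      exact hTinj _ _ _ _ h
  · have e1 := neg_abs_le (Real.log ε)
    have e2 := abs_nonneg R₁
    have e3 := abs_nonneg (Real.log ε)
    rw [hCT _ (show s < Real.log ε by linarith), hTlow s θ (by linarith)]
  · have e1 := le_abs_self (Real.log ε)
    have e2 := le_abs_self R₁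
    have e2' := abs_nonneg R₁
    have e3 := abs_nonneg (Real.log ε)
    have e4 := Real.add_one_le_exp s
    have e5 := exp_div_two_le_norm_expPolar (s, θ)
    rw [hCG _ (show Real.log r₀ < s by linarith), hR₁ _ (by simp only at e5; linarith)]
    have := hFend (Real.exp s) θ (by linarith)
    rwa [Real.log_exp] at this

/-- A smooth self-map of `ℝ³` with smooth left inverse `ψ` that preserves `α = dz - y dx` and
`dα`. -/
structure IsStrictContactEmbedding (φ ψ : R3 → R3) : Prop where
  contDiff : ContDiff ℝ (⊤ : ℕ∞) φ
  contDiff_inverse : ContDiff ℝ (⊤ : ℕ∞) ψ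
  leftInverse : Function.LeftInverse ψ φ
  map_form : ∀ p v, (fderiv ℝ φ p v).2.2 - (φ p).2.1 * (fderiv ℝ φ p v).1 = v.2.2 - p.2.1 * v.1
  map_dform : ∀ p v w, (fderiv ℝ φ p v).2.1 * (fderiv ℝ φ p w).1
    - (fderiv ℝ φ p w).2.1 * (fderiv ℝ φ p v).1 = v.2.1 * w.1 - w.2.1 * v.1

/-- The `t`-preserving extension of a self-map of `ℝ³` to the symplectization. -/
def symplLift (φ : R3 → R3) (p : R4) : R4 := (p.1, φ p.2)

namespace IsStrictContactEmbedding

variable {φ ψ : R3 → R3}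

theorem fderiv_injective (h : IsStrictContactEmbedding φ ψ) (p : R3) :
    Function.Injective (fderiv ℝ φ p) := by
  have h1 := (h.contDiff_inverse.differentiable (by simp) (φ p)).hasFDerivAt.comp p
    (h.contDiff.differentiable (by simp) p).hasFDerivAt
  rw [h.leftInverse.comp_eq_id] at h1
  have h2 := h1.unique (hasFDerivAt_id p)
  refine Function.LeftInverse.injective (g := fderiv ℝ ψ (φ p)) fun v => ?_
  simpa using congrArg (fun L => L v) h2

theorem contDiff_symplLift (h : IsStrictContactEmbedding φ ψ) :
    ContDiff ℝ (⊤ : ℕ∞) (symplLift φ) :=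
  contDiff_fst.prodMk (h.contDiff.comp contDiff_snd)

theorem leftInverse_symplLift (h : IsStrictContactEmbedding φ ψ) :
    Function.LeftInverse (symplLift ψ) (symplLift φ) :=
  fun p => Prod.ext rfl (h.leftInverse p.2)

theorem fderiv_symplLift (h : IsStrictContactEmbedding φ ψ) (p v : R4) :
    fderiv ℝ (symplLift φ) p v = (v.1, fderiv ℝ φ p.2 v.2) := by
  have h1 : HasFDerivAt (symplLift φ) _ p := HasFDerivAt.prodMk hasFDerivAt_fst
    ((h.contDiff.differentiable (by simp) p.2).hasFDerivAt.comp p hasFDerivAt_snd)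
  rw [h1.fderiv]
  rfl

theorem isLagImmAt (h : IsStrictContactEmbedding φ ψ) {f : ℝ × ℝ → R4} {p : ℝ × ℝ}
    (hf : IsLagImmAt f p) : IsLagImmAt (symplLift φ ∘ f) p := by
  have hd : fderiv ℝ (symplLift φ ∘ f) p = (fderiv ℝ (symplLift φ) (f p)).comp (fderiv ℝ f p) :=
    fderiv_comp p (h.contDiff_symplLift.differentiable (by simp) _)
      (hf.1.differentiableAt (by simp))
  have hv : ∀ v, fderiv ℝ (symplLift φ ∘ f) p v
      = ((fderiv ℝ f p v).1, fderiv ℝ φ (f p).2 (fderiv ℝ f p v).2) := fun v => by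
    rw [hd, ContinuousLinearMap.comp_apply, h.fderiv_symplLift]
  refine ⟨h.contDiff_symplLift.contDiffAt.comp p hf.1, fun u v huv => hf.2.1 ?_, fun u v => ?_⟩
  · rw [hv, hv, Prod.mk.injEq] at huv
    exact Prod.ext huv.1 (h.fderiv_injective _ huv.2)
  · have e := hf.2.2 u v
    rw [hv, hv]
    have e1 := h.map_form (f p).2 (fderiv ℝ f p u).2
    have e2 := h.map_form (f p).2 (fderiv ℝ f p v).2
    have e3 := h.map_dform (f p).2 (fderiv ℝ f p u).2 (fderiv ℝ f p v).2
    simp only [symplForm, symplLift, Function.comp] at e ⊢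
    linear_combination e + Real.exp (f p).1 * ((fderiv ℝ f p u).1 * e2
      - (fderiv ℝ f p v).1 * e1 - e3)

theorem isLegendrianKnot (h : IsStrictContactEmbedding φ ψ) {γ : ℝ → R3}
    (hγ : IsLegendrianKnot γ) : IsLegendrianKnot (φ ∘ γ) := by
  obtain ⟨h1, h2, h3, h4, h5⟩ := hγ
  have hd : ∀ t, deriv (φ ∘ γ) t = fderiv ℝ φ (γ t) (deriv γ t) := fun t =>
    ((h.contDiff.differentiable (by simp) (γ t)).hasFDerivAt.comp_hasDerivAt t
      (h1.differentiable (by simp) t).hasDerivAt).deriv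
  refine ⟨h.contDiff.comp h1, fun t => congrArg φ (h2 t),
    fun t t' e => h3 t t' (h.leftInverse.injective e), fun t e => h4 t ?_, fun t => ?_⟩
  · exact (injective_iff_map_eq_zero _).1 (h.fderiv_injective (γ t)) _ ((hd t).symm.trans e)
  · have e := h.map_form (γ t) (deriv γ t)
    rw [hd, Function.comp_apply]
    linear_combination e + h5 t

theorem smoothlyUnknotted (h : IsStrictContactEmbedding φ ψ) {γ : ℝ → R3}
    (hγ : SmoothlyUnknotted γ) : SmoothlyUnknotted (φ ∘ γ) := by
  obtain ⟨G, h1, h2, h3, h4⟩ := hγ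
  refine ⟨φ ∘ G, h.contDiff.comp h1, h.leftInverse.injective.comp_injOn h2, fun p hp => ?_,
    fun θ => congrArg φ (h4 θ)⟩
  rw [fderiv_comp p (h.contDiff.differentiable (by simp) _) (h1.differentiable (by simp) _)]
  exact (h.fderiv_injective _).comp (h3 p hp)

end IsStrictContactEmbedding

theorem symplForm_smul_add (p A B : R4) (a b c d : ℝ) :
    symplForm p (a • A + b • B) (c • A + d • B) = (a * d - b * c) * symplForm p A B := by
  simp only [symplForm, Prod.fst_add, Prod.snd_add, Prod.smul_fst, Prod.smul_snd, smul_eq_mul]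
  ring

theorem ContinuousLinearMap.apply_eq_smul_add_smul {E : Type*} [NormedAddCommGroup E]
    [NormedSpace ℝ E] (L : ℝ × ℝ →L[ℝ] E) (u : ℝ × ℝ) :
    L u = u.1 • L (1, 0) + u.2 • L (0, 1) := by
  rw [← map_smul, ← map_smul, ← map_add]
  simp

theorem IsLagrangianConcordance.isLagImmAt {C : ℝ × ℝ → R4} {γ₀ γ : ℝ → R3}
    (hC : IsLagrangianConcordance C γ₀ γ) (p : ℝ × ℝ) : IsLagImmAt C p := by
  obtain ⟨h1, -, -, h4, -, h6, -⟩ := hC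
  have hd := h1.differentiable (by simp) p
  refine ⟨h1.contDiffAt, (injective_iff_map_eq_zero _).2 fun u hu => ?_, fun u v => ?_⟩
  · rw [ContinuousLinearMap.apply_eq_smul_add_smul, ← Ds_eq_fderiv hd, ← Dtheta_eq_fderiv hd] at hu
    exact Prod.ext (h4 p _ _ hu).1 (h4 p _ _ hu).2
  · rw [ContinuousLinearMap.apply_eq_smul_add_smul _ u,
      ContinuousLinearMap.apply_eq_smul_add_smul _ v, ← Ds_eq_fderiv hd, ← Dtheta_eq_fderiv hd,
      symplForm_smul_add, h6, mul_zero]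

namespace IsStrictContactEmbedding

variable {φ ψ : R3 → R3}

theorem isLagrangianConcordance (h : IsStrictContactEmbedding φ ψ) {C : ℝ × ℝ → R4}
    {γ₀ γ : ℝ → R3} (hC : IsLagrangianConcordance C γ₀ γ) :
    IsLagrangianConcordance (symplLift φ ∘ C) (φ ∘ γ₀) (φ ∘ γ) := by
  have hI := hC.isLagImmAt
  obtain ⟨-, h2, h3, -, -, -, T, hT, hlow, hup⟩ := hC
  refine isLagrangianConcordance_of_isLagImmAt (fun p => h.isLagImmAt (hI p))
    (fun s θ => congrArg (symplLift φ) (h2 s θ))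
    (fun s θ s' θ' e => h3 _ _ _ _ (h.leftInverse_symplLift.injective e))
    ⟨T, hT, fun s θ hs => ?_, fun s θ hs => ?_⟩
  · rw [Function.comp_apply, hlow s θ hs]; rfl
  · rw [Function.comp_apply, hup s θ hs]; rfl

theorem isLagrangianDiscFilling (h : IsStrictContactEmbedding φ ψ) {F : ℝ × ℝ → R4}
    {γ : ℝ → R3} (hF : IsLagrangianDiscFilling F γ) :
    IsLagrangianDiscFilling (symplLift φ ∘ F) (φ ∘ γ) := by
  have hI := hF.isLagImmAt
  obtain ⟨h1, h2, h3, -, -, R, hR, hend⟩ := hF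
  refine ⟨h.contDiff_symplLift.comp h1, h.leftInverse_symplLift.injective.comp h2,
    fun K hK => ?_, fun p => (h.isLagImmAt (hI p)).2.1, fun p => (h.isLagImmAt (hI p)).2.2,
    R, hR, fun r θ hr => ?_⟩
  · obtain ⟨M, hM⟩ := h3 (symplLift ψ '' K) (hK.image
      (continuous_fst.prodMk (h.contDiff_inverse.continuous.comp continuous_snd)))
    exact ⟨M, fun p hp => hM p ⟨_, hp, h.leftInverse_symplLift _⟩⟩
  · rw [Function.comp_apply, hend r θ hr]; rfl

end IsStrictContactEmbedding

/-- Existence of a Lagrangian concordance to `γ` from a smoothly unknotted Legendrian knot. -/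
def ConcordantFromUnknot (γ : ℝ → R3) : Prop :=
  ∃ (γ₀ : ℝ → R3) (C : ℝ × ℝ → R4),
    IsLegendrianKnot γ₀ ∧ SmoothlyUnknotted γ₀ ∧ IsLagrangianConcordance C γ₀ γ

theorem ConcordantFromUnknot.of_comp {φ ψ : R3 → R3} (hφ : IsStrictContactEmbedding ψ φ)
    (h : Function.LeftInverse ψ φ) {γ : ℝ → R3} (hγ : ConcordantFromUnknot (φ ∘ γ)) :
    ConcordantFromUnknot γ := by
  obtain ⟨γ₀, C, h1, h2, h3⟩ := hγ
  have h4 := hφ.isLagrangianConcordance h3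
  rw [← Function.comp_assoc, h.comp_eq_id, Function.id_comp] at h4
  exact ⟨_, _, hφ.isLegendrianKnot h1, hφ.smoothlyUnknotted h2, h4⟩

/-- The Heisenberg translation of `(ℝ³, dz - y dx)` moving `a` to the origin. -/
def contactTranslation (a p : R3) : R3 :=
  (p.1 - a.1, p.2.1 - a.2.1, p.2.2 - a.2.2 - a.2.1 * (p.1 - a.1))

/-- The strict contactomorphism of `(ℝ³, dz - y dx)` lifting the linear map
`(x, y) ↦ (c x + s y, -s x + c y)`. -/
def contactRotation (c s : ℝ) (p : R3) : R3 :=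
  (c * p.1 + s * p.2.1, -s * p.1 + c * p.2.1,
    p.2.2 + (-(s * c) * p.1 ^ 2 / 2 + c * s * p.2.1 ^ 2 / 2 - s ^ 2 * (p.1 * p.2.1)))

theorem isStrictContactEmbedding_translation (a : R3) :
    IsStrictContactEmbedding (contactTranslation a)
      (contactTranslation (-a.1, -a.2.1, -a.2.2 + a.2.1 * a.1)) := by
  have hs : ∀ a, ContDiff ℝ (⊤ : ℕ∞) (contactTranslation a) := fun a => by
    unfold contactTranslation; fun_prop
  have hd : ∀ p v, fderiv ℝ (contactTranslation a) p v = (v.1, v.2.1, v.2.2 - a.2.1 * v.1) := by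
    intro p v
    have h1 : HasFDerivAt (fun p : R3 => p.1) (ContinuousLinearMap.fst ℝ ℝ (ℝ × ℝ)) p :=
      hasFDerivAt_fst
    have h2 : HasFDerivAt (fun p : R3 => p.2) (ContinuousLinearMap.snd ℝ ℝ (ℝ × ℝ)) p :=
      hasFDerivAt_snd
    have h : HasFDerivAt (contactTranslation a) _ p := (h1.sub_const a.1).prodMk
      ((h2.fst.sub_const a.2.1).prodMk
        ((h2.snd.sub_const a.2.2).sub ((h1.sub_const a.1).const_mul a.2.1)))
    rw [h.fderiv]
    simp
  refine ⟨hs a, hs _, fun p => ?_, fun p v => ?_, fun p v w => ?_⟩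
  · simp only [contactTranslation]
    exact Prod.ext (by ring) (Prod.ext (by ring) (by ring))
  · rw [hd]; simp only [contactTranslation]; ring
  · rw [hd, hd]

theorem fderiv_contactRotation (c s : ℝ) (p v : R3) :
    fderiv ℝ (contactRotation c s) p v = (c * v.1 + s * v.2.1,
      -s * v.1 + c * v.2.1, v.2.2 + (-(s * c) * p.1 * v.1 + c * s * p.2.1 * v.2.1
        - s ^ 2 * (p.1 * v.2.1 + v.1 * p.2.1))) := by
  have h1 : HasFDerivAt (fun p : R3 => p.1) (ContinuousLinearMap.fst ℝ ℝ (ℝ × ℝ)) p :=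
    hasFDerivAt_fst
  have h2 : HasFDerivAt (fun p : R3 => p.2) (ContinuousLinearMap.snd ℝ ℝ (ℝ × ℝ)) p :=
    hasFDerivAt_snd
  have h3 := h2.fst
  have h : HasFDerivAt (contactRotation c s) _ p := ((h1.const_mul c).add (h3.const_mul s)).prodMk
    (((h1.const_mul (-s)).add (h3.const_mul c)).prodMk
      (h2.snd.add (((((h1.pow 2).const_mul (-(s * c))).mul_const (2 : ℝ)⁻¹).add
        (((h3.pow 2).const_mul (c * s)).mul_const (2 : ℝ)⁻¹)).sub
          ((h1.mul h3).const_mul (s ^ 2)))))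
  rw [h.fderiv]
  simp
  ring

theorem isStrictContactEmbedding_rotation {c s : ℝ} (hcs : c ^ 2 + s ^ 2 = 1) :
    IsStrictContactEmbedding (contactRotation c s) (contactRotation c (-s)) := by
  have hs : ∀ s, ContDiff ℝ (⊤ : ℕ∞) (contactRotation c s) := fun s => by
    unfold contactRotation; fun_prop
  refine ⟨hs s, hs _, fun p => ?_, fun p v => ?_, fun p v w => ?_⟩
  · simp only [contactRotation]
    refine Prod.ext ?_ (Prod.ext ?_ ?_)
    · linear_combination p.1 * hcs
    · linear_combination p.2.1 * hcs
    · linear_combination (s * c / 2 * (p.1 ^ 2 - p.2.1 ^ 2) + s ^ 2 * (p.1 * p.2.1)) * hcs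
  · rw [fderiv_contactRotation]
    simp only [contactRotation]
    linear_combination -(p.2.1 * v.1) * hcs
  · rw [fderiv_contactRotation, fderiv_contactRotation]
    linear_combination (v.2.1 * w.1 - w.2.1 * v.1) * hcs

theorem IsLagrangianDiscFilling.comp_isCptDiffeo {F : ℝ × ℝ → R4} {γ : ℝ → R3}
    (hF : IsLagrangianDiscFilling F γ) {Φ : ℝ × ℝ → ℝ × ℝ} (hΦ : IsCptDiffeo Φ) :
    IsLagrangianDiscFilling (F ∘ Φ) γ := by
  have hI : ∀ p, IsLagImmAt (F ∘ Φ) p := fun p =>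
    (hF.isLagImmAt (Φ p)).comp hΦ.contDiff.contDiffAt (hΦ.immersion p)
  obtain ⟨h1, h2, h3, -, -, R, hR, hend⟩ := hF
  obtain ⟨R₁, hR₁⟩ := hΦ.eq_self
  refine ⟨h1.comp hΦ.contDiff, h2.comp hΦ.injective, fun K hK => ?_, fun p => (hI p).2.1,
    fun p => (hI p).2.2, max R (2 * R₁), lt_max_of_lt_left hR, fun r θ hr => ?_⟩
  · obtain ⟨M, hM⟩ := h3 K hK
    refine ⟨max M R₁, fun p hp => ?_⟩
    rcases le_total R₁ ‖p‖ with h | h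
    · have := hM _ hp
      rw [hR₁ p h] at this
      exact this.trans (le_max_left _ _)
    · exact h.trans (le_max_right _ _)
  · obtain ⟨hr1, hr2⟩ := max_le_iff.1 hr
    have h4 := exp_div_two_le_norm_expPolar (Real.log r, θ)
    simp only [expPolar, Real.exp_log (hR.trans_le hr1)] at h4
    rw [Function.comp_apply, hR₁ _ (by linarith), hend r θ hr1]

theorem IsLagrangianDiscFilling.exists_isMin {F : ℝ × ℝ → R4} {γ : ℝ → R3}
    (hF : IsLagrangianDiscFilling F γ) : ∃ p, ∀ u, (F p).1 ≤ (F u).1 := by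
  obtain ⟨h1, -, -, -, -, R, hR, hend⟩ := hF
  refine (continuous_fst.comp h1.continuous).exists_forall_le' 0 ?_
  filter_upwards [(tendsto_norm_cocompact_atTop (E := ℝ × ℝ)).eventually_ge_atTop
    (max R (Real.exp (F 0).1))] with u hu
  let w : ℂ := ⟨u.1, u.2⟩
  have hw : max R (Real.exp (F 0).1) ≤ ‖w‖ :=
    hu.trans (max_le (Complex.abs_re_le_norm w) (Complex.abs_im_le_norm w))
  obtain ⟨hw1, hw2⟩ := max_le_iff.1 hw
  have hu' : u = (‖w‖ * Real.cos w.arg, ‖w‖ * Real.sin w.arg) := by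
    rw [Complex.norm_mul_cos_arg, Complex.norm_mul_sin_arg]
  rw [Function.comp_apply, Function.comp_apply, hu', hend _ _ hw1]
  exact (Real.le_log_iff_exp_le (hR.trans_le hw1)).2 hw2

section Minimum

variable {F : ℝ × ℝ → R4} {γ : ℝ → R3} {p₀ : ℝ × ℝ} {t₀ : ℝ}

/-- A filling whose `t`-coordinate is minimal at `p₀`, and whose projection to the
`(z, x)`-plane is an orientation preserving local diffeomorphism there. -/
theorem IsLagrangianDiscFilling.concordantFromUnknot_of_pos (hF : IsLagrangianDiscFilling F γ)
    (h0 : F p₀ = (t₀, 0, 0, 0)) (hmin : ∀ u, t₀ ≤ (F u).1)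
    (hdet : 0 < (fderiv ℝ F p₀ (1, 0)).2.2.2 * (fderiv ℝ F p₀ (0, 1)).2.1
      - (fderiv ℝ F p₀ (0, 1)).2.2.2 * (fderiv ℝ F p₀ (1, 0)).2.1) :
    ConcordantFromUnknot γ := by
  have hs := hF.1
  let q : ℝ × ℝ → ℝ × ℝ := fun u => ((F u).2.2.2, (F u).2.1)
  have hd : ∀ v, fderiv ℝ q p₀ v = ((fderiv ℝ F p₀ v).2.2.2, (fderiv ℝ F p₀ v).2.1) := fun v => by
    have h := (hs.differentiable (by simp) p₀).hasFDerivAt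
    have h' : HasFDerivAt q _ p₀ := h.snd.snd.snd.prodMk h.snd.fst
    rw [h'.fderiv]
    rfl
  obtain ⟨Φ, hΦ, hΦ0, hq⟩ := exists_straightening (q := q) (p₀ := p₀) (by fun_prop)
    (by simp [q, h0]) (by simpa only [hd] using hdet)
  exact exists_concordance_of_graph_at_min (hF.comp_isCptDiffeo hΦ) (t₀ := t₀)
    (by rw [Function.comp_apply, hΦ0, h0]) (fun u => hmin (Φ u))
    (hq.mono fun u hu => ⟨congrArg Prod.fst hu, congrArg Prod.snd hu⟩)

theorem IsLagrangianDiscFilling.concordantFromUnknot_of_min (hF : IsLagrangianDiscFilling F γ)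
    (h0 : F p₀ = (t₀, 0, 0, 0)) (hmin : ∀ u, t₀ ≤ (F u).1) : ConcordantFromUnknot γ := by
  obtain ⟨-, hinj, hlag⟩ := hF.isLagImmAt p₀
  have hdF := (hF.1.differentiable (by simp) p₀).hasFDerivAt
  have ht : ∀ v, (fderiv ℝ F p₀ v).1 = 0 := fun v => by
    have hlm : IsLocalMin (fun u => (F u).1) p₀ :=
      Eventually.of_forall fun u => by simpa [h0] using hmin u
    exact congrArg (fun L => L v) (hlm.hasFDerivAt_eq_zero hdF.fst)
  set A := fderiv ℝ F p₀ (1, 0) with hA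
  set B := fderiv ℝ F p₀ (0, 1) with hB
  have hAt : A.1 = 0 := ht _
  have hBt : B.1 = 0 := ht _
  have hl : A.2.2.1 * B.2.1 - B.2.2.1 * A.2.1 = 0 := by
    have := hlag (1, 0) (0, 1)
    simp only [symplForm, ← hA, ← hB, hAt, hBt, mul_eq_zero, (Real.exp_pos _).ne'] at this
    linarith [this.resolve_left id]
  set m := A.2.2.2 * B.2.1 - B.2.2.2 * A.2.1 with hm
  set n := A.2.2.2 * B.2.2.1 - B.2.2.2 * A.2.2.1 with hn
  have hpos : 0 < m ^ 2 + n ^ 2 := by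
    by_contra! hle
    have hm0 : m = 0 := by nlinarith [sq_nonneg m, sq_nonneg n]
    have hn0 : n = 0 := by nlinarith [sq_nonneg m, sq_nonneg n]
    have key : ∀ a b : ℝ, a • A + b • B = 0 → a = 0 ∧ b = 0 := fun a b h => by
      have := (injective_iff_map_eq_zero _).1 hinj (a, b)
        (by rw [ContinuousLinearMap.apply_eq_smul_add_smul]; exact h)
      simpa using this
    have e1 := key B.2.1 (-A.2.1) (by
      refine Prod.ext ?_ (Prod.ext ?_ (Prod.ext ?_ ?_)) <;>
        simp only [Prod.fst_add, Prod.snd_add, Prod.smul_fst, Prod.smul_snd, smul_eq_mul, hAt, hBt,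
          Prod.fst_zero, Prod.snd_zero] <;> linarith)
    have e2 := key B.2.2.1 (-A.2.2.1) (by
      refine Prod.ext ?_ (Prod.ext ?_ (Prod.ext ?_ ?_)) <;>
        simp only [Prod.fst_add, Prod.snd_add, Prod.smul_fst, Prod.smul_snd, smul_eq_mul, hAt, hBt,
          Prod.fst_zero, Prod.snd_zero] <;> linarith)
    have e3 := key B.2.2.2 (-A.2.2.2) (by
      refine Prod.ext ?_ (Prod.ext ?_ (Prod.ext ?_ ?_)) <;>
        simp only [Prod.fst_add, Prod.snd_add, Prod.smul_fst, Prod.smul_snd, smul_eq_mul, hAt, hBt,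
          Prod.fst_zero, Prod.snd_zero] <;> linarith)
    have e4 := key 1 0 (by
      refine Prod.ext ?_ (Prod.ext ?_ (Prod.ext ?_ ?_)) <;>
        simp only [Prod.fst_add, Prod.snd_add, Prod.smul_fst, Prod.smul_snd, smul_eq_mul, hAt, hBt,
          Prod.fst_zero, Prod.snd_zero] <;> linarith [e1.2, e2.2, e3.2])
    exact one_ne_zero e4.1
  set ρ := √(m ^ 2 + n ^ 2)
  have hρ : 0 < ρ := Real.sqrt_pos.2 hpos
  have hρ2 : ρ ^ 2 = m ^ 2 + n ^ 2 := Real.sq_sqrt hpos.le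
  have hcs : (m / ρ) ^ 2 + (n / ρ) ^ 2 = 1 := by
    field_simp
    exact hρ2.symm
  have hcs' : (m / ρ) ^ 2 + (-(n / ρ)) ^ 2 = 1 := by rw [neg_sq, hcs]
  have hrot := isStrictContactEmbedding_rotation hcs
  have hrot' := isStrictContactEmbedding_rotation hcs'
  rw [neg_neg] at hrot'
  refine ConcordantFromUnknot.of_comp hrot' hrot.leftInverse
    ((hrot.isLagrangianDiscFilling hF).concordantFromUnknot_of_pos (p₀ := p₀) (t₀ := t₀)
      (by simp [symplLift, contactRotation, h0]) hmin ?_)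
  have hd : ∀ v, fderiv ℝ (symplLift (contactRotation (m / ρ) (n / ρ)) ∘ F) p₀ v =
      ((fderiv ℝ F p₀ v).1, fderiv ℝ (contactRotation (m / ρ) (n / ρ)) 0 (fderiv ℝ F p₀ v).2) := by
    intro v
    rw [fderiv_comp p₀ (hrot.contDiff_symplLift.differentiable (by simp) _) hdF.differentiableAt,
      ContinuousLinearMap.comp_apply, hrot.fderiv_symplLift, h0]
    rfl
  rw [hd, hd, ← hA, ← hB]
  simp only [fderiv_contactRotation, Prod.fst_zero, Prod.snd_zero]
  have : m / ρ * m + n / ρ * n = ρ := by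
    field_simp
    linarith
  nlinarith

end Minimum

theorem IsLagrangianDiscFilling.concordantFromUnknot {F : ℝ × ℝ → R4} {γ : ℝ → R3}
    (hF : IsLagrangianDiscFilling F γ) : ConcordantFromUnknot γ := by
  obtain ⟨p₀, hmin⟩ := hF.exists_isMin
  set a := (F p₀).2 with ha
  have h := isStrictContactEmbedding_translation a
  have h' := isStrictContactEmbedding_translation (-a.1, -a.2.1, -a.2.2 + a.2.1 * a.1)
  have e : (-(-a.1), -(-a.2.1), -(-a.2.2 + a.2.1 * a.1) + -a.2.1 * -a.1) = a :=
    Prod.ext (by ring) (Prod.ext (by ring) (by ring))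
  rw [e] at h'
  exact ConcordantFromUnknot.of_comp h' h.leftInverse
    ((h.isLagrangianDiscFilling hF).concordantFromUnknot_of_min (p₀ := p₀) (t₀ := (F p₀).1)
      (by simp [symplLift, contactTranslation, ← ha]) hmin)

end Construction

/-- If a Legendrian knot `γ` in the standard contact `ℝ³` admits a
Lagrangian disc filling, then there exist a smoothly unknotted Legendrian knot `γ₀` and a
Lagrangian concordance from `γ₀` to `γ`. -/
theorem lagrangian_disc_filling_yields_concordance_from_unknot
    (γ : ℝ → R3) (hγ : IsLegendrianKnot γ)
    (F : ℝ × ℝ → R4) (hF : IsLagrangianDiscFilling F γ) :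
    ∃ (γ₀ : ℝ → R3) (C : ℝ × ℝ → R4),
      IsLegendrianKnot γ₀ ∧ SmoothlyUnknotted γ₀ ∧
      IsLagrangianConcordance C γ₀ γ :=
  hF.concordantFromUnknot
end
end
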